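/- Every group of F-type is conjugacy separable; in particular, every group of F-type is residually finite and Hopfian. -/

import Mathlib

open scoped MatrixGroups

namespace FPaper

/-- A (reduced) word in a free group is *cyclically reduced* if its first letter is not the
formal inverse of its last letter. -/
def CyclicallyReduced {α : Type*} [DecidableEq α] (w : FreeGroup α) : Prop :=
  ∀ x y : α × Bool, w.toWord.head? = some x → w.toWord.getLast? = some y →
    x.1 = y.1 → x.2 = y.2

/-- The combinatorial data of a presentation of F-type:
`⟨a_1, …, a_n ∣ a_1^{e_1} = ⋯ = a_n^{e_n} = U V = 1⟩` with
`U = U(a_1, …, a_p)` and `V = V(a_{p+1}, …, a_n)`. -/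
structure FTypeBase where
  n : ℕ
  e : Fin n → ℕ
  p : ℕ
  U : FreeGroup (Fin n)
  V : FreeGroup (Fin n)

namespace FTypeBase

/-- Relators of the full F-type presentation. -/
def rels (D : FTypeBase) : Set (FreeGroup (Fin D.n)) :=
  {w | ∃ i : Fin D.n, w = FreeGroup.of i ^ D.e i} ∪ {D.U * D.V}

/-- Relators presenting the first factor `G₁` (the generators `a_{p+1}, …, a_n` are killed), so
that `PresentedGroup D.rels1` is the free product of cyclics on `a_1, …, a_p`. -/
def rels1 (D : FTypeBase) : Set (FreeGroup (Fin D.n)) :=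
  {w | ∃ i : Fin D.n, (i : ℕ) < D.p ∧ w = FreeGroup.of i ^ D.e i} ∪
    {w | ∃ i : Fin D.n, D.p ≤ (i : ℕ) ∧ w = FreeGroup.of i}

/-- Relators presenting the second factor `G₂` (the generators `a_1, …, a_p` are killed), so
that `PresentedGroup D.rels2` is the free product of cyclics on `a_{p+1}, …, a_n`. -/
def rels2 (D : FTypeBase) : Set (FreeGroup (Fin D.n)) :=
  {w | ∃ i : Fin D.n, D.p ≤ (i : ℕ) ∧ w = FreeGroup.of i ^ D.e i} ∪
    {w | ∃ i : Fin D.n, (i : ℕ) < D.p ∧ w = FreeGroup.of i}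

/-- The group presented by the F-type presentation. -/
abbrev Gp (D : FTypeBase) := PresentedGroup D.rels

/-- The first factor `G₁ = ⟨a_1, …, a_p ∣ a_1^{e_1} = ⋯ = a_p^{e_p} = 1⟩`. -/
abbrev Gp1 (D : FTypeBase) := PresentedGroup D.rels1

/-- The second factor `G₂ = ⟨a_{p+1}, …, a_n ∣ a_{p+1}^{e_{p+1}} = ⋯ = a_n^{e_n} = 1⟩`. -/
abbrev Gp2 (D : FTypeBase) := PresentedGroup D.rels2

/-- The image of the word `U` in the first factor `G₁`. -/
def imgU1 (D : FTypeBase) : D.Gp1 := PresentedGroup.mk D.rels1 D.U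

/-- The image of the word `V` in the second factor `G₂`. -/
def imgV2 (D : FTypeBase) : D.Gp2 := PresentedGroup.mk D.rels2 D.V

/-- The conditions making an F-type presentation: `n ≥ 2`; each `e_i` is `0` or `≥ 2`;
`1 ≤ p ≤ n - 1`; `U` is a cyclically reduced word in `a_1, …, a_p` of infinite order in `G₁`;
`V` is a cyclically reduced word in `a_{p+1}, …, a_n` of infinite order in `G₂`; and if
`p = 1` (resp. `p = n - 1`) then `U = a_1^m` (resp. `V = a_n^m`) for some `m ≥ 2`. -/
def IsFType (D : FTypeBase) : Prop :=
  2 ≤ D.n ∧ (∀ i, D.e i = 0 ∨ 2 ≤ D.e i) ∧ 1 ≤ D.p ∧ D.p ≤ D.n - 1 ∧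
  (∀ x ∈ D.U.toWord, (x.1 : ℕ) < D.p) ∧ (∀ x ∈ D.V.toWord, D.p ≤ (x.1 : ℕ)) ∧
  CyclicallyReduced D.U ∧ CyclicallyReduced D.V ∧
  ¬ IsOfFinOrder D.imgU1 ∧ ¬ IsOfFinOrder D.imgV2 ∧
  (D.p = 1 → ∃ (i : Fin D.n) (m : ℕ), (i : ℕ) = 0 ∧ 2 ≤ m ∧ D.U = FreeGroup.of i ^ m) ∧
  (D.p = D.n - 1 → ∃ (i : Fin D.n) (m : ℕ), (i : ℕ) = D.n - 1 ∧ 2 ≤ m ∧ D.V = FreeGroup.of i ^ m)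

/-- The subgroup of the F-type group generated by (the images of) `a_1, …, a_p`. -/
def factor1 (D : FTypeBase) : Subgroup D.Gp :=
  Subgroup.closure {g | ∃ i : Fin D.n, (i : ℕ) < D.p ∧ g = PresentedGroup.of i}

/-- The subgroup of the F-type group generated by (the images of) `a_{p+1}, …, a_n`. -/
def factor2 (D : FTypeBase) : Subgroup D.Gp :=
  Subgroup.closure {g | ∃ i : Fin D.n, D.p ≤ (i : ℕ) ∧ g = PresentedGroup.of i}

/-- The amalgamated subgroup `A = ⟨U⟩ = ⟨V⟩` of the F-type group. -/
def amalg (D : FTypeBase) : Subgroup D.Gp :=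
  Subgroup.zpowers (PresentedGroup.mk D.rels D.U)

end FTypeBase

/-- A group is *of F-type* if it is isomorphic to the group of some F-type presentation. -/
def IsFTypeGroup (G : Type*) [Group G] : Prop :=
  ∃ D : FTypeBase, D.IsFType ∧ Nonempty (G ≃* D.Gp)

/-- An element of a group is a *proper power* if it equals `h ^ k` for some `k ≥ 2`. -/
def IsProperPower {G : Type*} [Group G] (g : G) : Prop :=
  ∃ (h : G) (k : ℕ), 2 ≤ k ∧ g = h ^ k

/-- A group is a *free product of cyclic groups* if it has a presentation in which every
relator is a power of a generator. -/
def IsFreeProductOfCyclics (H : Type*) [Group H] : Prop :=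
  ∃ (ι : Type) (e : ι → ℕ),
    Nonempty (H ≃* PresentedGroup {w : FreeGroup ι | ∃ i : ι, w = FreeGroup.of i ^ e i})

/-- A subgroup `K` of `H` is *malnormal* if `g K g⁻¹ ∩ K = {1}` for every `g ∉ K`. -/
def IsMalnormal {H : Type*} [Group H] (K : Subgroup H) : Prop :=
  ∀ g : H, g ∉ K → ∀ x ∈ K, g * x * g⁻¹ ∈ K → x = 1

end FPaper

namespace FPaper

/-- A group is *conjugacy separable* if any two non-conjugate elements remain non-conjugate in
some finite quotient. -/
def ConjugacySeparable (H : Type*) [Group H] : Prop :=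
  ∀ g h : H, ¬ IsConj g h →
    ∃ (Q : Type) (_ : Group Q), Finite Q ∧
      ∃ φ : H →* Q, Function.Surjective φ ∧ ¬ IsConj (φ g) (φ h)

/-- A group is *residually finite* if every non-trivial element has non-trivial image in some
finite quotient. -/
def ResiduallyFinite (H : Type*) [Group H] : Prop :=
  ∀ g : H, g ≠ 1 →
    ∃ (Q : Type) (_ : Group Q), Finite Q ∧ ∃ φ : H →* Q, φ g ≠ 1

/-- A group is *Hopfian* if every surjective endomorphism is an automorphism. -/
def Hopfian (H : Type*) [Group H] : Prop :=
  ∀ φ : H →* H, Function.Surjective φ → Function.Injective φ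

/-- The filter of small subgroups in the profinite topology: a set of subgroups is large if it
contains all subgroups of some normal subgroup of finite index. -/
def profin (A : Type*) [Group A] : Filter (Subgroup A) where
  sets := {S | ∃ N₀ : Subgroup A, N₀.Normal ∧ N₀.FiniteIndex ∧ ∀ N ≤ N₀, N ∈ S}
  univ_sets := ⟨⊤, inferInstance, inferInstance, fun _ _ => trivial⟩
  sets_of_superset := by
    rintro S T ⟨N₀, h1, h2, h3⟩ hST
    exact ⟨N₀, h1, h2, fun N hN => hST (h3 N hN)⟩
  inter_sets := by
    rintro S T ⟨N₀, h1, h2, h3⟩ ⟨N₁, k1, k2, k3⟩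
    exact ⟨N₀ ⊓ N₁, inferInstance, inferInstance, fun N hN =>
      ⟨h3 N (hN.trans inf_le_left), k3 N (hN.trans inf_le_right)⟩⟩

theorem eventually_profin {A : Type*} [Group A] {P : Subgroup A → Prop} :
    (∀ᶠ N in profin A, P N) ↔
      ∃ N₀ : Subgroup A, N₀.Normal ∧ N₀.FiniteIndex ∧ ∀ N ≤ N₀, P N := Iff.rfl

theorem eventually_le_of_finiteIndex {A : Type*} [Group A] (K : Subgroup A) [K.FiniteIndex] :
    ∀ᶠ N in profin A, N ≤ K :=
  eventually_profin.2 ⟨K.normalCore, inferInstance, inferInstance,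
    fun _ hN => hN.trans K.normalCore_le⟩

theorem eventually_le_ker {A Q : Type*} [Group A] [Group Q] [Finite Q] (φ : A →* Q) :
    ∀ᶠ N in profin A, N ≤ φ.ker := eventually_le_of_finiteIndex _

/-- Separability properties of an element `u` of infinite order in a group `A` which guarantee
that amalgamating along `⟨u⟩` preserves conjugacy separability. -/
structure Nice (A : Type*) [Group A] (u : A) : Prop where
  pot : ∀ N₀ : Subgroup A, N₀.Normal → N₀.FiniteIndex → ∃ s₀ : ℕ, 0 < s₀ ∧ ∀ s' : ℕ, 0 < s' →
    ∃ N ≤ N₀, N.Normal ∧ N.FiniteIndex ∧ ∀ i : ℤ, u ^ i ∈ N ↔ ((s₀ * s' : ℕ) : ℤ) ∣ i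
  dc : ∀ (x y : A) (t : ℕ), 0 < t → ∀ᶠ N in profin A, ∀ α β : ℤ, x⁻¹ * (u ^ α * y * u ^ β) ∈ N →
    ∃ α' β' : ℤ, (t : ℤ) ∣ α - α' ∧ (t : ℤ) ∣ β - β' ∧ x = u ^ α' * y * u ^ β'
  conj : ∀ a a' : A, ¬ IsConj a a' → ∀ᶠ N in profin A, ∀ y : A, a'⁻¹ * (y * a * y⁻¹) ∉ N
  free : ∀ a : A, (∀ (y : A) (l : ℤ), a ≠ y * u ^ l * y⁻¹) → ∃ p : ℕ, p.Prime ∧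
    ∀ᶠ N in profin A, ∀ (i l : ℤ) (y : A), (a ^ i)⁻¹ * (y * u ^ l * y⁻¹) ∈ N → (p : ℤ) ∣ i
  inv : ∀ l : ℤ, l ≠ 0 → ¬ IsConj (u ^ l) (u ^ (-l)) → ∀ q : ℕ, 0 < q → ∀ᶠ N in profin A,
    ∀ (i j : ℤ) (y : A), (u ^ i)⁻¹ * (y * u ^ j * y⁻¹) ∈ N → (q : ℤ) ∣ i - j

/-- A permutation all of whose cycles have length `s` is a product of `Ω` with rotation of
`ZMod s`; the base point of each cycle can be prescribed. -/
theorem exists_cycle_coordinates {X J : Type} (σ : Equiv.Perm X) (s : ℕ)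
    (hσ : ∀ x (i : ℤ), (σ ^ i) x = x ↔ (s : ℤ) ∣ i) (x : J → X)
    (hx : ∀ j k, σ.SameCycle (x j) (x k) → j = k) :
    ∃ (Ω : Type) (e : Ω × ZMod s ≃ X) (ω : J → Ω), Function.Injective ω ∧
      (∀ a i, e (a, i + 1) = σ (e (a, i))) ∧ ∀ j, e (ω j, 0) = x j := by
  classical
  let st := Equiv.Perm.SameCycle.setoid σ
  have hsec : ∀ a : Quotient st, ∃ z : X, Quotient.mk st z = a ∧
      ∀ j, Quotient.mk st (x j) = a → z = x j := by
    intro a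
    by_cases h : ∃ j, Quotient.mk st (x j) = a
    · obtain ⟨j, hj⟩ := h
      refine ⟨x j, hj, fun k hk => ?_⟩
      rw [hx j k (Quotient.exact (hj.trans hk.symm))]
    · obtain ⟨z, hz⟩ := Quotient.exists_rep a
      exact ⟨z, hz, fun j hj => (h ⟨j, hj⟩).elim⟩
  choose sec hsec1 hsec2 using hsec
  let f : Quotient st × ZMod s → X := fun p => (σ ^ (p.2.cast : ℤ)) (sec p.1)
  have hf : ∀ a (k : ℤ), f (a, (k : ZMod s)) = (σ ^ k) (sec a) := by
    intro a k
    have h1 : (s : ℤ) ∣ k - ((k : ZMod s).cast : ℤ) := by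
      rw [← ZMod.intCast_eq_intCast_iff_dvd_sub]; simp
    have h2 := (hσ (sec a) _).2 h1
    change (σ ^ ((k : ZMod s).cast : ℤ)) (sec a) = _
    conv_rhs => rw [show k = ((k : ZMod s).cast : ℤ) + (k - ((k : ZMod s).cast : ℤ)) by ring,
      zpow_add, Equiv.Perm.mul_apply, h2]
  have hbij : Function.Bijective f := by
    constructor
    · rintro ⟨a, i⟩ ⟨b, j⟩ h
      obtain ⟨i, rfl⟩ := ZMod.intCast_surjective i
      obtain ⟨j, rfl⟩ := ZMod.intCast_surjective j
      rw [hf, hf] at h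
      have hab : a = b := by
        rw [← hsec1 a, ← hsec1 b]
        apply Quotient.sound
        refine ⟨-j + i, ?_⟩
        rw [zpow_add, Equiv.Perm.mul_apply, h, ← Equiv.Perm.mul_apply, ← zpow_add]
        simp
      subst hab
      have : (s : ℤ) ∣ -j + i := by
        rw [← hσ (sec a), zpow_add, Equiv.Perm.mul_apply, h, ← Equiv.Perm.mul_apply, ← zpow_add]
        simp
      ext
      · rfl
      · simp only
        rw [eq_comm, ZMod.intCast_eq_intCast_iff_dvd_sub]
        convert this using 1; ring
    · intro z
      obtain ⟨k, hk⟩ : σ.SameCycle (sec (Quotient.mk st z)) z :=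
        Quotient.exact (hsec1 (Quotient.mk st z))
      exact ⟨(Quotient.mk st z, (k : ZMod s)), by rw [hf, hk]⟩
  refine ⟨Quotient st, Equiv.ofBijective f hbij, fun j => Quotient.mk st (x j), ?_, ?_, ?_⟩
  · intro j k h
    exact hx j k (Quotient.exact h)
  · intro a i
    obtain ⟨i, rfl⟩ := ZMod.intCast_surjective i
    have := hf a (i + 1)
    push_cast at this
    change f _ = σ (f _)
    rw [this, hf, add_comm, zpow_add, Equiv.Perm.mul_apply, zpow_one]
  · intro j
    change f _ = _
    have := hf (Quotient.mk st (x j)) 0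
    simp only [Int.cast_zero, zpow_zero, Equiv.Perm.one_apply] at this
    rw [this]
    exact hsec2 _ _ rfl

/-- Two permutations of equipotent finite sets, all of whose cycles have the same length, are
conjugate, by a bijection with prescribed values on representatives of distinct cycles. -/
theorem exists_equiv_semiconj {X Y J : Type} [Finite X] [Finite Y] (σ : Equiv.Perm X)
    (τ : Equiv.Perm Y) (s : ℕ) (hs : 0 < s) (hσ : ∀ x (i : ℤ), (σ ^ i) x = x ↔ (s : ℤ) ∣ i)
    (hτ : ∀ x (i : ℤ), (τ ^ i) x = x ↔ (s : ℤ) ∣ i) (hcard : Nat.card X = Nat.card Y)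
    (x : J → X) (y : J → Y) (hx : ∀ j k, σ.SameCycle (x j) (x k) → j = k)
    (hy : ∀ j k, τ.SameCycle (y j) (y k) → j = k) :
    ∃ θ : X ≃ Y, (∀ z, θ (σ z) = τ (θ z)) ∧ ∀ j, θ (x j) = y j := by
  classical
  have : NeZero s := ⟨hs.ne'⟩
  obtain ⟨Ω, e, ω, h1, h2, h3⟩ := exists_cycle_coordinates σ s hσ x hx
  obtain ⟨Ω', e', ω', h1', h2', h3'⟩ := exists_cycle_coordinates τ s hτ y hy
  have : Finite (Ω × ZMod s) := Finite.of_equiv _ e.symm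
  have : Finite (Ω' × ZMod s) := Finite.of_equiv _ e'.symm
  have : Finite Ω := Finite.of_surjective (Prod.fst : Ω × ZMod s → Ω) Prod.fst_surjective
  have : Finite Ω' := Finite.of_surjective (Prod.fst : Ω' × ZMod s → Ω') Prod.fst_surjective
  have : Finite J := Finite.of_injective ω h1
  have := Fintype.ofFinite Ω
  have := Fintype.ofFinite Ω'
  have := Fintype.ofFinite J
  have hc : Fintype.card Ω = Fintype.card Ω' := by
    have a1 := Nat.card_congr e
    have a2 := Nat.card_congr e'
    rw [Nat.card_prod, Nat.card_zmod, Nat.card_eq_fintype_card] at a1 a2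
    exact Nat.eq_of_mul_eq_mul_right hs (by rw [a1, a2, hcard])
  obtain ⟨g, hg⟩ := Finset.exists_equiv_extend_of_card_eq (α := Ω) (t := (Finset.univ : Finset Ω'))
    (by rw [hc, Finset.card_univ]) (s := Finset.univ.image ω)
    (f := fun a => if h : ∃ j, ω j = a then ω' h.choose else Classical.choice (by
      by_contra hn
      rw [not_nonempty_iff] at hn
      rw [Fintype.card_eq_zero (α := Ω'), Fintype.card_eq_zero_iff] at hc
      exact hc.false a))
    (by simp) (by
      intro a ha b hb hab
      simp only [Finset.coe_image, Finset.coe_univ, Set.image_univ, Set.mem_range] at ha hb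
      simp only [dif_pos ha, dif_pos hb] at hab
      rw [← ha.choose_spec, ← hb.choose_spec, h1' hab])
  have hgj : ∀ j, ((g (ω j) : _) : Ω') = ω' j := by
    intro j
    rw [hg (ω j) (by simp)]
    have h : ∃ k, ω k = ω j := ⟨j, rfl⟩
    simp only [dif_pos h]
    rw [h1 h.choose_spec]
  let ε : Ω ≃ Ω' := g.trans (Equiv.subtypeUnivEquiv (by simp))
  have hε : ∀ j, ε (ω j) = ω' j := hgj
  refine ⟨(e.symm.trans (ε.prodCongr (Equiv.refl _))).trans e', ?_, ?_⟩
  · intro z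
    obtain ⟨⟨a, i⟩, rfl⟩ := e.surjective z
    rw [← h2]
    simp [h2']
  · intro j
    rw [← h3]
    simp [hε, h3']

/-- `G` is the amalgamated product of `A` and `B` along the cyclic subgroups generated by `u`
and `w`, expressed by its universal property. -/
structure Amalg (A B G : Type) [Group A] [Group B] [Group G] where
  iA : A →* G
  iB : B →* G
  u : A
  w : B
  glue : iA u = iB w
  gen : Subgroup.closure (Set.range iA ∪ Set.range iB) = ⊤
  lift : ∀ (Q : Type) [Group Q] (f : A →* Q) (g : B →* Q), f u = g w →
    ∃ φ : G →* Q, φ.comp iA = f ∧ φ.comp iB = g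

/-- The images of `g` and `h` in some finite quotient are not conjugate. -/
def Sep {G : Type} [Group G] (g h : G) : Prop :=
  ∃ (Q : Type) (_ : Group Q) (_ : Finite Q) (ψ : G →* Q), ∀ k, ψ k * ψ h * (ψ k)⁻¹ ≠ ψ g

theorem Sep.symm {G : Type} [Group G] {g h : G} (H : Sep g h) : Sep h g := by
  obtain ⟨Q, i1, i2, ψ, h⟩ := H
  refine ⟨Q, i1, i2, ψ, fun k hk => h k⁻¹ ?_⟩
  rw [← hk]; simp [mul_assoc]

theorem Sep.of_isConj {G : Type} [Group G] {g h g' h' : G} (H : Sep g' h') (hg : IsConj g g')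
    (hh : IsConj h h') : Sep g h := by
  obtain ⟨Q, i1, i2, ψ, H⟩ := H
  obtain ⟨a, rfl⟩ := isConj_iff.1 hg
  obtain ⟨b, rfl⟩ := isConj_iff.1 hh
  refine ⟨Q, i1, i2, ψ, fun k hk => H (a * k * b⁻¹) ?_⟩
  simp only [map_mul, map_inv]
  rw [← hk]; group

namespace Amalg

variable {A B G : Type} [Group A] [Group B] [Group G]

/-- Exchange the two factors. -/
def symm (D : Amalg A B G) : Amalg B A G where
  iA := D.iB
  iB := D.iA
  u := D.w
  w := D.u
  glue := D.glue.symm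
  gen := by rw [Set.union_comm]; exact D.gen
  lift Q _ f g h := by
    obtain ⟨φ, h1, h2⟩ := D.lift Q g f h.symm
    exact ⟨φ, h2, h1⟩

theorem induction (D : Amalg A B G) {p : G → Prop} (hA : ∀ a, p (D.iA a)) (hB : ∀ b, p (D.iB b))
    (hmul : ∀ x y, p x → p y → p (x * y)) (hinv : ∀ x, p x → p x⁻¹) (g : G) : p g := by
  have : g ∈ Subgroup.closure (Set.range D.iA ∪ Set.range D.iB) := by rw [D.gen]; trivial
  induction this using Subgroup.closure_induction with
  | mem x hx =>
    rcases hx with ⟨a, rfl⟩ | ⟨b, rfl⟩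
    · exact hA a
    · exact hB b
  | one => simpa using hA 1
  | mul x y _ _ hx hy => exact hmul x y hx hy
  | inv x _ hx => exact hinv x hx

end Amalg

/-- `A` acting on `I` disjoint copies of `P` through a homomorphism to `P`. -/
def repl {A P : Type} [Group A] [Group P] (I : Type) (f : A →* P) :
    A →* Equiv.Perm (I × P) where
  toFun a := (Equiv.refl I).prodCongr (Equiv.mulLeft (f a))
  map_one' := by ext x <;> simp
  map_mul' a b := by ext x <;> simp [mul_assoc]

@[simp] theorem repl_apply {A P : Type} [Group A] [Group P] (I : Type) (f : A →* P) (a : A)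
    (x : I × P) : repl I f a x = (x.1, f a * x.2) := rfl

theorem repl_zpow_apply_eq_self {A P : Type} [Group A] [Group P] (I : Type) (f : A →* P) (u : A)
    (s : ℕ) (hf : ∀ i : ℤ, u ^ i ∈ f.ker ↔ (s : ℤ) ∣ i) (x : I × P) (i : ℤ) :
    ((repl I f u) ^ i) x = x ↔ (s : ℤ) ∣ i := by
  rw [← map_zpow, repl_apply, ← hf, MonoidHom.mem_ker]
  constructor
  · intro h
    simpa using congrArg Prod.snd h
  · intro h
    rw [h]; simp

namespace Amalg

variable {A B G : Type} [Group A] [Group B] [Group G]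

theorem exists_finite_quotient (D : Amalg A B G) (N₁ : Subgroup A) (N₂ : Subgroup B)
    [N₁.Normal] [N₁.FiniteIndex] [N₂.Normal] [N₂.FiniteIndex] (s : ℕ) (hs : 0 < s)
    (h1 : ∀ i : ℤ, D.u ^ i ∈ N₁ ↔ (s : ℤ) ∣ i) (h2 : ∀ i : ℤ, D.w ^ i ∈ N₂ ↔ (s : ℤ) ∣ i) :
    ∃ (P : Type) (_ : Group P) (_ : Finite P) (φ : G →* P),
      (∀ a, φ (D.iA a) = 1 ↔ a ∈ N₁) ∧ (∀ b, φ (D.iB b) = 1 ↔ b ∈ N₂) := by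
  let f₁ := QuotientGroup.mk' N₁
  let f₂ := QuotientGroup.mk' N₂
  have hk1 : ∀ i : ℤ, D.u ^ i ∈ f₁.ker ↔ (s : ℤ) ∣ i := by simpa [f₁] using h1
  have hk2 : ∀ i : ℤ, D.w ^ i ∈ f₂.ker ↔ (s : ℤ) ∣ i := by simpa [f₂] using h2
  obtain ⟨θ, hθ, -⟩ := exists_equiv_semiconj (X := Fin (Nat.card (B ⧸ N₂)) × (A ⧸ N₁))
    (Y := Fin (Nat.card (A ⧸ N₁)) × (B ⧸ N₂)) (J := Empty) (repl _ f₁ D.u) (repl _ f₂ D.w) s hs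
    (repl_zpow_apply_eq_self _ f₁ D.u s hk1) (repl_zpow_apply_eq_self _ f₂ D.w s hk2)
    (by simp [mul_comm]) Empty.elim Empty.elim (fun j => j.elim) (fun j => j.elim)
  obtain ⟨φ, hA, hB⟩ := D.lift _ (repl _ f₁)
    (θ.symm.permCongrHom.toMonoidHom.comp (repl _ f₂)) (by
      ext1 x
      simp [Equiv.permCongrHom, Equiv.permCongr_apply, ← hθ])
  refine ⟨_, _, inferInstance, φ, fun a => ?_, fun b => ?_⟩
  · rw [show φ (D.iA a) = repl _ f₁ a from DFunLike.congr_fun hA a]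
    rw [← QuotientGroup.eq_one_iff, Equiv.ext_iff]
    constructor
    · intro h
      have : f₁ a = 1 := by simpa using congrArg Prod.snd (h (⟨0, Nat.card_pos⟩, 1))
      exact this
    · intro h x
      have : f₁ a = 1 := h
      simp [this]
  · rw [show φ (D.iB b) = _ from DFunLike.congr_fun hB b]
    rw [← QuotientGroup.eq_one_iff]
    change θ.symm.permCongrHom (repl _ f₂ b) = 1 ↔ _
    rw [EmbeddingLike.map_eq_one_iff, Equiv.ext_iff]
    constructor
    · intro h
      have : f₂ b = 1 := by simpa using congrArg Prod.snd (h (⟨0, Nat.card_pos⟩, 1))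
      exact this
    · intro h x
      have : f₂ b = 1 := h
      simp [this]

/-- Compatible finite quotients of the factors satisfying prescribed eventual properties. -/
theorem exists_compatible (D : Amalg A B G) (nA : Nice A D.u) (nB : Nice B D.w)
    {pA : Subgroup A → Prop} {pB : Subgroup B → Prop} (hA : ∀ᶠ N in profin A, pA N)
    (hB : ∀ᶠ N in profin B, pB N) (t : ℕ) (ht : 0 < t) :
    ∃ (N₁ : Subgroup A) (N₂ : Subgroup B) (s : ℕ), N₁.Normal ∧ N₁.FiniteIndex ∧ N₂.Normal ∧
      N₂.FiniteIndex ∧ pA N₁ ∧ pB N₂ ∧ 0 < s ∧ t ∣ s ∧ (∀ i : ℤ, D.u ^ i ∈ N₁ ↔ (s : ℤ) ∣ i) ∧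
      ∀ i : ℤ, D.w ^ i ∈ N₂ ↔ (s : ℤ) ∣ i := by
  obtain ⟨M₁, a1, a2, a3⟩ := eventually_profin.1 hA
  obtain ⟨M₂, b1, b2, b3⟩ := eventually_profin.1 hB
  obtain ⟨s₁, hs1, H1⟩ := nA.pot M₁ a1 a2
  obtain ⟨s₂, hs2, H2⟩ := nB.pot M₂ b1 b2
  obtain ⟨N₁, c1, c2, c3, c4⟩ := H1 (s₂ * t) (by positivity)
  obtain ⟨N₂, d1, d2, d3, d4⟩ := H2 (s₁ * t) (by positivity)
  refine ⟨N₁, N₂, s₁ * (s₂ * t), c2, c3, d2, d3, a3 _ c1, b3 _ d1, by positivity,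
    ⟨s₁ * s₂, by ring⟩, c4, ?_⟩
  rwa [show s₁ * (s₂ * t) = s₂ * (s₁ * t) by ring]

theorem exists_finite_quotient_of_eventually (D : Amalg A B G) (nA : Nice A D.u)
    (nB : Nice B D.w)
    {pA : Subgroup A → Prop} {pB : Subgroup B → Prop} (hA : ∀ᶠ N in profin A, pA N)
    (hB : ∀ᶠ N in profin B, pB N) (t : ℕ) (ht : 0 < t) :
    ∃ (P : Type) (_ : Group P) (_ : Finite P) (φ : G →* P) (s : ℕ), 0 < s ∧ t ∣ s ∧
      pA (φ.comp D.iA).ker ∧ pB (φ.comp D.iB).ker ∧ ∀ i : ℤ, φ (D.iA D.u) ^ i = 1 ↔ (s : ℤ) ∣ i := by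
  obtain ⟨N₁, N₂, s, i1, i2, i3, i4, h1, h2, h3, h4, h5, h6⟩ := D.exists_compatible nA nB hA hB t ht
  obtain ⟨P, j1, j2, φ, k1, k2⟩ := D.exists_finite_quotient N₁ N₂ s h3 h5 h6
  refine ⟨P, j1, j2, φ, s, h3, h4, ?_, ?_, fun i => ?_⟩
  · convert h1; ext a; exact k1 a
  · convert h2; ext a; exact k2 a
  · rw [← map_zpow, ← map_zpow, k1, h5]

end Amalg

section

theorem sum_eq_sum_fixed {E : Type} [Fintype E] [DecidableEq E] (p : ℕ) [Fact p.Prime]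
    (t : E → E) (n : ℕ) (ht : t^[p ^ n] = id) (F : E → ZMod p) (hF : ∀ x, F (t x) = F x) :
    ∑ x, F x = ∑ x, if t x = x then F x else 0 := by
  have key : ∀ v : ZMod p, ((Finset.univ.filter fun x => F x = v).card : ZMod p) =
      ((Finset.univ.filter fun x => F x = v ∧ t x = x).card : ZMod p) := by
    intro v
    let f : Function.End {x // F x = v} := fun x => ⟨t x, by rw [hF]; exact x.2⟩
    have hf : ∀ k (x : {x // F x = v}), (((f ^ k) x : {x // F x = v}) : E) = t^[k] x := by
      intro k
      induction k with
      | zero => intro x; rfl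
      | succ k ih =>
        intro x
        rw [pow_succ, Function.iterate_succ_apply]
        exact ih (f x)
    have h1 : f ^ p ^ n = 1 := by
      funext x
      apply Subtype.ext
      rw [hf, ht]; rfl
    have h2 := Equiv.Perm.card_fixedPoints_modEq h1
    rw [← ZMod.natCast_eq_natCast_iff] at h2
    rw [← Fintype.card_subtype, h2, ← Fintype.card_subtype]
    congr 1
    apply Fintype.card_congr
    refine ⟨fun x => ⟨x.1.1, x.1.2, congrArg Subtype.val x.2⟩,
      fun x => ⟨⟨x.1, x.2.1⟩, Subtype.ext x.2.2⟩, fun _ => rfl, fun _ => rfl⟩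
  rw [← Finset.sum_filter, ← Finset.sum_fiberwise Finset.univ F F,
    ← Finset.sum_fiberwise (Finset.univ.filter fun x => t x = x) F F]
  refine Finset.sum_congr rfl fun v _ => ?_
  rw [Finset.sum_congr rfl (g := fun _ => v) (by simp), Finset.sum_const, nsmul_eq_mul, key,
    Finset.sum_congr (s₁ := Finset.filter _ (Finset.filter _ _)) rfl (g := fun _ => v) (by simp),
    Finset.sum_const, nsmul_eq_mul, Finset.filter_filter]
  congr 3
  ext; simp [and_comm]

open Classical in
/-- Push a chain of edges to the vertices of one type. -/
noncomputable def push {P : Type} [Group P] [Finite P] {p : ℕ} {C R : Subgroup P} (h : C ≤ R)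
    (f : P ⧸ C → ZMod p) (v : P ⧸ R) : ZMod p :=
  letI := Fintype.ofFinite (P ⧸ C)
  ∑ e, if Subgroup.quotientMapOfLE h e = v then f e else 0

section push

variable {P : Type} [Group P] [Finite P] {p : ℕ} {C R : Subgroup P} (h : C ≤ R)

theorem push_add (f g : P ⧸ C → ZMod p) (v : P ⧸ R) :
    push h (fun x => f x + g x) v = push h f v + push h g v := by
  simp only [push, ← Finset.sum_add_distrib]
  refine Finset.sum_congr rfl fun e _ => ?_
  split_ifs <;> simp

theorem push_neg (f : P ⧸ C → ZMod p) (v : P ⧸ R) :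
    push h (fun x => - f x) v = - push h f v := by
  simp only [push, ← Finset.sum_neg_distrib]
  refine Finset.sum_congr rfl fun e _ => ?_
  split_ifs <;> simp

theorem push_zero (v : P ⧸ R) : push (p := p) h (fun _ => 0) v = 0 := by
  simp [push]

theorem quotientMapOfLE_smul (k : P) (e : P ⧸ C) :
    Subgroup.quotientMapOfLE h (k • e) = k • Subgroup.quotientMapOfLE h e := by
  induction e using QuotientGroup.induction_on with
  | H z => rfl

theorem push_smul (k : P) (f : P ⧸ C → ZMod p) (v : P ⧸ R) :
    push h (fun x => f (k⁻¹ • x)) v = push h f (k⁻¹ • v) := by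
  classical
  let _ := Fintype.ofFinite (P ⧸ C)
  simp only [push]
  refine Fintype.sum_equiv (MulAction.toPerm k⁻¹) _ _ fun e => ?_
  simp only [MulAction.toPerm_apply, quotientMapOfLE_smul]
  congr 1
  simp

open Classical in
theorem push_single (k : P) (v : P ⧸ R) :
    push (p := p) h (fun x => if x = (k : P ⧸ C) then 1 else 0) v =
      if v = (k : P ⧸ R) then 1 else 0 := by
  let _ := Fintype.ofFinite (P ⧸ C)
  simp only [push, ← ite_and]
  rw [Finset.sum_eq_single (k : P ⧸ C)]
  · simp [eq_comm]
  · intro b _ hb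
    simp [hb]
  · simp

open Classical in
/-- Summation of an invariant chain over the star of a vertex: only the fixed edges count. -/
theorem push_eq_sum_fixed [Fact p.Prime] [Fintype (P ⧸ C)] (t : P) (n : ℕ) (ht : t ^ p ^ n = 1)
    (f : P ⧸ C → ZMod p)
    (hf : ∀ x, f (t • x) = f x) (v : P ⧸ R) (hv : t • v = v) :
    push h f v = ∑ e, if Subgroup.quotientMapOfLE h e = v ∧ t • e = e then f e else 0 := by
  have := sum_eq_sum_fixed p (fun e : P ⧸ C => t • e) n
    (by
      funext e
      rw [smul_iterate_apply, ht, one_smul]; rfl)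
    (fun e => if Subgroup.quotientMapOfLE h e = v then f e else 0) (by
      intro e
      simp only [hf, quotientMapOfLE_smul]
      have : t • Subgroup.quotientMapOfLE h e = v ↔ Subgroup.quotientMapOfLE h e = v := by
        conv_lhs => rw [← hv]
        simp
      simp [this])
  unfold push
  rw [show Fintype.ofFinite (P ⧸ C) = ‹_› from Subsingleton.elim _ _]
  refine this.trans (Finset.sum_congr rfl fun e _ => ?_)
  by_cases h1 : Subgroup.quotientMapOfLE h e = v <;> by_cases h2 : t • e = e <;> simp [h1, h2]

end push

namespace Amalg

variable {A B G : Type} [Group A] [Group B] [Group G]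

/-- The semidirect product of `P` with its module of functions on `P ⧸ C`. -/
abbrev ChainGroup {P : Type} [Group P] (p : ℕ) (C : Subgroup P) : Type :=
  (P ⧸ C → Multiplicative (ZMod p)) ⋊[mulAutArrow] P

open Classical in
/-- The extension of a finite quotient `P` by the module of `1`-chains of the coset graph. -/
theorem exists_chain (D : Amalg A B G) {P : Type} [Group P] [Finite P] (φ : G →* P) (p : ℕ)
    [Fact p.Prime] (C RA RB : Subgroup P) (hC : C = Subgroup.zpowers (φ (D.iA D.u)))
    (hRA : RA = (φ.comp D.iA).range) (hRB : RB = (φ.comp D.iB).range)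
    (hCA : C ≤ RA) (hCB : C ≤ RB) :
    ∃ (Q : Type) (_ : Group Q) (_ : Finite Q) (ψ : G →* Q) (δ : G → (P ⧸ C → ZMod p)),
      (∀ g h k, ψ k * ψ h * (ψ k)⁻¹ = ψ g → φ k * φ h * (φ k)⁻¹ = φ g ∧
        ∀ x, δ k x - δ k ((φ g)⁻¹ • x) + δ h ((φ k)⁻¹ • x) = δ g x) ∧
      (∀ a x, δ (D.iA a) x = 0) ∧
      (∀ b x, δ (D.iB b) x = (if x = ((1 : P) : P ⧸ C) then 1 else 0) -
        if x = (φ (D.iB b) : P ⧸ C) then 1 else 0) ∧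
      (∀ k v, push hCA (δ k) v = (if v = ((1 : P) : P ⧸ RA) then 1 else 0) -
        if v = (φ k : P ⧸ RA) then 1 else 0) ∧
      ∀ k v, push hCB (δ k) v = 0 := by
  have : Finite (P ⧸ C → ZMod p) := Pi.finite
  have : Finite (ChainGroup p C) := Finite.of_equiv _ (SemidirectProduct.equivProd
    (φ := mulAutArrow) (N := P ⧸ C → Multiplicative (ZMod p)) (G := P)).symm
  let e : P ⧸ C → Multiplicative (ZMod p) := fun x => Multiplicative.ofAdd (if x = ((1 : P) : P ⧸ C) then 1 else 0)
  let cj : ChainGroup p C := SemidirectProduct.inl e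
  obtain ⟨ψ, hA, hB⟩ := D.lift (ChainGroup p C) (SemidirectProduct.inr.comp (φ.comp D.iA))
    ((MulAut.conj cj).toMonoidHom.comp (SemidirectProduct.inr.comp (φ.comp D.iB))) (by
      ext x
      · simp only [MonoidHom.comp_apply, ← D.glue]
        simp only [MulEquiv.toMonoidHom_eq_coe, MonoidHom.coe_coe, MulAut.conj_apply,
          SemidirectProduct.left_inr, SemidirectProduct.mul_left, SemidirectProduct.inv_left,
          SemidirectProduct.mul_right, cj, SemidirectProduct.left_inl,
          SemidirectProduct.right_inl, SemidirectProduct.right_inr, mul_one, one_mul, map_one,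
          Pi.mul_apply, Pi.one_apply, inv_one, MulAut.one_apply, mulAutArrow_apply_apply,
          Pi.inv_apply, map_inv]
        congr 1
        rw [eq_comm, mul_inv_eq_one]
        change e x = e ((φ (D.iA D.u))⁻¹ • x)
        simp only [e]
        congr 1
        have : (φ (D.iA D.u))⁻¹ • x = ((1 : P) : P ⧸ C) ↔ x = ((1 : P) : P ⧸ C) := by
          rw [inv_smul_eq_iff]
          have : φ (D.iA D.u) • ((1 : P) : P ⧸ C) = ((1 : P) : P ⧸ C) := by
            rw [MulAction.Quotient.smul_coe, QuotientGroup.eq]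
            simp [hC]
          rw [this]
        simp [this]
      · simp [cj, D.glue])
  have hA' : ∀ a, ψ (D.iA a) = SemidirectProduct.inr (φ (D.iA a)) :=
    fun a => DFunLike.congr_fun hA a
  have hB' : ∀ b, ψ (D.iB b) = cj * SemidirectProduct.inr (φ (D.iB b)) * cj⁻¹ :=
    fun b => DFunLike.congr_fun hB b
  have hright : ∀ g, (ψ g).right = φ g := by
    refine D.induction (fun a => ?_) (fun b => ?_) (fun x y hx hy => ?_) (fun x hx => ?_)
    · rw [hA']; simp
    · rw [hB']; simp [cj]
    · simp [hx, hy]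
    · simp [hx]
  let δ : G → (P ⧸ C → ZMod p) := fun g x => ((ψ g).left x).toAdd
  have hδmul : ∀ g h x, δ (g * h) x = δ g x + δ h ((φ g)⁻¹ • x) := by
    intro g h x
    simp only [δ, map_mul, SemidirectProduct.mul_left, Pi.mul_apply, toAdd_mul, hright,
      mulAutArrow_apply_apply]
    rfl
  have hδA : ∀ a x, δ (D.iA a) x = 0 := by
    intro a x; simp [δ, hA']
  have hδ1 : ∀ x, δ 1 x = 0 := by
    intro x; simp [δ]
  have hδinv : ∀ g x, δ g⁻¹ x = - δ g (φ g • x) := by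
    intro g x
    have := hδmul g g⁻¹ (φ g • x)
    rw [mul_inv_cancel, hδ1, inv_smul_smul] at this
    exact eq_neg_of_add_eq_zero_right this.symm
  have hδB : ∀ b x, δ (D.iB b) x = (if x = ((1 : P) : P ⧸ C) then 1 else 0) -
        if x = (φ (D.iB b) : P ⧸ C) then 1 else 0 := by
    intro b x
    simp only [δ, hB', cj]
    simp only [SemidirectProduct.mul_left, SemidirectProduct.left_inl, SemidirectProduct.right_inl,
      map_one, SemidirectProduct.left_inr, mul_one, SemidirectProduct.mul_right, one_mul,
      SemidirectProduct.right_inr, SemidirectProduct.inv_left, inv_one, MulAut.one_apply, map_inv,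
      Pi.mul_apply, toAdd_mul, Pi.inv_apply, toAdd_inv]
    rw [← sub_eq_add_neg]
    congr 1
    simp only [mulAutArrow_apply_apply]
    change (if (φ (D.iB b))⁻¹ • x = ((1 : P) : P ⧸ C) then 1 else 0) = _
    congr 1
    rw [inv_smul_eq_iff, MulAction.Quotient.smul_coe]
    simp
  have hpush : ∀ k, (∀ v, push hCA (δ k) v = (if v = ((1 : P) : P ⧸ RA) then 1 else 0) -
        if v = (φ k : P ⧸ RA) then 1 else 0) ∧ ∀ v, push hCB (δ k) v = 0 := by
    have hmulpush : ∀ (R : Subgroup P) (hR : C ≤ R) x y v, push hR (δ (x * y)) v =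
        push hR (δ x) v + push hR (δ y) ((φ x)⁻¹ • v) := by
      intro R hR x y v
      rw [← push_smul, ← push_add]
      congr 1
      funext z
      exact hδmul x y z
    have hinvpush : ∀ (R : Subgroup P) (hR : C ≤ R) x v, push hR (δ x⁻¹) v =
        - push hR (δ x) (φ x • v) := by
      intro R hR x v
      have := push_smul hR (φ x)⁻¹ (δ x) v
      rw [inv_inv] at this
      rw [← this, ← push_neg]
      congr 1
      funext z
      exact hδinv x z
    have hpA : ∀ (R : Subgroup P) (hR : C ≤ R) a v, push hR (δ (D.iA a)) v = 0 := by
      intro R hR a v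
      rw [show δ (D.iA a) = fun _ => 0 from funext (hδA a), push_zero]
    have hpB : ∀ (R : Subgroup P) (hR : C ≤ R) b v, push hR (δ (D.iB b)) v =
        (if v = ((1 : P) : P ⧸ R) then 1 else 0) - if v = (φ (D.iB b) : P ⧸ R) then 1 else 0 := by
      intro R hR b v
      rw [show δ (D.iB b) = _ from funext (hδB b)]
      simp only [sub_eq_add_neg]
      rw [push_add, push_neg, push_single, push_single]
    intro k
    constructor
    · refine D.induction (p := fun k => ∀ v, push hCA (δ k) v =
        (if v = ((1 : P) : P ⧸ RA) then 1 else 0) - if v = (φ k : P ⧸ RA) then 1 else 0)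
        (fun a v => ?_) (fun b v => hpB _ _ _ _) (fun x y hx hy v => ?_) (fun x hx v => ?_) k
      · rw [hpA]
        have : ((φ (D.iA a) : P) : P ⧸ RA) = ((1 : P) : P ⧸ RA) := by
          rw [QuotientGroup.eq, hRA]
          exact ⟨a⁻¹, by simp⟩
        rw [this, sub_self]
      · rw [hmulpush, hx, hy]
        simp only [inv_smul_eq_iff, MulAction.Quotient.smul_coe, smul_eq_mul, mul_one, map_mul]
        ring
      · rw [hinvpush, hx]
        simp only [← eq_inv_smul_iff, MulAction.Quotient.smul_coe, smul_eq_mul, mul_one, map_inv,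
          inv_mul_cancel]
        ring
    · refine D.induction (p := fun k => ∀ v, push hCB (δ k) v = 0)
        (fun a v => hpA _ _ _ _) (fun b v => ?_) (fun x y hx hy v => ?_) (fun x hx v => ?_) k
      · rw [hpB]
        have : ((φ (D.iB b) : P) : P ⧸ RB) = ((1 : P) : P ⧸ RB) := by
          rw [QuotientGroup.eq, hRB]
          exact ⟨b⁻¹, by simp⟩
        rw [this, sub_self]
      · rw [hmulpush, hx, hy, add_zero]
      · rw [hinvpush, hx, neg_zero]
  refine ⟨ChainGroup p C, inferInstance, inferInstance, ψ, δ, ?_, hδA, hδB, fun k => (hpush k).1,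
    fun k => (hpush k).2⟩
  intro g h k hk
  refine ⟨by rw [← hright k, ← hright h, ← hright g, ← hk]; simp, fun x => ?_⟩
  have h1 : ∀ x, δ (k * h) x = δ (g * k) x := by
    intro x
    simp only [δ, map_mul, ← hk]
    simp
  have h2 := h1 x
  rw [hδmul, hδmul] at h2
  linear_combination h2

end Amalg

end

namespace Amalg

variable {A B G : Type} [Group A] [Group B] [Group G]

/-- If no power of `a` prime to `p` is conjugate into `⟨u⟩` modulo the kernel, then the sum of an
`a`-invariant chain over the star of the base vertex vanishes. -/
theorem push_eq_zero_of_free (D : Amalg A B G) {P : Type} [Group P] [Finite P] (φ : G →* P) (p : ℕ)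
    [Fact p.Prime] {C RA : Subgroup P} (hC : C = Subgroup.zpowers (φ (D.iA D.u)))
    (hRA : RA = (φ.comp D.iA).range) (hCA : C ≤ RA) (a : A)
    (hfree : ∀ (i l : ℤ) (y : A), (a ^ i)⁻¹ * (y * D.u ^ l * y⁻¹) ∈ (φ.comp D.iA).ker → (p : ℤ) ∣ i)
    (f : P ⧸ C → ZMod p) (hf : ∀ x, f ((φ (D.iA a))⁻¹ • x) = f x) :
    push hCA f ((1 : P) : P ⧸ RA) = 0 := by
  classical
  let _ := Fintype.ofFinite (P ⧸ C)
  obtain ⟨k, n, hn, hk⟩ := Nat.exists_eq_pow_mul_and_not_dvd (orderOf_pos (φ (D.iA a))).ne' p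
    (Nat.Prime.ne_one Fact.out)
  have hf' : ∀ m : ℕ, ∀ x, f (φ (D.iA a) ^ m • x) = f x := by
    intro m
    induction m with
    | zero => simp
    | succ m ih =>
      intro x
      rw [pow_succ, mul_smul, ih]
      have := hf (φ (D.iA a) • x)
      rw [inv_smul_smul] at this
      exact this.symm
  have ht : (φ (D.iA a) ^ n) ^ p ^ k = 1 := by
    rw [← pow_mul, mul_comm, ← hk, pow_orderOf_eq_one]
  have hv : φ (D.iA a) ^ n • ((1 : P) : P ⧸ RA) = ((1 : P) : P ⧸ RA) := by
    rw [MulAction.Quotient.smul_coe, QuotientGroup.eq, hRA]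
    exact ⟨(a ^ n)⁻¹, by simp⟩
  rw [push_eq_sum_fixed hCA _ k ht f (hf' n) _ hv]
  refine Finset.sum_eq_zero fun e _ => if_neg ?_
  rintro ⟨h1, h2⟩
  induction e using QuotientGroup.induction_on with
  | H z =>
    rw [Subgroup.quotientMapOfLE_apply_mk, eq_comm, QuotientGroup.eq, hRA] at h1
    obtain ⟨y, hy⟩ := h1
    rw [MulAction.Quotient.smul_coe, eq_comm, QuotientGroup.eq, hC] at h2
    obtain ⟨l, hl⟩ := Subgroup.mem_zpowers_iff.1 h2
    have hz : φ (D.iA y) = z := by simpa using hy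
    apply hn
    have := hfree n l y (by
      rw [MonoidHom.mem_ker]
      simp only [MonoidHom.comp_apply, map_mul, map_inv, map_zpow]
      rw [hz, hl]
      simp)
    exact_mod_cast this

theorem sep_of_free (D : Amalg A B G) (nA : Nice A D.u) (nB : Nice B D.w) (a : A)
    (ha : ∀ (y : A) (l : ℤ), a ≠ y * D.u ^ l * y⁻¹) :
    (∀ a', ¬ IsConj a' a → Sep (D.iA a) (D.iA a')) ∧ ∀ b, Sep (D.iA a) (D.iB b) := by
  classical
  obtain ⟨p, hp, hfree⟩ := nA.free a ha
  have : Fact p.Prime := ⟨hp⟩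
  constructor
  · intro a' ha'
    obtain ⟨P, _, _, φ, s, -, -, ⟨h1, h2⟩, -, -⟩ := D.exists_finite_quotient_of_eventually nA nB
      (hfree.and (nA.conj a' a ha')) (Filter.Eventually.of_forall (p := fun _ => True)
        fun _ => trivial) 1 one_pos
    obtain ⟨Q, _, _, ψ, δ, c1, c2, c3, c4, c5⟩ := D.exists_chain φ p _ _ (φ.comp D.iB).range rfl rfl
      rfl (by simp only [Subgroup.zpowers_le]; exact ⟨D.u, rfl⟩)
      (by simp only [Subgroup.zpowers_le]; exact ⟨D.w, by simp [D.glue]⟩)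
    refine ⟨Q, inferInstance, inferInstance, ψ, fun k hk => ?_⟩
    obtain ⟨e1, e2⟩ := c1 _ _ _ hk
    have h3 := D.push_eq_zero_of_free φ p rfl rfl (by
      simp only [Subgroup.zpowers_le]; exact ⟨D.u, rfl⟩) a h1 (δ k) (by
      intro x
      have := e2 x
      rw [c2, c2] at this
      linear_combination -this)
    rw [c4] at h3
    by_cases h4 : ((1 : P) : P ⧸ (φ.comp D.iA).range) = (φ k : P ⧸ (φ.comp D.iA).range)
    · rw [QuotientGroup.eq] at h4
      obtain ⟨y, hy⟩ := h4
      have hy' : φ (D.iA y) = φ k := by simpa using hy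
      apply h2 y
      rw [MonoidHom.mem_ker]
      simp only [MonoidHom.comp_apply, map_mul, map_inv]
      rw [hy', e1]
      simp
    · simp [h4] at h3
  · intro b
    obtain ⟨P, _, _, φ, s, -, -, h1, -, -⟩ := D.exists_finite_quotient_of_eventually nA nB
      hfree (Filter.Eventually.of_forall (p := fun _ => True)
        fun _ => trivial) 1 one_pos
    obtain ⟨Q, _, _, ψ, δ, c1, c2, c3, c4, c5⟩ := D.exists_chain φ p _ _ (φ.comp D.iB).range rfl rfl
      rfl (by simp only [Subgroup.zpowers_le]; exact ⟨D.u, rfl⟩)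
      (by simp only [Subgroup.zpowers_le]; exact ⟨D.w, by simp [D.glue]⟩)
    refine ⟨Q, inferInstance, inferInstance, ψ, fun k hk => ?_⟩
    obtain ⟨e1, e2⟩ := c1 _ _ _ hk
    have h3 := D.push_eq_zero_of_free φ p rfl rfl (by
      simp only [Subgroup.zpowers_le]; exact ⟨D.u, rfl⟩) a h1
      (fun x => δ k x + if x = (φ k : P ⧸ Subgroup.zpowers (φ (D.iA D.u))) then 1 else 0) (by
      intro x
      have := e2 x
      rw [c2, c3] at this
      simp only [inv_smul_eq_iff, MulAction.Quotient.smul_coe, smul_eq_mul, mul_one] at this ⊢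
      rw [← e1, inv_mul_cancel_right]
      rw [← e1] at this
      linear_combination -this)
    rw [push_add, push_single, c4] at h3
    simp at h3

theorem sep_inv (D : Amalg A B G) (nA : Nice A D.u) (nB : Nice B D.w) (l : ℤ) (hl : l ≠ 0)
    (hA : ¬ IsConj (D.u ^ l) (D.u ^ (-l))) (hB : ¬ IsConj (D.w ^ l) (D.w ^ (-l))) :
    Sep (D.iA (D.u ^ l)) (D.iA (D.u ^ (-l))) := by
  classical
  have : Fact (Nat.Prime 2) := ⟨Nat.prime_two⟩
  obtain ⟨q₀, hq₀⟩ : ∃ q₀ : ℕ, q₀ = 2 ^ (2 * l).natAbs := ⟨_, rfl⟩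
  have hq0 : 0 < q₀ := by rw [hq₀]; positivity
  have hq1 : ¬ (q₀ : ℤ) ∣ 2 * l := by
    intro h
    have h1 := Int.natAbs_dvd_natAbs.2 h
    rw [Int.natAbs_natCast] at h1
    have := Nat.le_of_dvd (by omega) h1
    have h3 : (2 * l).natAbs < 2 ^ (2 * l).natAbs := Nat.lt_two_pow_self
    omega
  obtain ⟨P, _, _, φ, s, hs, hqs, h1, h2, h3⟩ := D.exists_finite_quotient_of_eventually nA nB
    (nA.inv l hl hA q₀ hq0) (nB.inv l hl hB q₀ hq0) q₀ hq0
  obtain ⟨k₂, N, hN, hk₂⟩ := Nat.exists_eq_pow_mul_and_not_dvd hs.ne' 2 (by norm_num)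
  have hcop : IsCoprime (q₀ : ℤ) (N : ℤ) := by
    rw [Nat.isCoprime_iff_coprime, hq₀]
    exact Nat.Coprime.pow_left _ ((Nat.Prime.coprime_iff_not_dvd Nat.prime_two).2 hN)
  obtain ⟨C, hC⟩ : ∃ C : Subgroup P, C = Subgroup.zpowers (φ (D.iA D.u)) := ⟨_, rfl⟩
  have hCw : C = Subgroup.zpowers (φ (D.iB D.w)) := by rw [hC, D.glue]
  have hCA : C ≤ (φ.comp D.iA).range := by
    rw [hC, Subgroup.zpowers_le]; exact ⟨D.u, rfl⟩
  have hCB : C ≤ (φ.comp D.iB).range := by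
    rw [hCw, Subgroup.zpowers_le]; exact ⟨D.w, rfl⟩
  obtain ⟨Q, _, _, ψ, δ, c1, c2, -, c4, c5⟩ := D.exists_chain φ 2 C _ _ hC rfl rfl hCA hCB
  refine ⟨Q, inferInstance, inferInstance, ψ, fun k hk => ?_⟩
  obtain ⟨e1, e2⟩ := c1 _ _ _ hk
  let _ : ∀ R : Subgroup P, Fintype (P ⧸ R) := fun R => Fintype.ofFinite (P ⧸ R)
  obtain ⟨c, hc⟩ : ∃ c, c = φ (D.iA D.u) := ⟨_, rfl⟩
  have hcw : c = φ (D.iB D.w) := by rw [hc, D.glue]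
  rw [← hc] at hC h3
  have hcs : c ^ s = 1 := by
    have := (h3 s).2 (dvd_refl _)
    simpa using this
  have hg : φ (D.iA (D.u ^ l)) = c ^ l := by simp [hc]
  have hh : φ (D.iA (D.u ^ (-l))) = c ^ (-l) := by simp [hc]
  rw [hg, hh] at e1
  obtain ⟨t, htdef⟩ : ∃ t, t = c ^ (l * N) := ⟨_, rfl⟩
  have htpow : t ^ 2 ^ k₂ = 1 := by
    rw [htdef, ← zpow_natCast, ← zpow_mul, h3, hk₂]
    push_cast
    exact ⟨l, by ring⟩
  have hδ : ∀ x, δ k (t • x) = δ k x := by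
    have h4 : ∀ x, δ k (c ^ l • x) = δ k x := by
      intro x
      have := e2 (c ^ l • x)
      rw [c2, c2, hg, inv_smul_smul] at this
      linear_combination this
    have h5 : ∀ n : ℕ, ∀ x, δ k ((c ^ l) ^ n • x) = δ k x := by
      intro n
      induction n with
      | zero => simp
      | succ n ih => intro x; rw [pow_succ, mul_smul, ih, h4]
    intro x
    rw [htdef, zpow_mul, zpow_natCast, h5]
  let Z : P → Prop := fun x => ∃ m : ℤ, x⁻¹ * t * x = c ^ m ∧ (q₀ : ℤ) ∣ m - l * N
  let F : P ⧸ C → Prop := fun e => ∃ x, Z x ∧ (x : P ⧸ C) = e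
  have hFmk : ∀ x : P, F (x : P ⧸ C) → Z x := by
    rintro x ⟨y, ⟨m, hm, hm'⟩, hy⟩
    rw [QuotientGroup.eq, hC] at hy
    obtain ⟨j, hj⟩ := Subgroup.mem_zpowers_iff.1 hy
    refine ⟨m, ?_, hm'⟩
    have : x = y * c ^ j := by rw [hj]; group
    rw [this, mul_inv_rev]
    calc _ = (c ^ j)⁻¹ * (y⁻¹ * t * y) * c ^ j := by group
      _ = _ := by rw [hm]; group
  -- the sum over the star of a vertex containing an edge of `F`
  have key : ∀ (X : Type) [Group X] (ι : X →* P) (v : X), ι v = c →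
      (∀ (i j : ℤ) (y : X), (v ^ i)⁻¹ * (y * v ^ j * y⁻¹) ∈ ι.ker → (q₀ : ℤ) ∣ i - j) →
      ∀ (hR : C ≤ ι.range) (z : P ⧸ ι.range),
      (∑ e, if Subgroup.quotientMapOfLE hR e = z then (if F e then δ k e else 0) else 0) =
        if ∃ x, Z x ∧ (x : P ⧸ ι.range) = z then push hR (δ k) z else 0 := by
    intro X _ ι v hv hinv hR z
    split_ifs with hz
    · obtain ⟨x, ⟨m, hm, hm'⟩, rfl⟩ := hz
      have hfix : t • (x : P ⧸ ι.range) = (x : P ⧸ ι.range) := by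
        rw [MulAction.Quotient.smul_coe, eq_comm, QuotientGroup.eq, smul_eq_mul, ← mul_assoc, hm]
        exact ⟨v ^ m, by simp [hv]⟩
      rw [push_eq_sum_fixed hR t k₂ htpow (δ k) hδ _ hfix]
      refine Finset.sum_congr rfl fun e _ => ?_
      rw [← ite_and]
      congr 1
      rw [eq_iff_iff, and_congr_right_iff]
      intro he
      induction e using QuotientGroup.induction_on with
      | H y =>
        constructor
        · intro h
          obtain ⟨m', h4, -⟩ := hFmk _ h
          rw [MulAction.Quotient.smul_coe, eq_comm, QuotientGroup.eq, hC, smul_eq_mul, ← mul_assoc,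
            h4]
          exact ⟨m', rfl⟩
        · intro h
          rw [MulAction.Quotient.smul_coe, eq_comm, QuotientGroup.eq, hC, smul_eq_mul,
            ← mul_assoc] at h
          obtain ⟨j, hj⟩ := Subgroup.mem_zpowers_iff.1 h
          refine ⟨y, ⟨j, hj.symm, ?_⟩, rfl⟩
          rw [Subgroup.quotientMapOfLE_apply_mk, eq_comm, QuotientGroup.eq] at he
          obtain ⟨a, ha⟩ := he
          have := hinv m j a (by
            rw [MonoidHom.mem_ker]
            simp only [map_mul, map_inv, map_zpow, hv, ha, hj]
            rw [← hm]; group)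
          have h6 := dvd_sub hm' this
          rwa [show m - l * N - (m - j) = j - l * N by ring] at h6
    · refine Finset.sum_eq_zero fun e _ => ?_
      rw [← ite_and]
      refine if_neg ?_
      rintro ⟨rfl, x, hx, rfl⟩
      exact hz ⟨x, hx, rfl⟩
  have total : ∀ (R : Subgroup P) (hR : C ≤ R), (∑ e, if F e then δ k e else 0) =
      ∑ z : P ⧸ R, ∑ e, if Subgroup.quotientMapOfLE hR e = z then (if F e then δ k e else 0)
        else 0 := by
    intro R hR
    rw [Finset.sum_comm]
    simp
  have hSB : (∑ e, if F e then δ k e else 0) = 0 := by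
    rw [total _ hCB]
    refine Finset.sum_eq_zero fun z _ => ?_
    rw [key B (φ.comp D.iB) D.w (by simp [hcw]) h2 hCB z, c5]
    simp
  rw [total _ hCA, Finset.sum_congr rfl (fun z _ =>
    key A (φ.comp D.iA) D.u (by simp [hc]) h1 hCA z)] at hSB
  have hZ1 : ∃ x, Z x ∧ (x : P ⧸ (φ.comp D.iA).range) = ((1 : P) : P ⧸ (φ.comp D.iA).range) :=
    ⟨1, ⟨l * N, by simp [htdef], by simp⟩, rfl⟩
  by_cases hZk : ∃ x, Z x ∧ (x : P ⧸ (φ.comp D.iA).range) = (φ k : P ⧸ (φ.comp D.iA).range)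
  · obtain ⟨x, ⟨m, hm, hm'⟩, hx⟩ := hZk
    rw [eq_comm, QuotientGroup.eq] at hx
    obtain ⟨a, ha⟩ := hx
    have hx : x = φ k * φ (D.iA a) := by
      rw [← MonoidHom.comp_apply, ha]; group
    have ht2 : (φ k)⁻¹ * t * φ k = c ^ (-(l * N)) := by
      have : (φ k)⁻¹ * c ^ l * φ k = c ^ (-l) := by rw [← e1]; group
      have h7 : ((φ k)⁻¹ * c ^ l * (φ k)⁻¹⁻¹) ^ N = (φ k)⁻¹ * (c ^ l) ^ N * (φ k)⁻¹⁻¹ := conj_pow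
      rw [inv_inv, this] at h7
      rw [htdef, zpow_mul, zpow_natCast, ← h7, ← zpow_natCast, ← zpow_mul]
      congr 1; ring
    have := h1 m (-(l * N)) a⁻¹ (by
      rw [MonoidHom.mem_ker]
      simp only [map_mul, map_inv, map_zpow, MonoidHom.comp_apply, ← hc]
      rw [← hm, ← ht2, hx]; group)
    have h8 : (q₀ : ℤ) ∣ (2 * l) * N := by
      have h6 := dvd_sub this hm'
      rwa [show m - -(l * N) - (m - l * N) = (2 * l) * N by ring] at h6
    exact hq1 (hcop.dvd_of_dvd_mul_right h8)
  · have : ∀ z : P ⧸ (φ.comp D.iA).range,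
        (if ∃ x, Z x ∧ (x : P ⧸ (φ.comp D.iA).range) = z then push hCA (δ k) z else 0) =
        if z = ((1 : P) : P ⧸ (φ.comp D.iA).range) then 1 else 0 := by
      intro z
      rw [c4]
      by_cases hz1 : z = ((1 : P) : P ⧸ (φ.comp D.iA).range)
      · have : z ≠ (φ k : P ⧸ (φ.comp D.iA).range) := by
          rintro rfl
          exact hZk (hz1 ▸ hZ1)
        rw [if_neg this, if_pos hz1, if_pos (hz1 ▸ hZ1), sub_zero]
      · by_cases hzk : z = (φ k : P ⧸ (φ.comp D.iA).range)
        · rw [if_neg hz1, if_neg (hzk ▸ hZk)]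
        · rw [if_neg hz1, if_neg hzk]; simp
    rw [Finset.sum_congr rfl (fun z _ => this z)] at hSB
    simp at hSB

theorem sep_zpow (D : Amalg A B G) (nA : Nice A D.u) (nB : Nice B D.w) (l l' : ℤ)
    (h : l.natAbs ≠ l'.natAbs) : Sep (D.iA (D.u ^ l)) (D.iA (D.u ^ l')) := by
  obtain ⟨P, _, _, φ, s, hs, hqs, -, -, h3⟩ := D.exists_finite_quotient_of_eventually nA nB
    (Filter.Eventually.of_forall (p := fun _ => True) fun _ => trivial)
    (Filter.Eventually.of_forall (p := fun _ => True) fun _ => trivial)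
    (2 * (if l = 0 then 1 else l.natAbs) * (if l' = 0 then 1 else l'.natAbs))
    (by split_ifs <;> positivity)
  refine ⟨P, inferInstance, inferInstance, φ, fun k hk => h ?_⟩
  have key : ∀ i : ℤ, (s : ℤ) ∣ l * i ↔ (s : ℤ) ∣ l' * i := by
    intro i
    simp only [map_zpow] at hk
    rw [← h3, ← h3, zpow_mul, zpow_mul, ← hk, conj_zpow]
    simp
  have hsz : (s : ℤ) ≠ 0 := by exact_mod_cast hs.ne'
  have aux : ∀ l l' : ℤ, ((2 * (if l = 0 then 1 else l.natAbs) *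
      (if l' = 0 then 1 else l'.natAbs) : ℕ) : ℤ) ∣ s →
      (∀ i : ℤ, (s : ℤ) ∣ l * i → (s : ℤ) ∣ l' * i) → l ∣ l' := by
    intro l l' hd hk
    by_cases hl : l = 0
    · subst hl
      have h1 := hk 1 (by simp)
      by_cases hl' : l' = 0
      · simp [hl']
      · exfalso
        have h2 := hd.trans h1
        simp only [if_true, if_neg hl', mul_one] at h2
        have h4 := Int.natAbs_dvd_natAbs.2 h2
        rw [Int.natAbs_natCast] at h4
        have := Nat.le_of_dvd (by omega) h4
        omega
    · have h1 : l ∣ s := by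
        refine dvd_trans ?_ hd
        simp only [if_neg hl]
        push_cast
        exact Dvd.dvd.mul_right (Dvd.dvd.mul_left ((dvd_abs l l).2 dvd_rfl) _) _
      obtain ⟨i, hi⟩ := h1
      have h2 := hk i (by rw [hi])
      rw [hi] at h2
      have hi0 : i ≠ 0 := by rintro rfl; simp at hi; omega
      exact Int.dvd_of_mul_dvd_mul_right hi0 h2
  have h4 : ((2 * (if l = 0 then 1 else l.natAbs) *
      (if l' = 0 then 1 else l'.natAbs) : ℕ) : ℤ) ∣ s := by exact_mod_cast hqs
  apply Int.natAbs_eq_of_dvd_dvd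
  · exact aux l l' h4 fun i => (key i).1
  · exact aux l' l (by rw [mul_right_comm]; exact h4) fun i => (key i).2

/-- Non-conjugate elements of the factors are separated. -/
theorem sep_elliptic (D : Amalg A B G) (nA : Nice A D.u) (nB : Nice B D.w) (g h : G)
    (hg : (∃ a, g = D.iA a) ∨ ∃ b, g = D.iB b) (hh : (∃ a, h = D.iA a) ∨ ∃ b, h = D.iB b)
    (hgh : ¬ IsConj g h) : Sep g h := by
  have red : ∀ g, ((∃ a, g = D.iA a) ∨ ∃ b, g = D.iB b) →
      (∃ l : ℤ, IsConj g (D.iA (D.u ^ l))) ∨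
      (∃ a, g = D.iA a ∧ ∀ (y : A) (l : ℤ), a ≠ y * D.u ^ l * y⁻¹) ∨
      (∃ b, g = D.iB b ∧ ∀ (y : B) (l : ℤ), b ≠ y * D.w ^ l * y⁻¹) := by
    rintro g (⟨a, rfl⟩ | ⟨b, rfl⟩)
    · by_cases h : ∀ (y : A) (l : ℤ), a ≠ y * D.u ^ l * y⁻¹
      · exact .inr (.inl ⟨a, rfl, h⟩)
      · push Not at h
        obtain ⟨y, l, rfl⟩ := h
        refine .inl ⟨l, isConj_iff.2 ⟨(D.iA y)⁻¹, ?_⟩⟩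
        simp only [map_mul, map_inv]; group
    · by_cases h : ∀ (y : B) (l : ℤ), b ≠ y * D.w ^ l * y⁻¹
      · exact .inr (.inr ⟨b, rfl, h⟩)
      · push Not at h
        obtain ⟨y, l, rfl⟩ := h
        refine .inl ⟨l, isConj_iff.2 ⟨(D.iB y)⁻¹, ?_⟩⟩
        simp only [map_mul, map_inv, map_zpow, D.glue]; group
  have free : ∀ g h : G, ((∃ a, g = D.iA a ∧ ∀ (y : A) (l : ℤ), a ≠ y * D.u ^ l * y⁻¹) ∨
      (∃ b, g = D.iB b ∧ ∀ (y : B) (l : ℤ), b ≠ y * D.w ^ l * y⁻¹)) →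
      ((∃ a, h = D.iA a) ∨ ∃ b, h = D.iB b) → ¬ IsConj g h → Sep g h := by
    rintro g h (⟨a, rfl, ha⟩ | ⟨b, rfl, hb⟩) (⟨a', rfl⟩ | ⟨b', rfl⟩) hgh
    · exact (D.sep_of_free nA nB a ha).1 a' fun hc => hgh (D.iA.map_isConj hc.symm)
    · exact (D.sep_of_free nA nB a ha).2 b'
    · exact (D.symm.sep_of_free nB nA b hb).2 a'
    · exact (D.symm.sep_of_free nB nA b hb).1 b' fun hc => hgh (D.iB.map_isConj hc.symm)
  rcases red g hg with ⟨l, hl⟩ | hg'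
  · rcases red h hh with ⟨l', hl'⟩ | hh'
    · refine Sep.of_isConj ?_ hl hl'
      have hn : ¬ IsConj (D.iA (D.u ^ l)) (D.iA (D.u ^ l')) := fun hc =>
        hgh (hl.trans (hc.trans hl'.symm))
      by_cases habs : l.natAbs = l'.natAbs
      · rcases Int.natAbs_eq_natAbs_iff.1 habs with rfl | h2
        · exact (hn (IsConj.refl _)).elim
        · obtain rfl : l' = -l := by omega
          refine D.sep_inv nA nB l ?_ (fun hc => hn (D.iA.map_isConj hc)) fun hc => hn ?_
          · rintro rfl; exact hn (IsConj.refl _)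
          · have := D.iB.map_isConj hc
            simpa only [map_zpow, ← D.glue] using this
      · exact D.sep_zpow nA nB l l' habs
    · exact (free h g hh' hg fun hc => hgh hc.symm).symm
  · exact free g h hg' hh hgh

end Amalg

namespace Amalg

variable {A B G : Type} [Group A] [Group B] [Group G]

/-- The product of the first `n` syllables of a cyclic word; the first pair is rightmost. -/
def ev (D : Amalg A B G) {m : ℕ} (a : ZMod m → A) (b : ZMod m → B) : ℕ → G
  | 0 => 1
  | n + 1 => D.iB (b n) * D.iA (a n) * ev D a b n

theorem ev_add (D : Amalg A B G) {m : ℕ} (a : ZMod m → A) (b : ZMod m → B) (d n : ℕ) :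
    D.ev a b (n + d) = D.ev (fun τ : ZMod m => a (τ + (d : ZMod m))) (fun τ : ZMod m => b (τ + (d : ZMod m))) n * D.ev a b d := by
  induction n with
  | zero => simp [ev]
  | succ n ih => rw [Nat.add_right_comm, ev, ev, ih]; simp [mul_assoc]

theorem isConj_ev_shift (D : Amalg A B G) {m : ℕ} (a : ZMod m → A) (b : ZMod m → B) (d : ℕ) :
    IsConj (D.ev a b m) (D.ev (fun τ : ZMod m => a (τ + (d : ZMod m))) (fun τ : ZMod m => b (τ + (d : ZMod m))) m) := by
  rw [isConj_iff]
  refine ⟨D.ev a b d, ?_⟩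
  have h1 := D.ev_add a b d m
  have h2 := D.ev_add a b m d
  rw [add_comm] at h2
  simp only [CharP.cast_eq_zero, add_zero] at h2
  rw [← h2, h1]; group

/-- Congruent cyclic words are conjugate. -/
theorem isConj_ev_of_solution (D : Amalg A B G) {m : ℕ} (a a' : ZMod m → A) (b b' : ZMod m → B)
    (i i' : ZMod m → ℤ) (hA : ∀ τ, a' τ * D.u ^ i' τ = D.u ^ i τ * a τ)
    (hB : ∀ τ, b' τ * D.w ^ i τ = D.w ^ i' (τ + 1) * b τ) :
    IsConj (D.ev a b m) (D.ev a' b' m) := by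
  have key : ∀ n : ℕ, D.ev a' b' n * D.iA D.u ^ i' 0 = D.iA D.u ^ i' n * D.ev a b n := by
    intro n
    induction n with
    | zero => simp [ev]
    | succ n ih =>
      have h1 := congrArg D.iA (hA n)
      have h2 := congrArg D.iB (hB n)
      simp only [map_mul, map_zpow, ← D.glue] at h1 h2
      rw [ev, ev, mul_assoc, ih, mul_assoc, ← mul_assoc (D.iA (a' n)), h1]
      push_cast
      calc _ = (D.iB (b' n) * D.iA D.u ^ i n) * D.iA (a n) * D.ev a b n := by group
        _ = _ := by rw [h2]; group
  have := key m
  simp only [CharP.cast_eq_zero] at this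
  rw [isConj_iff]
  exact ⟨D.iA D.u ^ i' 0, by rw [← this]; group⟩

/-- The action of an amalgam on a cyclic cover of a permutation representation, twisted by an
integer valued function invariant under the amalgamated subgroup. -/
theorem exists_cover (D : Amalg A B G) {X : Type} (r : ℕ) (fA : A →* Equiv.Perm X)
    (fB : B →* Equiv.Perm X) (hf : fA D.u = fB D.w) (ω : X → ℤ) (hω : ∀ x, ω (fA D.u x) = ω x) :
    ∃ Ψ : G →* Equiv.Perm (X × ZMod r),
      (∀ a x n, Ψ (D.iA a) (x, n) = (fA a x, n)) ∧
      (∀ b x n, Ψ (D.iB b) (x, n) = (fB b x, n + ((ω x - ω (fB b x) : ℤ) : ZMod r))) ∧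
      ∀ g x n c, Ψ g (x, n + c) = ((Ψ g (x, n)).1, (Ψ g (x, n)).2 + c) := by
  let gA : A →* Equiv.Perm (X × ZMod r) :=
    { toFun := fun a => (fA a).prodCongr (Equiv.refl _)
      map_one' := by ext x <;> simp
      map_mul' := fun a b => by ext x <;> simp }
  let gB : B →* Equiv.Perm (X × ZMod r) :=
    { toFun := fun b =>
        { toFun := fun x => (fB b x.1, x.2 + ((ω x.1 - ω (fB b x.1) : ℤ) : ZMod r))
          invFun := fun x => ((fB b)⁻¹ x.1, x.2 - ((ω ((fB b)⁻¹ x.1) - ω x.1 : ℤ) : ZMod r))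
          left_inv := fun x => by simp
          right_inv := fun x => by simp }
      map_one' := by ext x <;> simp
      map_mul' := fun a b => by
        ext x
        · simp
        · simp; ring }
  obtain ⟨Ψ, h1, h2⟩ := D.lift _ gA gB (by
    ext1 x
    simp [gA, gB, ← hf, hω, Prod.map])
  have hA : ∀ a x n, Ψ (D.iA a) (x, n) = (fA a x, n) := fun a x n => by
    rw [show Ψ (D.iA a) = gA a from DFunLike.congr_fun h1 a]; rfl
  have hB : ∀ b x n, Ψ (D.iB b) (x, n) = (fB b x, n + ((ω x - ω (fB b x) : ℤ) : ZMod r)) :=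
    fun b x n => by
      rw [show Ψ (D.iB b) = gB b from DFunLike.congr_fun h2 b]; rfl
  refine ⟨Ψ, hA, hB, fun g => ?_⟩
  refine D.induction (p := fun g => ∀ x n c, Ψ g (x, n + c) = ((Ψ g (x, n)).1, (Ψ g (x, n)).2 + c))
    ?_ ?_ ?_ ?_ g
  · intro a x n c
    rw [hA, hA]
  · intro b x n c
    rw [hB, hB]
    simp only [Prod.mk.injEq, true_and]; ring
  · intro g h hg hh x n c
    rw [map_mul, Equiv.Perm.mul_apply, hh, hg, Equiv.Perm.mul_apply]
  · intro g hg x n c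
    rw [map_inv, Equiv.Perm.inv_eq_iff_eq, hg]
    simp

/-- A cyclic word of length at most `m` which shifts a point of the cover by `2 * m` passes
alternately through points of weight `-1` and of weight `1`. -/
theorem cover_rigid (D : Amalg A B G) {X : Type} {m : ℕ} (hm : 0 < m) (fA : A →* Equiv.Perm X)
    (fB : B →* Equiv.Perm X) (ω : X → ℤ) (hω1 : ∀ x, |ω x| ≤ 1)
    (Ψ : G →* Equiv.Perm (X × ZMod (4 * m + 1)))
    (hA : ∀ a x n, Ψ (D.iA a) (x, n) = (fA a x, n))
    (hB : ∀ b x n, Ψ (D.iB b) (x, n) =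
      (fB b x, n + ((ω x - ω (fB b x) : ℤ) : ZMod (4 * m + 1))))
    {m' : ℕ} (hm' : m' ≤ m) (a : ZMod m' → A) (b : ZMod m' → B) (x₀ : X)
    (n₀ : ZMod (4 * m + 1)) (h : Ψ (D.ev a b m') (x₀, n₀) = (x₀, n₀ + 2 * m)) :
    m' = m ∧ ∃ x : ZMod m' → X, ∀ τ, ω (x τ) = -1 ∧ ω (fA (a τ) (x τ)) = 1 ∧
      x (τ + 1) = fB (b τ) (fA (a τ) (x τ)) := by
  let xs : ℕ → X := fun n => Nat.rec x₀ (fun k x => fB (b k) (fA (a k) x)) n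
  have hxs : ∀ k : ℕ, xs (k + 1) = fB (b k) (fA (a k) (xs k)) := fun k => rfl
  let T : ℕ → ℤ := fun k => ω (fA (a k) (xs k)) - ω (xs (k + 1))
  have key : ∀ n : ℕ, Ψ (D.ev a b n) (x₀, n₀) =
      (xs n, n₀ + ((∑ k ∈ Finset.range n, T k : ℤ) : ZMod (4 * m + 1))) := by
    intro n
    induction n with
    | zero => simp [ev, xs]
    | succ n ih =>
      rw [ev, map_mul, map_mul, Equiv.Perm.mul_apply, Equiv.Perm.mul_apply, ih, hA, hB,
        Finset.sum_range_succ, hxs]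
      simp only [T, hxs]; push_cast; simp only [Prod.mk.injEq, true_and]; ring
  rw [key, Prod.mk.injEq] at h
  have hT : ∀ k, |T k| ≤ 2 := fun k => by
    have h1 := hω1 (fA (a k) (xs k))
    have h2 := hω1 (xs (k + 1))
    rw [abs_le] at *
    constructor <;> simp only [T] <;> linarith
  have hsum : |∑ k ∈ Finset.range m', T k| ≤ 2 * m' := by
    refine (Finset.abs_sum_le_sum_abs _ _).trans ?_
    refine (Finset.sum_le_card_nsmul _ _ 2 fun k _ => hT k).trans ?_
    simp [mul_comm]
  have hS : ∑ k ∈ Finset.range m', T k = 2 * m := by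
    have h2 := add_left_cancel h.2
    have h3 : ((∑ k ∈ Finset.range m', T k : ℤ) : ZMod (4 * m + 1)) = ((2 * m : ℤ) : ZMod _) := by
      rw [h2]; push_cast; ring
    rw [ZMod.intCast_eq_intCast_iff_dvd_sub] at h3
    rw [abs_le] at hsum
    have := Int.eq_zero_of_abs_lt_dvd h3 (by
      rw [abs_lt]; push_cast; constructor <;> linarith [hsum.1, hsum.2])
    linarith
  have hmm : m' = m := by
    have := (le_abs_self _).trans hsum
    rw [hS] at this
    have : (m : ℤ) ≤ m' := by linarith
    have : m ≤ m' := by exact_mod_cast this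
    omega
  subst hmm
  have hTk : ∀ k < m', T k = 2 := by
    intro k hk
    by_contra hne
    have : ∑ k ∈ Finset.range m', T k < ∑ k ∈ Finset.range m', 2 :=
      Finset.sum_lt_sum (fun i _ => (abs_le.1 (hT i)).2)
        ⟨k, by simpa using hk, lt_of_le_of_ne (abs_le.1 (hT k)).2 hne⟩
    rw [hS] at this
    simp [mul_comm] at this
  have hω : ∀ k < m', ω (fA (a k) (xs k)) = 1 ∧ ω (xs (k + 1)) = -1 := by
    intro k hk
    have h0 : ω (fA (a k) (xs k)) - ω (xs (k + 1)) = 2 := hTk k hk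
    have h1 := abs_le.1 (hω1 (fA (a k) (xs k)))
    have h2 := abs_le.1 (hω1 (xs (k + 1)))
    constructor <;> linarith [h1.1, h1.2, h2.1, h2.2]
  have : NeZero m' := ⟨by omega⟩
  have hx : ∀ τ : ZMod m', xs ((τ + 1).val) = xs (τ.val + 1) := by
    intro τ
    have hτ := ZMod.val_lt τ
    have e : τ + 1 = ((τ.val + 1 : ℕ) : ZMod m') := by push_cast; simp
    rcases Nat.lt_or_ge (τ.val + 1) m' with hl | hl
    · rw [e, ZMod.val_natCast_of_lt hl]
    · have : τ.val + 1 = m' := by omega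
      rw [e, this, CharP.cast_eq_zero, ZMod.val_zero, h.1]; rfl
  refine ⟨rfl, fun τ => xs τ.val, fun τ => ?_⟩
  have h1 := hω τ.val (ZMod.val_lt τ)
  have h2 := hω (τ - 1).val (ZMod.val_lt (τ - 1))
  rw [← hx (τ - 1), sub_add_cancel] at h2
  refine ⟨h2.2, by simpa using h1.1, ?_⟩
  change xs ((τ + 1).val) = _
  rw [hx, hxs]; simp

/-- Finite quotients detecting the length and the shape of a cyclically reduced word. -/
theorem exists_label_quotient (D : Amalg A B G) {m : ℕ} [NeZero m] (a : ZMod m → A)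
    (b : ZMod m → B) (N₁ : Subgroup A) (N₂ : Subgroup B)
    [N₁.Normal] [N₁.FiniteIndex] [N₂.Normal] [N₂.FiniteIndex] (s : ℕ) (hs : 0 < s)
    (h1 : ∀ i : ℤ, D.u ^ i ∈ N₁ ↔ (s : ℤ) ∣ i) (h2 : ∀ i : ℤ, D.w ^ i ∈ N₂ ↔ (s : ℤ) ∣ i)
    (ha : ∀ j (i : ℤ), (D.u ^ i)⁻¹ * a j ∉ N₁) (hb : ∀ j (i : ℤ), (D.w ^ i)⁻¹ * b j ∉ N₂) :
    ∃ (Q : Type) (_ : Group Q) (_ : Finite Q) (ψ : G →* Q),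
      ∀ k h, ψ k * ψ h * (ψ k)⁻¹ = ψ (D.ev a b m) →
        (∀ x, h ≠ D.iA x) ∧ (∀ x, h ≠ D.iB x) ∧
        (∀ (m' : ℕ) (a' : ZMod m' → A) (b' : ZMod m' → B), m' ≤ m → h = D.ev a' b' m' → m' = m) ∧
        ∀ (a' : ZMod m → A) (b' : ZMod m → B), h = D.ev a' b' m →
          ∃ (d : ℕ) (i i' : ZMod m → ℤ),
            (∀ τ, (a' τ)⁻¹ * (D.u ^ i τ * a (τ + d) * D.u ^ (- i' τ)) ∈ N₁) ∧
            ∀ τ, (b' τ)⁻¹ * (D.w ^ i' (τ + 1) * b (τ + d) * D.w ^ (- i τ)) ∈ N₂ := by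
  classical
  have hm : 0 < m := Nat.pos_of_ne_zero (NeZero.ne m)
  let f₁ := QuotientGroup.mk' N₁
  let f₂ := QuotientGroup.mk' N₂
  have hk1 : ∀ i : ℤ, D.u ^ i ∈ f₁.ker ↔ (s : ℤ) ∣ i := by simpa [f₁] using h1
  have hk2 : ∀ i : ℤ, D.w ^ i ∈ f₂.ker ↔ (s : ℤ) ∣ i := by simpa [f₂] using h2
  have ha' : ∀ j (i : ℤ), f₁ (a j) ≠ f₁ D.u ^ i := by
    intro j i h
    apply ha j i
    rw [← QuotientGroup.ker_mk' N₁, MonoidHom.mem_ker, map_mul, map_inv, map_zpow]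
    rw [inv_mul_eq_one]; exact h.symm
  have hb' : ∀ j (i : ℤ), f₂ (b j) ≠ f₂ D.w ^ i := by
    intro j i h
    apply hb j i
    rw [← QuotientGroup.ker_mk' N₂, MonoidHom.mem_ker, map_mul, map_inv, map_zpow]
    rw [inv_mul_eq_one]; exact h.symm
  let I₁ := ZMod m × Fin (Nat.card (B ⧸ N₂))
  let I₂ := ZMod m × Fin (Nat.card (A ⧸ N₁))
  let al : ZMod m → I₁ := fun j => (j, ⟨0, Nat.card_pos⟩)
  let be : ZMod m → I₂ := fun j => (j, ⟨0, Nat.card_pos⟩)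
  have hal : ∀ i j, al i = al j → i = j := fun i j h => congrArg Prod.fst h
  have hbe : ∀ i j, be i = be j → i = j := fun i j h => congrArg Prod.fst h
  have hzp : ∀ (i : ℤ) (x : I₁ × (A ⧸ N₁)), ((repl I₁ f₁ D.u) ^ i) x = (x.1, f₁ D.u ^ i * x.2) := by
    intro i x
    rw [← map_zpow, repl_apply, map_zpow]
  have hzp2 : ∀ (i : ℤ) (x : I₂ × (B ⧸ N₂)),
      ((repl I₂ f₂ D.w) ^ i) x = (x.1, f₂ D.w ^ i * x.2) := by
    intro i x
    rw [← map_zpow, repl_apply, map_zpow]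
  obtain ⟨θ, hθ, hθJ⟩ := exists_equiv_semiconj (X := I₁ × (A ⧸ N₁)) (Y := I₂ × (B ⧸ N₂))
    (J := ZMod m ⊕ ZMod m) (repl _ f₁ D.u) (repl _ f₂ D.w) s hs
    (repl_zpow_apply_eq_self _ f₁ D.u s hk1) (repl_zpow_apply_eq_self _ f₂ D.w s hk2)
    (by simp only [Nat.card_prod, Nat.card_fin, I₁, I₂]; ring)
    (Sum.elim (fun j => (al j, f₁ (a j))) fun j => (al (j + 1), 1))
    (Sum.elim (fun j => (be j, 1)) fun j => (be j, f₂ (b j)))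
    (by
      rintro (j | j) (k | k) ⟨i, hi⟩ <;> rw [hzp] at hi <;>
        simp only [Sum.elim_inl, Sum.elim_inr, Prod.mk.injEq] at hi
      · rw [hal _ _ hi.1]
      · exfalso
        apply ha' j (-i)
        rw [zpow_neg]; exact eq_inv_of_mul_eq_one_right hi.2
      · exfalso
        apply ha' k i
        rw [← hi.2, mul_one]
      · rw [add_right_cancel (hal _ _ hi.1)])
    (by
      rintro (j | j) (k | k) ⟨i, hi⟩ <;> rw [hzp2] at hi <;>
        simp only [Sum.elim_inl, Sum.elim_inr, Prod.mk.injEq] at hi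
      · rw [hbe _ _ hi.1]
      · exfalso
        apply hb' k i
        rw [← hi.2, mul_one]
      · exfalso
        apply hb' j (-i)
        rw [zpow_neg]; exact eq_inv_of_mul_eq_one_right hi.2
      · rw [hbe _ _ hi.1])
  have hθz : ∀ (i : ℤ) x, θ (x.1, f₁ D.u ^ i * x.2) = ((θ x).1, f₂ D.w ^ i * (θ x).2) := by
    intro i x
    rw [← hzp, ← hzp2]
    have hp : ∀ n : ℕ, ∀ x, θ (((repl _ f₁ D.u) ^ n) x) = ((repl _ f₂ D.w) ^ n) (θ x) := by
      intro n
      induction n with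
      | zero => simp
      | succ n ih => intro x; rw [pow_succ, pow_succ, Equiv.Perm.mul_apply, ih, hθ]; rfl
    obtain ⟨n, rfl | rfl⟩ := i.eq_nat_or_neg
    · rw [zpow_natCast, zpow_natCast, hp]
    · rw [zpow_neg, zpow_neg, zpow_natCast, zpow_natCast, Equiv.Perm.eq_inv_iff_eq, ← hp,
        ← Equiv.Perm.mul_apply, mul_inv_cancel, Equiv.Perm.one_apply]
  have hy : ∀ j (i : ℤ), θ (al j, f₁ D.u ^ i * f₁ (a j)) = (be j, f₂ D.w ^ i) := by
    intro j i
    have h0 := hθJ (Sum.inl j)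
    simp only [Sum.elim_inl] at h0
    rw [hθz i (al j, f₁ (a j)), h0, mul_one]
  have hx : ∀ j (i : ℤ), θ (al (j + 1), f₁ D.u ^ i) = (be j, f₂ D.w ^ i * f₂ (b j)) := by
    intro j i
    have h0 := hθJ (Sum.inr j)
    simp only [Sum.elim_inr] at h0
    have := hθz i (al (j + 1), 1)
    rwa [h0, mul_one] at this
  let P₁ : I₁ × (A ⧸ N₁) → Prop := fun x => ∃ j, ∃ i : ℤ, x = (al j, f₁ D.u ^ i * f₁ (a j))
  let P₀ : I₁ × (A ⧸ N₁) → Prop := fun x => ∃ j, ∃ i : ℤ, x = (al j, f₁ D.u ^ i)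
  have hP : ∀ x, P₁ x → ¬ P₀ x := by
    rintro _ ⟨j, i, rfl⟩ ⟨j', i', h⟩
    rw [Prod.mk.injEq] at h
    apply ha' j (-i + i')
    rw [zpow_add, ← h.2]; group
  let ω : I₁ × (A ⧸ N₁) → ℤ := fun x => if P₁ x then 1 else if P₀ x then -1 else 0
  have hω1 : ∀ x, |ω x| ≤ 1 := by
    intro x; simp only [ω]; split_ifs <;> simp
  have hωp : ∀ x, ω x = 1 → P₁ x := by
    intro x h; simp only [ω] at h; split_ifs at h <;> first | assumption | simp at h
  have hωn : ∀ x, ω x = -1 → P₀ x := by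
    intro x h; simp only [ω] at h; split_ifs at h; assumption
  have hωu : ∀ x, ω (repl I₁ f₁ D.u x) = ω x := by
    intro x
    have e1 : P₁ (repl I₁ f₁ D.u x) ↔ P₁ x := by
      constructor
      · rintro ⟨j, i, h⟩
        rw [repl_apply, Prod.mk.injEq] at h
        refine ⟨j, i - 1, Prod.ext h.1 ?_⟩
        have h3 : f₁ D.u * x.2 = f₁ D.u ^ i * f₁ (a j) := h.2
        rw [sub_eq_neg_add, zpow_add, mul_assoc, ← h3]; group
      · rintro ⟨j, i, rfl⟩
        refine ⟨j, i + 1, ?_⟩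
        rw [repl_apply, add_comm, zpow_one_add, mul_assoc]
    have e0 : P₀ (repl I₁ f₁ D.u x) ↔ P₀ x := by
      constructor
      · rintro ⟨j, i, h⟩
        rw [repl_apply, Prod.mk.injEq] at h
        refine ⟨j, i - 1, Prod.ext h.1 ?_⟩
        have h3 : f₁ D.u * x.2 = f₁ D.u ^ i := h.2
        rw [sub_eq_neg_add, zpow_add, ← h3]; group
      · rintro ⟨j, i, rfl⟩
        refine ⟨j, i + 1, ?_⟩
        rw [repl_apply, add_comm, zpow_one_add]
    simp only [ω, e1, e0]
  let fB : B →* Equiv.Perm (I₁ × (A ⧸ N₁)) := θ.symm.permCongrHom.toMonoidHom.comp (repl _ f₂)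
  have hfB : ∀ y x, θ (fB y x) = ((θ x).1, f₂ y * (θ x).2) := by
    intro y x
    simp [fB, Equiv.permCongrHom, Equiv.permCongr_apply]
  obtain ⟨Ψ, hA, hB, hΨ⟩ := D.exists_cover (4 * m + 1) (repl _ f₁) fB (by
    ext1 x
    apply θ.injective
    rw [hfB, hθ, repl_apply]) ω hωu
  refine ⟨_, _, inferInstance, Ψ, fun k h hk => ?_⟩
  have hg : Ψ (D.ev a b m) ((al 0, 1), 0) = ((al 0, (1 : A ⧸ N₁)), (2 * m : ZMod (4 * m + 1))) := by
    have hxs : ∀ n : ℕ, Ψ (D.ev a b n) ((al 0, 1), 0) = ((al n, (1 : A ⧸ N₁)), (2 * n : ZMod (4 * m + 1))) := by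
      intro n
      induction n with
      | zero => simp [ev]
      | succ n ih =>
        rw [ev, map_mul, map_mul, Equiv.Perm.mul_apply, Equiv.Perm.mul_apply, ih, hA, hB,
          repl_apply]
        have e : fB (b n) (al n, f₁ (a n) * 1) = (al (n + 1), 1) := by
          apply θ.injective
          have e1 := hy n 0
          have e2 := hx n 0
          simp only [zpow_zero, one_mul] at e1 e2
          rw [hfB, mul_one, e1, e2, mul_one]
        rw [e]
        have o1 : ω (al n, f₁ (a n) * 1) = 1 := if_pos ⟨n, 0, by simp⟩
        have p0 : P₀ (al (n + 1), 1) := ⟨n + 1, 0, by simp⟩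
        have o2 : ω (al (n + 1), 1) = -1 := by
          simp only [ω]
          rw [if_neg fun h => hP _ h p0, if_pos p0]
        rw [o1, o2]
        push_cast
        simp only [Prod.mk.injEq, true_and]; ring
    have := hxs m
    simpa using this
  obtain ⟨x₀, n₀, hh⟩ : ∃ x₀ n₀, Ψ h (x₀, n₀) = (x₀, n₀ + 2 * m) := by
    refine ⟨((Ψ k)⁻¹ ((al 0, 1), 0)).1, ((Ψ k)⁻¹ ((al 0, 1), 0)).2, ?_⟩
    have h1 : Ψ h = (Ψ k)⁻¹ * Ψ (D.ev a b m) * Ψ k := by rw [← hk]; group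
    have h2 := hΨ k⁻¹ (al 0, 1) 0 (2 * m)
    rw [zero_add, map_inv] at h2
    rw [Prod.mk.eta, h1, Equiv.Perm.mul_apply, ← Equiv.Perm.mul_apply (Ψ k), mul_inv_cancel,
      Equiv.Perm.one_apply, Equiv.Perm.mul_apply, hg, h2]
  have h2m : (2 * m : ZMod (4 * m + 1)) ≠ 0 := by
    intro h0
    have h3 : ((2 * m : ℕ) : ZMod (4 * m + 1)) = 0 := by push_cast; exact h0
    rw [ZMod.natCast_eq_zero_iff] at h3
    have := Nat.le_of_dvd (by omega) h3
    omega
  refine ⟨?_, ?_, ?_, ?_⟩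
  · rintro x rfl
    rw [hA, Prod.mk.injEq, left_eq_add] at hh
    exact h2m hh.2
  · rintro x rfl
    rw [hB, Prod.mk.injEq] at hh
    rw [hh.1, sub_self, Int.cast_zero, add_zero, left_eq_add] at hh
    exact h2m hh.2
  · rintro m' a' b' hmm rfl
    exact (D.cover_rigid hm _ fB ω hω1 Ψ hA hB hmm a' b' x₀ n₀ hh).1
  · rintro a' b' rfl
    obtain ⟨-, x, hxx⟩ := D.cover_rigid hm _ fB ω hω1 Ψ hA hB le_rfl a' b' x₀ n₀ hh
    have q0 := fun τ => hωn _ (hxx τ).1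
    have q1 := fun τ => hωp _ (hxx τ).2.1
    choose j' i' hx' using q0
    choose j i hy' using q1
    have hjj : ∀ τ, j' τ = j τ ∧ f₁ (a' τ) * f₁ D.u ^ i' τ = f₁ D.u ^ i τ * f₁ (a (j τ)) := by
      intro τ
      have := hy' τ
      rw [hx', repl_apply, Prod.mk.injEq] at this
      exact ⟨hal _ _ this.1, this.2⟩
    have hjb : ∀ τ, j' (τ + 1) = j τ + 1 ∧
        f₂ (b' τ) * f₂ D.w ^ i τ = f₂ D.w ^ i' (τ + 1) * f₂ (b (j τ)) := by
      intro τ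
      have h0 := congrArg θ (hxx τ).2.2
      rw [hfB, hy', hy, hx', ← sub_add_cancel (j' (τ + 1)) 1, hx, Prod.mk.injEq] at h0
      have h1 := hbe _ _ h0.1
      rw [h1] at h0
      exact ⟨by rw [← h1]; ring, h0.2.symm⟩
    have hj : ∀ τ, j τ = τ + j 0 := by
      have : ∀ n : ℕ, j n = n + j 0 := by
        intro n
        induction n with
        | zero => simp
        | succ n ih =>
          push_cast
          rw [← (hjj _).1, (hjb _).1, ih]; ring
      intro τ
      simpa using this τ.val
    refine ⟨(j 0).val, i, i', fun τ => ?_, fun τ => ?_⟩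
    · have h0 := (hjj τ).2
      rw [hj τ] at h0
      rw [← QuotientGroup.ker_mk' N₁, MonoidHom.mem_ker]
      change f₁ _ = 1
      simp only [map_mul, map_inv, map_zpow, ZMod.natCast_val, ZMod.cast_id', id]
      rw [← h0]; group
    · have h0 := (hjb τ).2
      rw [hj τ] at h0
      rw [← QuotientGroup.ker_mk' N₂, MonoidHom.mem_ker]
      change f₂ _ = 1
      simp only [map_mul, map_inv, map_zpow, ZMod.natCast_val, ZMod.cast_id', id]
      rw [← h0]; group

end Amalg

/-- A subgroup of a finitely generated abelian group is closed in the profinite topology. -/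
theorem mem_of_forall_eq_add_nsmul {W : Type} [AddCommGroup W] [AddGroup.FG W] (L : AddSubgroup W)
    (x : W) (h : ∀ t : ℕ, 0 < t → ∃ l ∈ L, ∃ z, x = l + t • z) : x ∈ L := by
  classical
  obtain ⟨n, ι, _, p, hp, e, ⟨f⟩⟩ := AddCommGroup.equiv_free_prod_directSum_zmod (W ⧸ L)
  rw [← QuotientAddGroup.eq_zero_iff]
  have h' : ∀ t : ℕ, 0 < t → ∃ z, f (x : W ⧸ L) = t • z := by
    intro t ht
    obtain ⟨l, hl, z, rfl⟩ := h t ht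
    refine ⟨f z, ?_⟩
    rw [← map_nsmul]
    congr 1
    rw [QuotientAddGroup.mk_add, (QuotientAddGroup.eq_zero_iff l).2 hl, zero_add]; rfl
  rw [← f.map_eq_zero_iff]
  ext i
  · by_contra hne
    obtain ⟨z, hz⟩ := h' ((f (x : W ⧸ L)).1 i).natAbs.succ (Nat.succ_pos _)
    have h1 := congrArg (fun y => y.1 i) hz
    have h2 : ((((f (x : W ⧸ L)).1 i).natAbs.succ : ℕ) : ℤ) ∣ (f (x : W ⧸ L)).1 i :=
      ⟨z.1 i, by simpa using h1⟩
    apply hne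
    have := Int.eq_zero_of_abs_lt_dvd h2 (by rw [Int.abs_eq_natAbs]; push_cast; linarith)
    simpa using this
  · obtain ⟨z, hz⟩ := h' (p i ^ e i) (pow_pos (hp i).pos _)
    have h1 := congrArg (fun y => y.2 i) hz
    simp only [Prod.smul_snd, DirectSum.smul_apply, nsmul_eq_mul, CharP.cast_eq_zero,
      zero_mul] at h1
    rw [h1]; rfl

/-- A system of affine conditions over the integers which is solvable modulo every positive
integer is solvable. -/
theorem exists_solution_of_forall_mod {V K : Type} [AddCommGroup V] [Finite K]
    (E : K → V →+ ℤ × ℤ) (S : K → Set (ℤ × ℤ))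
    (hS : ∀ k, ∀ x ∈ S k, ∀ y ∈ S k, ∀ z ∈ S k, x - y + z ∈ S k)
    (h : ∀ t : ℕ, 0 < t → ∃ v, ∀ k, ∃ s ∈ S k, ∃ z, E k v = s + t • z) :
    ∃ v, ∀ k, E k v ∈ S k := by
  have : Fintype K := Fintype.ofFinite K
  have hne : ∀ k, ∃ s, s ∈ S k := by
    obtain ⟨v, hv⟩ := h 1 one_pos
    intro k
    obtain ⟨s, hs, -⟩ := hv k
    exact ⟨s, hs⟩
  choose s₀ hs₀ using hne
  let H : K → AddSubgroup (ℤ × ℤ) := fun k =>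
    { carrier := {x | s₀ k + x ∈ S k}
      zero_mem' := by simpa using hs₀ k
      add_mem' := by
        intro x y hx hy
        have := hS k _ hx _ (hs₀ k) _ hy
        simp only [Set.mem_ofPred_eq]
        convert this using 1; abel
      neg_mem' := by
        intro x hx
        have := hS k _ (hs₀ k) _ hx _ (hs₀ k)
        simp only [Set.mem_ofPred_eq]
        convert this using 1; abel }
  let E' : V →+ (K → ℤ × ℤ) := AddMonoidHom.mk' (fun v k => E k v) (by intro a b; ext k <;> simp)
  have hmem : s₀ ∈ E'.range ⊔ AddSubgroup.pi Set.univ H := by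
    have : AddGroup.FG (K → ℤ × ℤ) := AddGroup.fg_iff_addMonoid_fg.2 inferInstance
    apply mem_of_forall_eq_add_nsmul
    intro t ht
    obtain ⟨v, hv⟩ := h t ht
    choose s hs z hz using hv
    refine ⟨E' v + (fun k => -(s k - s₀ k)), add_mem (AddSubgroup.mem_sup_left ⟨v, rfl⟩)
      (AddSubgroup.mem_sup_right ?_), fun k => - z k, ?_⟩
    · rw [AddSubgroup.mem_pi]
      intro k _
      apply neg_mem
      change s₀ k + (s k - s₀ k) ∈ S k
      simpa using hs k
    · funext k
      simp only [E', Pi.add_apply, Pi.smul_apply, AddMonoidHom.mk'_apply, hz]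
      abel_nf
      simp
  rw [AddSubgroup.mem_sup] at hmem
  obtain ⟨_, ⟨v, rfl⟩, y, hy, hxy⟩ := hmem
  refine ⟨v, fun k => ?_⟩
  rw [AddSubgroup.mem_pi] at hy
  have h1 : s₀ k + -y k ∈ S k := neg_mem (hy k trivial)
  have h2 : E k v + y k = s₀ k := congrFun hxy k
  rwa [← h2, add_neg_cancel_right] at h1

namespace Amalg

variable {A B G : Type} [Group A] [Group B] [Group G]

/-- The product of a word whose first pair is rightmost. -/
def evList (D : Amalg A B G) : List (A × B) → G
  | [] => 1
  | x :: L => evList D L * (D.iB x.2 * D.iA x.1)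

theorem evList_append (D : Amalg A B G) (L M : List (A × B)) :
    D.evList (L ++ M) = D.evList M * D.evList L := by
  induction L with
  | nil => simp [evList]
  | cons x L ih => rw [List.cons_append, evList, evList, ih, mul_assoc]

theorem isConj_evList_append (D : Amalg A B G) (L M : List (A × B)) :
    IsConj (D.evList (L ++ M)) (D.evList (M ++ L)) := by
  rw [evList_append, evList_append, isConj_iff]
  exact ⟨D.evList L, by group⟩

theorem exists_evList (D : Amalg A B G) (g : G) : ∃ L, g = D.evList L := by
  have : (∃ L, g = D.evList L) ∧ ∃ L, g⁻¹ = D.evList L := by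
    refine D.induction (p := fun g => (∃ L, g = D.evList L) ∧ ∃ L, g⁻¹ = D.evList L)
      ?_ ?_ ?_ ?_ g
    · intro a
      exact ⟨⟨[(a, 1)], by simp [evList]⟩, ⟨[(a⁻¹, 1)], by simp [evList]⟩⟩
    · intro a
      exact ⟨⟨[(1, a)], by simp [evList]⟩, ⟨[(1, a⁻¹)], by simp [evList]⟩⟩
    · rintro x y ⟨⟨L, rfl⟩, ⟨L', hL'⟩⟩ ⟨⟨M, rfl⟩, ⟨M', hM'⟩⟩
      exact ⟨⟨M ++ L, by rw [evList_append]⟩,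
        ⟨L' ++ M', by rw [evList_append, mul_inv_rev, hL', hM']⟩⟩
    · rintro x ⟨h1, h2⟩
      exact ⟨h2, by simpa using h1⟩
  exact this.1

theorem evList_eq_ev (D : Amalg A B G) (L : List (A × B)) :
    D.evList L = D.ev (fun τ : ZMod L.length => (L.getD τ.val (1, 1)).1)
      (fun τ : ZMod L.length => (L.getD τ.val (1, 1)).2) L.length := by
  have key : ∀ n ≤ L.length, D.evList (L.take n) =
      D.ev (fun τ : ZMod L.length => (L.getD τ.val (1, 1)).1)
      (fun τ : ZMod L.length => (L.getD τ.val (1, 1)).2) n := by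
    intro n
    induction n with
    | zero => simp [ev, evList]
    | succ n ih =>
      intro hn
      rw [List.take_succ_eq_append_getElem (by omega), evList_append, ev, ← ih (by omega),
        ZMod.val_natCast_of_lt (by omega)]
      simp [evList, List.getElem?_eq_getElem (show n < L.length by omega)]
  rw [← key _ le_rfl, List.take_length]

/-- Every element of an amalgam is conjugate to an element of a factor or to a cyclically
reduced word. -/
theorem exists_normal_form (D : Amalg A B G) (g : G) :
    (∃ a, IsConj g (D.iA a)) ∨ (∃ b, IsConj g (D.iB b)) ∨
      ∃ (m : ℕ) (_ : NeZero m) (a : ZMod m → A) (b : ZMod m → B), IsConj g (D.ev a b m) ∧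
        (∀ j (i : ℤ), a j ≠ D.u ^ i) ∧ ∀ j (i : ℤ), b j ≠ D.w ^ i := by
  classical
  have hex : ∃ m, ∃ L : List (A × B), L.length = m ∧ IsConj g (D.evList L) := by
    obtain ⟨L, rfl⟩ := D.exists_evList g
    exact ⟨_, L, rfl, IsConj.refl _⟩
  obtain ⟨L, hL, hc⟩ := Nat.find_spec hex
  have hmin : ∀ M : List (A × B), IsConj g (D.evList M) → L.length ≤ M.length := by
    intro M hM
    rw [hL]
    exact Nat.find_min' hex ⟨M, rfl, hM⟩
  by_contra hcon
  push Not at hcon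
  obtain ⟨hA, hB, hM⟩ := hcon
  have hgl : ∀ k : ℤ, D.iA D.u ^ k = D.iB D.w ^ k := fun k => by rw [D.glue]
  have hu : ∀ x ∈ L, ∀ k : ℤ, x.1 ≠ D.u ^ k := by
    rintro ⟨a, b⟩ hx k (rfl : a = _)
    obtain ⟨L₁, L₂, rfl⟩ := List.append_of_mem hx
    have h1 := hc.trans (D.isConj_evList_append L₁ _)
    rw [List.cons_append] at h1
    rcases List.eq_nil_or_concat (L₂ ++ L₁) with h0 | ⟨L', y, h0⟩
    · rw [h0] at h1
      apply hB (b * D.w ^ k)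
      simpa [evList, hgl] using h1
    · rw [h0, List.concat_eq_append, ← List.cons_append] at h1
      have h2 := h1.trans (D.isConj_evList_append _ [y])
      have h3 := hmin ((y.1, b * D.w ^ k * y.2) :: L') (by
        convert h2 using 1
        simp only [List.cons_append, List.nil_append, evList, map_mul, map_zpow, hgl, mul_assoc])
      have h4 := congrArg List.length h0
      simp at h3 h4
      omega
  have hw : ∀ x ∈ L, ∀ k : ℤ, x.2 ≠ D.w ^ k := by
    rintro ⟨a, b⟩ hx k (rfl : b = _)
    obtain ⟨L₁, L₂, rfl⟩ := List.append_of_mem hx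
    have h1 := hc.trans (D.isConj_evList_append L₁ _)
    rw [List.cons_append] at h1
    rcases h0 : L₂ ++ L₁ with _ | ⟨y, L'⟩
    · rw [h0] at h1
      apply hA (D.u ^ k * a)
      simpa [evList, hgl] using h1
    · rw [h0] at h1
      have h3 := hmin ((y.1 * D.u ^ k * a, y.2) :: L') (by
        convert h1 using 1
        simp only [evList, map_mul, map_zpow, hgl, mul_assoc])
      have h4 := congrArg List.length h0
      simp at h3 h4
      omega
  have h0 : L ≠ [] := by
    rintro rfl
    exact hA 1 (by simpa [evList] using hc)
  have hne : NeZero L.length := ⟨by simpa using h0⟩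
  have hget : ∀ τ : ZMod L.length, L.getD τ.val (1, 1) ∈ L := by
    intro τ
    have := ZMod.val_lt τ
    rw [List.getD_eq_getElem _ _ this]
    exact List.getElem_mem _
  obtain ⟨j, i, hji⟩ := hM _ hne _ _ (D.evList_eq_ev L ▸ hc) fun τ i => hu _ (hget τ) i
  exact hw _ (hget j) i hji

end Amalg

theorem coset_of_double_coset {A : Type} [Group A] (u x y : A) {p q r : ℤ × ℤ}
    (hp : x = u ^ p.1 * y * u ^ (-p.2)) (hq : x = u ^ q.1 * y * u ^ (-q.2))
    (hr : x = u ^ r.1 * y * u ^ (-r.2)) :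
    x = u ^ (p - q + r).1 * y * u ^ (-(p - q + r).2) := by
  calc x = u ^ p.1 * y * u ^ (-p.2) := hp
    _ = u ^ p.1 * (u ^ (-q.1) * (u ^ q.1 * y * u ^ (-q.2)) * u ^ q.2) * u ^ (-p.2) := by group
    _ = u ^ p.1 * (u ^ (-q.1) * x * u ^ q.2) * u ^ (-p.2) := by rw [← hq]
    _ = u ^ p.1 * (u ^ (-q.1) * (u ^ r.1 * y * u ^ (-r.2)) * u ^ q.2) * u ^ (-p.2) := by rw [← hr]
    _ = _ := by
      simp only [Prod.fst_add, Prod.fst_sub, Prod.snd_add, Prod.snd_sub, neg_add, neg_sub]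
      group

namespace Amalg

variable {A B G : Type} [Group A] [Group B] [Group G]

/-- Variant of `exists_label_quotient` with quotients of the factors subject to eventual
conditions. -/
theorem exists_label_quotient_of_eventually (D : Amalg A B G) (nA : Nice A D.u) (nB : Nice B D.w)
    {pA : Subgroup A → Prop} {pB : Subgroup B → Prop} (hA : ∀ᶠ N in profin A, pA N)
    (hB : ∀ᶠ N in profin B, pB N) {m : ℕ} [NeZero m] (a : ZMod m → A) (b : ZMod m → B)
    (ha : ∀ j (i : ℤ), a j ≠ D.u ^ i) (hb : ∀ j (i : ℤ), b j ≠ D.w ^ i) :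
    ∃ N₁ N₂, pA N₁ ∧ pB N₂ ∧ ∃ (Q : Type) (_ : Group Q) (_ : Finite Q) (ψ : G →* Q),
      ∀ k h, ψ k * ψ h * (ψ k)⁻¹ = ψ (D.ev a b m) →
        (∀ x, h ≠ D.iA x) ∧ (∀ x, h ≠ D.iB x) ∧
        (∀ (m' : ℕ) (a' : ZMod m' → A) (b' : ZMod m' → B), m' ≤ m → h = D.ev a' b' m' → m' = m) ∧
        ∀ (a' : ZMod m → A) (b' : ZMod m → B), h = D.ev a' b' m →
          ∃ (d : ℕ) (i i' : ZMod m → ℤ),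
            (∀ τ, (a' τ)⁻¹ * (D.u ^ i τ * a (τ + d) * D.u ^ (- i' τ)) ∈ N₁) ∧
            ∀ τ, (b' τ)⁻¹ * (D.w ^ i' (τ + 1) * b (τ + d) * D.w ^ (- i τ)) ∈ N₂ := by
  have out : ∀ {C : Type} [Group C] {v : C} (n : Nice C v) (x : C), (∀ i : ℤ, x ≠ v ^ i) →
      ∀ᶠ N in profin C, ∀ i : ℤ, (v ^ i)⁻¹ * x ∉ N := by
    intro C _ v n x hx
    filter_upwards [n.dc x 1 1 one_pos] with N hN i hi
    obtain ⟨α, β, -, -, h⟩ := hN i 0 (by simpa using inv_mem hi)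
    exact hx (α + β) (by rw [h, zpow_add, mul_one])
  have hA' : ∀ᶠ N in profin A, pA N ∧ ∀ j (i : ℤ), (D.u ^ i)⁻¹ * a j ∉ N :=
    hA.and (Filter.eventually_all.2 fun j => out nA _ (ha j))
  have hB' : ∀ᶠ N in profin B, pB N ∧ ∀ j (i : ℤ), (D.w ^ i)⁻¹ * b j ∉ N :=
    hB.and (Filter.eventually_all.2 fun j => out nB _ (hb j))
  obtain ⟨N₁, N₂, s, i1, i2, i3, i4, p1, p2, hs, -, h1, h2⟩ :=
    D.exists_compatible nA nB hA' hB' 1 one_pos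
  exact ⟨N₁, N₂, p1.1, p2.1, D.exists_label_quotient a b N₁ N₂ s hs h1 h2 p1.2 p2.2⟩

theorem isConj_ev_of_forall_mod (D : Amalg A B G) {m : ℕ} [NeZero m]
    (a a' : ZMod m → A) (b b' : ZMod m → B) (d : ℕ)
    (h : ∀ t : ℕ, 0 < t → ∃ i i' : ZMod m → ℤ,
      (∀ τ, ∃ α β : ℤ, (t : ℤ) ∣ i τ - α ∧ (t : ℤ) ∣ - i' τ - β ∧
        a' τ = D.u ^ α * a (τ + d) * D.u ^ β) ∧
      ∀ τ, ∃ α β : ℤ, (t : ℤ) ∣ i' (τ + 1) - α ∧ (t : ℤ) ∣ - i τ - β ∧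
        b' τ = D.w ^ α * b (τ + d) * D.w ^ β) :
    IsConj (D.ev a b m) (D.ev a' b' m) := by
  let E : ZMod m ⊕ ZMod m → (ZMod m → ℤ) × (ZMod m → ℤ) →+ ℤ × ℤ := Sum.elim
    (fun τ => AddMonoidHom.mk' (fun v => (v.1 τ, v.2 τ)) fun _ _ => rfl)
    (fun τ => AddMonoidHom.mk' (fun v => (v.2 (τ + 1), v.1 τ)) fun _ _ => rfl)
  let S : ZMod m ⊕ ZMod m → Set (ℤ × ℤ) := Sum.elim
    (fun τ => {s | a' τ = D.u ^ s.1 * a (τ + d) * D.u ^ (-s.2)})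
    (fun τ => {s | b' τ = D.w ^ s.1 * b (τ + d) * D.w ^ (-s.2)})
  obtain ⟨v, hv⟩ := exists_solution_of_forall_mod E S (by
    rintro (τ | τ) x hx y hy z hz
    · exact coset_of_double_coset _ _ _ hx hy hz
    · exact coset_of_double_coset _ _ _ hx hy hz) (by
    intro t ht
    obtain ⟨i, i', h1, h2⟩ := h t ht
    refine ⟨(i, i'), ?_⟩
    rintro (τ | τ)
    · obtain ⟨α, β, ⟨x, hx⟩, ⟨y, hy⟩, h3⟩ := h1 τ
      refine ⟨(α, -β), by simpa [S] using h3, (x, -y), ?_⟩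
      simp only [E, Sum.elim_inl, AddMonoidHom.mk'_apply, Prod.ext_iff, Prod.fst_add,
        Prod.snd_add, nsmul_eq_mul, Prod.fst_mul, Prod.snd_mul, Prod.fst_natCast,
        Prod.snd_natCast]
      constructor <;> linarith
    · obtain ⟨α, β, ⟨x, hx⟩, ⟨y, hy⟩, h3⟩ := h2 τ
      refine ⟨(α, -β), by simpa [S] using h3, (x, -y), ?_⟩
      simp only [E, Sum.elim_inr, AddMonoidHom.mk'_apply, Prod.ext_iff, Prod.fst_add,
        Prod.snd_add, nsmul_eq_mul, Prod.fst_mul, Prod.snd_mul, Prod.fst_natCast,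
        Prod.snd_natCast]
      constructor <;> linarith)
  refine (D.isConj_ev_shift a b d).trans (D.isConj_ev_of_solution _ _ _ _ v.1 v.2 ?_ ?_)
  · intro τ
    have h1 : a' τ = D.u ^ v.1 τ * a (τ + d) * D.u ^ (-v.2 τ) := hv (Sum.inl τ)
    rw [h1]; group
  · intro τ
    have h1 : b' τ = D.w ^ v.2 (τ + 1) * b (τ + d) * D.w ^ (-v.1 τ) := hv (Sum.inr τ)
    rw [h1]; group

/-- A cyclically reduced word is separated from the nonconjugate elements of at most the same
length. -/
theorem sep_hyperbolic (D : Amalg A B G) (nA : Nice A D.u) (nB : Nice B D.w)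
    {m : ℕ} [NeZero m] (a : ZMod m → A) (b : ZMod m → B)
    (ha : ∀ j (i : ℤ), a j ≠ D.u ^ i) (hb : ∀ j (i : ℤ), b j ≠ D.w ^ i) (h : G)
    (hh : (∃ x, h = D.iA x) ∨ (∃ x, h = D.iB x) ∨
      ∃ (m' : ℕ) (a' : ZMod m' → A) (b' : ZMod m' → B), m' ≤ m ∧ h = D.ev a' b' m')
    (hc : ¬ IsConj (D.ev a b m) h) : Sep (D.ev a b m) h := by
  by_cases hm : ∃ (a' : ZMod m → A) (b' : ZMod m → B), h = D.ev a' b' m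
  · obtain ⟨a', b', rfl⟩ := hm
    have ht : ∀ d : ZMod m, ∃ t : ℕ, 0 < t ∧ ¬ ∃ i i' : ZMod m → ℤ,
        (∀ τ, ∃ α β : ℤ, (t : ℤ) ∣ i τ - α ∧ (t : ℤ) ∣ - i' τ - β ∧
          a' τ = D.u ^ α * a (τ + d) * D.u ^ β) ∧
        ∀ τ, ∃ α β : ℤ, (t : ℤ) ∣ i' (τ + 1) - α ∧ (t : ℤ) ∣ - i τ - β ∧
          b' τ = D.w ^ α * b (τ + d) * D.w ^ β := by
      intro d
      by_contra hcon
      push Not at hcon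
      apply hc
      apply D.isConj_ev_of_forall_mod a a' b b' d.val
      simpa using hcon
    choose t ht0 ht using ht
    obtain ⟨T, hT⟩ : ∃ T, T = ∏ d, t d := ⟨_, rfl⟩
    have hT0 : 0 < T := hT ▸ Finset.prod_pos fun d _ => ht0 d
    have hdvd : ∀ d, (t d : ℤ) ∣ T := fun d =>
      Int.natCast_dvd_natCast.2 (hT ▸ Finset.dvd_prod_of_mem t (Finset.mem_univ d))
    obtain ⟨N₁, N₂, h1, h2, Q, iQ, iF, ψ, hψ⟩ := D.exists_label_quotient_of_eventually nA nB
      (Filter.eventually_all.2 fun d : ZMod m => Filter.eventually_all.2 fun τ : ZMod m =>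
        nA.dc (a' τ) (a (τ + d)) T hT0)
      (Filter.eventually_all.2 fun d : ZMod m => Filter.eventually_all.2 fun τ : ZMod m =>
        nB.dc (b' τ) (b (τ + d)) T hT0) a b ha hb
    refine ⟨Q, iQ, iF, ψ, fun k hk => ?_⟩
    obtain ⟨d, i, i', h3, h4⟩ := (hψ k _ hk).2.2.2 a' b' rfl
    refine ht d ⟨i, i', fun τ => ?_, fun τ => ?_⟩
    · obtain ⟨α, β, e1, e2, e3⟩ := h1 d τ _ _ (h3 τ)
      exact ⟨α, β, (hdvd d).trans e1, (hdvd d).trans e2, e3⟩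
    · obtain ⟨α, β, e1, e2, e3⟩ := h2 d τ _ _ (h4 τ)
      exact ⟨α, β, (hdvd d).trans e1, (hdvd d).trans e2, e3⟩
  · obtain ⟨N₁, N₂, -, -, Q, iQ, iF, ψ, hψ⟩ := D.exists_label_quotient_of_eventually nA nB
      (pA := fun _ => True) (pB := fun _ => True) (by simp) (by simp) a b ha hb
    refine ⟨Q, iQ, iF, ψ, fun k hk => ?_⟩
    obtain ⟨e1, e2, e3, -⟩ := hψ k _ hk
    rcases hh with ⟨x, hx⟩ | ⟨x, hx⟩ | ⟨m', a', b', hmm, rfl⟩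
    · exact e1 x hx
    · exact e2 x hx
    · obtain rfl := e3 m' a' b' hmm rfl
      exact hm ⟨a', b', rfl⟩

/-- Nonconjugate elements of an amalgam of nice groups are separated by a finite quotient. -/
theorem sep_of_not_isConj (D : Amalg A B G) (nA : Nice A D.u) (nB : Nice B D.w) (g h : G)
    (hc : ¬ IsConj g h) : Sep g h := by
  have red : ∀ {g' h' : G}, IsConj g g' → IsConj h h' → ¬ IsConj g' h' := fun h1 h2 h3 =>
    hc ((h1.trans h3).trans h2.symm)
  have ell : ∀ {x}, ((∃ a, IsConj x (D.iA a)) ∨ ∃ b, IsConj x (D.iB b)) → ∃ x', IsConj x x' ∧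
      ((∃ a, x' = D.iA a) ∨ ∃ b, x' = D.iB b) := by
    rintro x (⟨a, h⟩ | ⟨b, h⟩)
    exacts [⟨_, h, Or.inl ⟨a, rfl⟩⟩, ⟨_, h, Or.inr ⟨b, rfl⟩⟩]
  rcases or_assoc.2 (D.exists_normal_form g) with hg | ⟨m, _, a, b, hg, ha, hb⟩ <;>
    rcases or_assoc.2 (D.exists_normal_form h) with hh | ⟨m', _, a', b', hh, ha', hb'⟩
  · obtain ⟨g', cg, hg⟩ := ell hg
    obtain ⟨h', ch, hh⟩ := ell hh
    exact (D.sep_elliptic nA nB g' h' hg hh (red cg ch)).of_isConj cg ch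
  · obtain ⟨g', cg, hg⟩ := ell hg
    refine (D.sep_hyperbolic nA nB a' b' ha' hb' g' (hg.imp id Or.inl)
      fun h => red cg hh h.symm).symm.of_isConj cg hh
  · obtain ⟨h', ch, hh⟩ := ell hh
    exact (D.sep_hyperbolic nA nB a b ha hb h' (hh.imp id Or.inl) (red hg ch)).of_isConj hg ch
  · rcases le_total m' m with hm | hm
    · exact (D.sep_hyperbolic nA nB a b ha hb _ (Or.inr (Or.inr ⟨m', a', b', hm, rfl⟩))
        (red hg hh)).of_isConj hg hh
    · exact (D.sep_hyperbolic nA nB a' b' ha' hb' _ (Or.inr (Or.inr ⟨m, a, b, hm, rfl⟩))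
        fun h => red hg hh h.symm).symm.of_isConj hg hh

end Amalg

/-- `A` is the free product of the cyclic groups generated by `c i`, of order `e i` (infinite if
`e i = 0`), expressed by its universal property. -/
structure CyclicGens (ι : Type) (e : ι → ℕ) (A : Type) [Group A] where
  c : ι → A
  pow : ∀ i, c i ^ e i = 1
  gen : Subgroup.closure (Set.range c) = ⊤
  lift : ∀ (Q : Type) [Group Q] (f : ι → Q), (∀ i, f i ^ e i = 1) → ∃ φ : A →* Q, ∀ i, φ (c i) = f i

theorem exists_perm_extending {C : Type} (X : Set C) (hX : X.Finite) (τ : Equiv.Perm C) :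
    ∃ σ : Equiv.Perm C, (∀ x ∈ X, τ x ∈ X → σ x = τ x) ∧ ∀ x, σ x ∈ X ↔ x ∈ X := by
  classical
  have : Fintype X := hX.fintype
  obtain ⟨g, hg⟩ := Finset.exists_equiv_extend_of_card_eq (α := X) (t := Finset.univ) (by simp)
    (s := Finset.univ.filter fun x : X => τ x ∈ X)
    (f := fun x => if h : τ x ∈ X then ⟨τ x, h⟩ else x) (by simp) (by
      intro x hx y hy hxy
      simp only [Finset.coe_filter, Finset.mem_univ, true_and, Set.mem_ofPred_eq] at hx hy
      simp only [dif_pos hx, dif_pos hy, Subtype.mk.injEq] at hxy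
      exact Subtype.ext (τ.injective hxy))
  let g' : Equiv.Perm X := g.trans (Equiv.subtypeUnivEquiv fun x => Finset.mem_univ x)
  refine ⟨Equiv.Perm.ofSubtype g', fun x hx hτ => ?_, fun x => ?_⟩
  · rw [Equiv.Perm.ofSubtype_apply_of_mem _ hx]
    have := hg ⟨x, hx⟩ (by simpa using hτ)
    simp only [dif_pos hτ] at this
    exact congrArg Subtype.val this
  · by_cases hx : x ∈ X
    · rw [Equiv.Perm.ofSubtype_apply_of_mem _ hx]
      exact ⟨fun _ => hx, fun _ => Subtype.property _⟩
    · rw [Equiv.Perm.ofSubtype_apply_of_not_mem _ hx]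

section
variable {A : Type} [Group A] (H : Subgroup A)

theorem exists_perm_of_coset_perm (σ : Equiv.Perm (A ⧸ H)) (s : A ⧸ H → A)
    (hs : ∀ x, s x • x = σ x) : ∃ π : Equiv.Perm A, ∀ y : A, π y = s y * y := by
  have h1 : ∀ y : A, ((s y * y : A) : A ⧸ H) = σ y := fun y => hs y
  have h2 : ∀ y : A, (((s (σ⁻¹ y))⁻¹ * y : A) : A ⧸ H) = σ⁻¹ y := fun y => by
    have : ((s (σ⁻¹ y))⁻¹ * y : A) = (s (σ⁻¹ y))⁻¹ • (y : A ⧸ H) := rfl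
    rw [this, inv_smul_eq_iff, hs]; simp
  refine ⟨⟨fun y => s y * y, fun y => (s (σ⁻¹ y))⁻¹ * y, fun y => ?_, fun y => ?_⟩, fun y => rfl⟩
  · simp only [h1]; simp
  · simp only [h2]; simp

theorem exists_perm_of_generator (c : A) (e : ℕ) (he : c ^ e = 1) (X₀ X : Set (A ⧸ H))
    (hX : X.Finite) (hX₀ : X₀ ⊆ X) (hc : e ≠ 0 → ∀ x ∈ X₀, ∀ k : ℤ, c ^ k • x ∈ X) :
    ∃ π : Equiv.Perm A, π ^ e = 1 ∧ (∀ y, ∀ h ∈ H, π (y * h) = π y * h) ∧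
      (∀ y : A, (π y : A ⧸ H) ∈ X ↔ (y : A ⧸ H) ∈ X) ∧
      ∀ y : A, (y : A ⧸ H) ∈ X₀ → ((c * y : A) : A ⧸ H) ∈ X₀ → π y = c * y := by
  classical
  have hcos : ∀ y, ∀ h ∈ H, ((y * h : A) : A ⧸ H) = y := fun y h hh =>
    QuotientGroup.mk_mul_of_mem y hh
  by_cases h0 : e = 0
  · obtain ⟨σ, h1, h2⟩ := exists_perm_extending X hX (MulAction.toPerm c : Equiv.Perm (A ⧸ H))
    have : ∀ x : A ⧸ H, ∃ s : A, s • x = σ x ∧ (x ∈ X → c • x ∈ X → s = c) := by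
      intro x
      by_cases hx : x ∈ X ∧ c • x ∈ X
      · exact ⟨c, (h1 x hx.1 hx.2).symm, fun _ _ => rfl⟩
      · obtain ⟨s, hs⟩ := MulAction.exists_smul_eq A x (σ x)
        exact ⟨s, hs, fun a b => absurd ⟨a, b⟩ hx⟩
    choose s hs hs' using this
    obtain ⟨π, hπ⟩ := exists_perm_of_coset_perm H σ s hs
    refine ⟨π, by rw [h0, pow_zero], fun y h hh => ?_, fun y => ?_, fun y h3 h4 => ?_⟩
    · rw [hπ, hπ, hcos y h hh, mul_assoc]
    · rw [← h2 (y : A ⧸ H), hπ]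
      exact iff_of_eq (congrArg (· ∈ X) (hs y) : (((s y * y : A) : A ⧸ H) ∈ X) = (σ y ∈ X))
    · rw [hπ, hs' _ (hX₀ h3) (hX₀ h4)]
  · let S : Set (A ⧸ H) := {x | ∀ k : ℤ, c ^ k • x ∈ X}
    have hS : ∀ x, c • x ∈ S ↔ x ∈ S := by
      intro x
      simp only [S, Set.mem_ofPred_eq]
      constructor
      · intro h k
        have := h (k - 1)
        rwa [smul_smul, ← zpow_add_one, sub_add_cancel] at this
      · intro h k
        rw [smul_smul, ← zpow_add_one]
        exact h _
    have hSX : ∀ x ∈ S, x ∈ X := fun x hx => by simpa using hx 0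
    have hS' : ∀ y : A, ((c * y : A) : A ⧸ H) ∈ S ↔ (y : A ⧸ H) ∈ S := fun y => hS y
    have hSi : ∀ y : A, ((c⁻¹ * y : A) : A ⧸ H) ∈ S ↔ (y : A ⧸ H) ∈ S := fun y => by
      rw [← hS']; simp
    let π : Equiv.Perm A :=
      { toFun := fun y => if (y : A ⧸ H) ∈ S then c * y else y
        invFun := fun y => if (y : A ⧸ H) ∈ S then c⁻¹ * y else y
        left_inv := fun y => by
          by_cases hy : (y : A ⧸ H) ∈ S
          · simp [hy, hS']
          · simp [hy]
        right_inv := fun y => by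
          by_cases hy : (y : A ⧸ H) ∈ S
          · simp [hy, hSi]
          · simp [hy] }
    have hπ1 : ∀ y : A, (y : A ⧸ H) ∈ S → π y = c * y := fun y hy => if_pos hy
    have hπ0 : ∀ y : A, (y : A ⧸ H) ∉ S → π y = y := fun y hy => if_neg hy
    have hpow : ∀ y : A, (y : A ⧸ H) ∈ S → ∀ n : ℕ, (π ^ n) y = c ^ n * y ∧
        ((c ^ n * y : A) : A ⧸ H) ∈ S := by
      intro y hy n
      induction n with
      | zero => simpa using hy
      | succ n ih =>
        rw [pow_succ', Equiv.Perm.mul_apply, ih.1, hπ1 _ ih.2, pow_succ', mul_assoc]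
        exact ⟨rfl, (hS' _).2 ih.2⟩
    have hpow0 : ∀ y : A, (y : A ⧸ H) ∉ S → ∀ n : ℕ, (π ^ n) y = y := by
      intro y hy n
      induction n with
      | zero => simp
      | succ n ih => rw [pow_succ', Equiv.Perm.mul_apply, ih, hπ0 _ hy]
    refine ⟨π, ?_, fun y h hh => ?_, fun y => ?_, fun y h3 h4 => ?_⟩
    · ext y
      by_cases hy : (y : A ⧸ H) ∈ S
      · rw [(hpow y hy e).1, he]; simp
      · rw [hpow0 y hy e]; simp
    · by_cases hy : (y : A ⧸ H) ∈ S
      · rw [hπ1 _ hy, hπ1 _ (by rwa [hcos y h hh]), mul_assoc]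
      · rw [hπ0 _ hy, hπ0 _ (by rwa [hcos y h hh])]
    · by_cases hy : (y : A ⧸ H) ∈ S
      · rw [hπ1 _ hy]
        exact ⟨fun _ => hSX _ hy, fun _ => hSX _ ((hS' y).2 hy)⟩
      · rw [hπ0 _ hy]
    · exact hπ1 _ fun k => hc h0 _ h3 k

end

variable {ι : Type} {e : ι → ℕ} {A : Type} [Group A]

/-- Finitely generated subgroups of a free product of cyclic groups are virtual retracts, and can
be separated from any element outside. -/
theorem CyclicGens.exists_retraction [Finite ι] (D : CyclicGens ι e A) (H : Subgroup A)
    (hH : H.FG) (z : A) (hz : z ∉ H) :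
    ∃ F : Subgroup A, F.FiniteIndex ∧ z ∉ F ∧ H ≤ F ∧
      ∃ ρ : F →* H, ∀ x : F, (x : A) ∈ H → (ρ x : A) = x := by
  classical
  let Good : Set (A ⧸ H) → (A →* Equiv.Perm A) → Prop := fun X₀ φ =>
    ∀ i (y : A), (y : A ⧸ H) ∈ X₀ → ((D.c i * y : A) : A ⧸ H) ∈ X₀ → φ (D.c i) y = D.c i * y
  have hGood : ∀ {X Y φ}, X ⊆ Y → Good Y φ → Good X φ := fun hXY h i y h1 h2 =>
    h i y (hXY h1) (hXY h2)
  have track : ∀ g : A, ∃ X₀ : Set (A ⧸ H), X₀.Finite ∧ ∀ φ, Good X₀ φ → φ g 1 = g := by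
    intro g
    have hg : g ∈ Subgroup.closure (Set.range D.c) := by rw [D.gen]; trivial
    induction hg using Subgroup.closure_induction_left with
    | one => exact ⟨∅, Set.finite_empty, by simp⟩
    | mul_left x hx y _ ih =>
      obtain ⟨i, rfl⟩ := hx
      obtain ⟨X, hX, h⟩ := ih
      refine ⟨insert (y : A ⧸ H) (insert ((D.c i * y : A) : A ⧸ H) X),
        (hX.insert _).insert _, fun φ hφ => ?_⟩
      rw [map_mul, Equiv.Perm.mul_apply,
        h φ (hGood ((Set.subset_insert _ _).trans (Set.subset_insert _ _)) hφ)]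
      exact hφ i y (by simp) (by simp)
    | inv_mul_cancel x hx y _ ih =>
      obtain ⟨i, rfl⟩ := hx
      obtain ⟨X, hX, h⟩ := ih
      refine ⟨insert (y : A ⧸ H) (insert (((D.c i)⁻¹ * y : A) : A ⧸ H) X),
        (hX.insert _).insert _, fun φ hφ => ?_⟩
      rw [map_mul, Equiv.Perm.mul_apply,
        h φ (hGood ((Set.subset_insert _ _).trans (Set.subset_insert _ _)) hφ), map_inv,
        Equiv.Perm.inv_eq_iff_eq, hφ i _ (by simp) (by simp)]
      simp
  obtain ⟨T, hT⟩ := hH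
  choose X₁ hX₁ htrack using track
  let X₀ : Set (A ⧸ H) := insert ((1 : A) : A ⧸ H) (X₁ z ∪ ⋃ t ∈ T, X₁ t)
  have hX₀ : X₀.Finite :=
    ((hX₁ z).union (T.finite_toSet.biUnion fun t _ => hX₁ t)).insert _
  let X : Set (A ⧸ H) := X₀ ∪ ⋃ i : {i // e i ≠ 0},
    (fun p : ℕ × (A ⧸ H) => D.c i ^ p.1 • p.2) '' (Set.Iio (e i) ×ˢ X₀)
  have hX : X.Finite := hX₀.union (Set.finite_iUnion fun i =>
    ((Set.finite_Iio _).prod hX₀).image _)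
  have hsub : X₀ ⊆ X := Set.subset_union_left
  have hπ := fun i => exists_perm_of_generator H (D.c i) (e i) (D.pow i) X₀ X hX hsub (by
    intro he x hx k
    refine Or.inr (Set.mem_iUnion.2 ⟨⟨i, he⟩, ((k % e i).toNat, x), ⟨?_, hx⟩, ?_⟩)
    · have := Int.emod_lt_of_pos k (show (0 : ℤ) < e i by omega)
      have := Int.emod_nonneg k (show (e i : ℤ) ≠ 0 by omega)
      simp only [Set.mem_Iio]
      omega
    · have h0 := Int.emod_nonneg k (show (e i : ℤ) ≠ 0 by omega)
      change D.c i ^ (k % e i).toNat • x = _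
      rw [← zpow_natCast, Int.toNat_of_nonneg h0]
      conv_rhs => rw [← Int.emod_add_mul_ediv k (e i), zpow_add, zpow_mul, zpow_natCast, D.pow,
        one_zpow, mul_one])
  choose π h1 h2 h3 h4 using hπ
  obtain ⟨φ, hφ⟩ := D.lift _ π h1
  have hgood : Good X₀ φ := fun i y a b => by rw [hφ]; exact h4 i y a b
  have hind : ∀ p : Equiv.Perm A → Prop, p 1 → (∀ i, p (π i)) → (∀ x y, p x → p y → p (x * y)) →
      (∀ x, p x → p x⁻¹) → ∀ g, p (φ g) := by
    intro p p1 pc pm pi g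
    have hg : g ∈ Subgroup.closure (Set.range D.c) := by rw [D.gen]; trivial
    induction hg using Subgroup.closure_induction with
    | mem x hx => obtain ⟨i, rfl⟩ := hx; rw [hφ]; exact pc i
    | one => rwa [map_one]
    | mul x y _ _ a b => rw [map_mul]; exact pm _ _ a b
    | inv x _ a => rw [map_inv]; exact pi _ a
  have hright : ∀ g y, ∀ h ∈ H, φ g (y * h) = φ g y * h := by
    intro g
    refine hind (fun π => ∀ y, ∀ h ∈ H, π (y * h) = π y * h) (by simp) h2 ?_ ?_ g
    · intro p q hp hq y h hh
      rw [Equiv.Perm.mul_apply, Equiv.Perm.mul_apply, hq y h hh, hp _ h hh]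
    · intro p hp y h hh
      rw [Equiv.Perm.inv_eq_iff_eq, hp _ h hh]; simp
  have hpres : ∀ g y, (φ g y : A ⧸ H) ∈ X ↔ (y : A ⧸ H) ∈ X := by
    intro g
    refine hind (fun π => ∀ y : A, (π y : A ⧸ H) ∈ X ↔ (y : A ⧸ H) ∈ X) (by simp) h3 ?_ ?_ g
    · intro p q hp hq y
      rw [Equiv.Perm.mul_apply, hp, hq]
    · intro p hp y
      rw [← hp]; simp
  have hz1 : φ z 1 = z := htrack z φ (hGood (by
    intro x hx; exact Or.inr (Or.inl hx)) hgood)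
  have hT1 : ∀ t ∈ T, φ t 1 = t := fun t ht => htrack t φ (hGood (by
    intro x hx; exact Or.inr (Or.inr (Set.mem_biUnion ht hx))) hgood)
  have hone : ∀ g, ∀ h ∈ H, φ g h = φ g 1 * h := fun g h hh => by
    rw [← hright g 1 h hh, one_mul]
  let F : Subgroup A :=
    { carrier := {g | φ g 1 ∈ H}
      one_mem' := by simp
      mul_mem' := by
        intro a b ha hb
        simp only [Set.mem_ofPred_eq] at *
        rw [map_mul, Equiv.Perm.mul_apply, hone a _ hb]
        exact mul_mem ha hb
      inv_mem' := by
        intro a ha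
        simp only [Set.mem_ofPred_eq] at *
        have := hone a⁻¹ _ ha
        rw [map_inv, ← Equiv.Perm.mul_apply, inv_mul_cancel, Equiv.Perm.one_apply] at this
        rw [map_inv, eq_inv_of_mul_eq_one_left this.symm]
        exact inv_mem ha }
  have hF : ∀ g, g ∈ F ↔ φ g 1 ∈ H := fun g => Iff.rfl
  have hHF : ∀ h ∈ H, φ h 1 = h := by
    intro h hh
    rw [← hT] at hh
    induction hh using Subgroup.closure_induction with
    | mem t ht => exact hT1 t ht
    | one => simp
    | mul x y hx hy ix iy =>
      rw [hT] at hx hy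
      rw [map_mul, Equiv.Perm.mul_apply, iy, hone x y hy, ix]
    | inv x hx ix =>
      rw [hT] at hx
      rw [map_inv, Equiv.Perm.inv_eq_iff_eq, hone x _ (inv_mem hx), ix, mul_inv_cancel]
  refine ⟨F, ?_, ?_, ?_, ?_⟩
  · have : Finite X := hX
    have hfin : Finite (A ⧸ F) := by
      have hx1 : ∀ g, (φ g 1 : A ⧸ H) ∈ X := fun g => (hpres g 1).2 (hsub (Or.inl rfl))
      refine Finite.of_injective (β := X) (fun q => ⟨(φ q.out 1 : A ⧸ H), hx1 _⟩) ?_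
      intro p q hpq
      simp only [Subtype.mk.injEq] at hpq
      rw [QuotientGroup.eq] at hpq
      rw [← QuotientGroup.out_eq' p, ← QuotientGroup.out_eq' q, QuotientGroup.eq, hF, map_mul,
        Equiv.Perm.mul_apply]
      have h5 := hright p.out⁻¹ (φ p.out 1) _ hpq
      rw [mul_inv_cancel_left, map_inv, ← Equiv.Perm.mul_apply _ (φ p.out), inv_mul_cancel, Equiv.Perm.one_apply,
        one_mul] at h5
      rw [map_inv, h5]
      exact hpq
    exact Subgroup.finiteIndex_of_finite_quotient
  · rw [hF, hz1]; exact hz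
  · intro h hh
    rw [hF, hHF h hh]; exact hh
  · refine ⟨MonoidHom.mk' (fun g => ⟨φ g 1, g.2⟩) ?_, fun x hx => hHF x hx⟩
    intro a b
    apply Subtype.ext
    change φ (a * b : A) 1 = φ a 1 * φ b 1
    rw [map_mul, Equiv.Perm.mul_apply, hone a _ b.2]

section

open Monoid

section
variable {ι : Type} {M : ι → Type} [∀ i, Group (M i)] {Q : Type} [Group Q]

theorem toWord_eq_of_prod_eq {i j k l : ι} (w : CoprodI.NeWord M i j) (w' : CoprodI.NeWord M k l)
    (h : w.prod = w'.prod) : w.toWord = w'.toWord := by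
  classical
  exact CoprodI.Word.equiv.symm.injective h

theorem neWord_prod_ne_one {i j : ι} (w : CoprodI.NeWord M i j) : w.prod ≠ 1 := by
  classical
  intro h
  have h3 : w.toWord = CoprodI.Word.empty := CoprodI.Word.equiv.symm.injective h
  exact w.toList_ne_nil (congrArg CoprodI.Word.toList h3)

theorem exists_neWord {g : CoprodI M} (hg : g ≠ 1) :
    ∃ (i j : ι) (w : CoprodI.NeWord M i j), w.prod = g := by
  classical
  have hw : CoprodI.Word.equiv g ≠ CoprodI.Word.empty := by
    intro h
    apply hg
    have := congrArg CoprodI.Word.prod h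
    rw [CoprodI.Word.prod_empty] at this
    rw [← this]
    exact (CoprodI.Word.equiv.left_inv _).symm
  obtain ⟨i, j, w, hw'⟩ := CoprodI.NeWord.of_word _ hw
  refine ⟨i, j, w, ?_⟩
  rw [CoprodI.NeWord.prod, hw']
  exact CoprodI.Word.equiv.left_inv _

theorem isFreeGroup_ker_of_cocycle (T : CoprodI M →* Q) (lam : ∀ i, M i → Q → FreeGroup Q)
    (hmul : ∀ i k k' x, lam i (k * k') x = lam i k (T (CoprodI.of k') * x) * lam i k' x)
    (hne : ∀ i k x, k ≠ 1 → lam i k x ≠ 1) : IsFreeGroup T.ker := by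
  classical
  let Fr := CoprodI (fun _ : ι => FreeGroup Q)
  have hone : ∀ i x, lam i 1 x = 1 := fun i x => by
    have := hmul i 1 1 x
    simpa using this
  let act : ∀ i, M i →* Function.End (Q × Fr) := fun i =>
    { toFun := fun k p => (T (CoprodI.of k) * p.1, CoprodI.of (i := i) (lam i k p.1) * p.2)
      map_one' := by
        funext p
        simp only [map_one, one_mul, hone]
        rfl
      map_mul' := fun k k' => by
        funext p
        change _ = ((_, _) : Q × Fr)
        simp only [map_mul, hmul, mul_assoc] }
  let Φ : CoprodI M →* Function.End (Q × Fr) := CoprodI.lift act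
  have hΦof : ∀ i (k : M i) (p : Q × Fr), Φ (CoprodI.of k) p =
      (T (CoprodI.of k) * p.1, CoprodI.of (i := i) (lam i k p.1) * p.2) := fun i k p => by
    simp only [Φ, CoprodI.lift_of]; rfl
  have hΦmul : ∀ g h (p : Q × Fr), Φ (g * h) p = Φ g (Φ h p) := fun g h p => by
    rw [map_mul]; rfl
  have hΦ : ∀ g (p : Q × Fr), Φ g p = (T g * p.1, (Φ g (p.1, 1)).2 * p.2) := by
    intro g
    induction g using CoprodI.induction_on with
    | one => intro p; simp only [map_one, one_mul]; exact Prod.ext rfl (by simp [Function.End.one_def])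
    | of i m => intro p; simp only [hΦof, mul_one]
    | mul g h ihg ihh =>
      intro p
      rw [hΦmul, hΦmul, ihh p, ihg, ihg (Φ h (p.1, 1)), ihh (p.1, 1)]
      simp [mul_assoc]
  let ρ : T.ker →* Fr :=
    { toFun := fun g => (Φ g (1, 1)).2
      map_one' := by
        simp only [Subgroup.coe_one, map_one]; rfl
      map_mul' := fun g h => by
        have hh : T h = 1 := h.2
        simp only [Subgroup.coe_mul]
        rw [hΦmul, hΦ g, hΦ h]
        simp [hh] }
  have key : ∀ {i j} (w : CoprodI.NeWord M i j) (x : Q),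
      ∃ w' : CoprodI.NeWord (fun _ : ι => FreeGroup Q) i j, (Φ w.prod (x, 1)).2 = w'.prod := by
    intro i j w
    induction w with
    | singleton m hm =>
      intro x
      refine ⟨.singleton (lam _ m x) (hne _ m x hm), ?_⟩
      rw [CoprodI.NeWord.prod_singleton, hΦof, CoprodI.NeWord.prod_singleton, mul_one]
    | append w₁ hn w₂ ih₁ ih₂ =>
      intro x
      obtain ⟨w₂', h₂⟩ := ih₂ x
      obtain ⟨w₁', h₁⟩ := ih₁ (T w₂.prod * x)
      refine ⟨.append w₁' hn w₂', ?_⟩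
      rw [CoprodI.NeWord.append_prod, CoprodI.NeWord.append_prod, hΦmul, hΦ w₁.prod, hΦ w₂.prod]
      simp only
      rw [h₁, h₂, mul_one]
  have hinj : Function.Injective ρ := by
    rw [injective_iff_map_eq_one]
    intro g hg
    by_contra hg1
    obtain ⟨i, j, w, hp⟩ := exists_neWord (fun h => hg1 (Subtype.ext h))
    obtain ⟨w', h'⟩ := key w 1
    rw [hp] at h'
    exact neWord_prod_ne_one w' (by rw [← h']; exact hg)
  have : IsFreeGroup ρ.range := subgroupIsFreeOfIsFree ρ.range
  exact IsFreeGroup.ofMulEquiv (MonoidHom.ofInjective hinj).symm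

theorem isFreeGroup_ker (T : CoprodI M →* Q) (hT : ∀ i, (∀ m : M i, T (CoprodI.of m) = 1 → m = 1) ∨
      ((∀ m : M i, T (CoprodI.of m) = 1) ∧ ∃ f : M i →* Multiplicative ℤ, Function.Injective f)) :
    IsFreeGroup T.ker := by
  have : ∀ i, ∃ l : M i → Q → FreeGroup Q,
      (∀ k k' x, l (k * k') x = l k (T (CoprodI.of k') * x) * l k' x) ∧
      ∀ k x, k ≠ 1 → l k x ≠ 1 := by
    intro i
    rcases hT i with h | ⟨h, f, hf⟩
    · refine ⟨fun k x => FreeGroup.of (T (CoprodI.of k) * x) * (FreeGroup.of x)⁻¹, ?_, ?_⟩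
      · intro k k' x; simp [mul_assoc]
      · intro k x hk h1
        rw [mul_inv_eq_one] at h1
        have := FreeGroup.of_injective h1
        exact hk (h k (by simpa using this))
    · refine ⟨fun k x => FreeGroup.of x ^ (Multiplicative.toAdd (f k)), ?_, ?_⟩
      · intro k k' x; simp [h, zpow_add]
      · intro k x hk h1
        have h2 : (Multiplicative.toAdd (f k)) = 0 := by
          by_contra h3
          exact FreeGroup.of_ne_one x ((IsMulTorsionFree.zpow_eq_one_iff_left h3).1 h1)
        exact hk (hf (by rw [map_one]; exact h2))
  choose l h1 h2 using this
  exact isFreeGroup_ker_of_cocycle T l h1 h2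

theorem neWord_head_split {i j : ι} (w : CoprodI.NeWord M i j) :
    (i = j ∧ w.prod = CoprodI.of w.head) ∨
      ∃ (a : ι) (w' : CoprodI.NeWord M a j), a ≠ i ∧ w.prod = CoprodI.of w.head * w'.prod ∧
        w'.toList.length + 1 = w.toList.length := by
  induction w with
  | singleton m hm => exact .inl ⟨rfl, by simp⟩
  | append w₁ hn w₂ ih₁ ih₂ =>
    right
    rcases ih₁ with ⟨rfl, h⟩ | ⟨a, w', ha, h, hl⟩
    · refine ⟨_, w₂, hn.symm, by simp [h], ?_⟩
      have : w₁.toList.length = 1 := by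
        have := toWord_eq_of_prod_eq w₁ (.singleton w₁.head (by
          intro h1
          rw [h1, map_one] at h
          exact neWord_prod_ne_one _ h)) (by simp [h])
        have := congrArg (fun w => w.toList.length) this
        exact this
      simp [CoprodI.NeWord.toList, this, add_comm]
    · refine ⟨a, .append w' hn w₂, ha, by simp [h, mul_assoc], ?_⟩
      simp only [CoprodI.NeWord.toList, List.length_append]
      omega

theorem neWord_not_isOfFinOrder {i j : ι} (w : CoprodI.NeWord M i j) (hij : i ≠ j) :
    ¬ IsOfFinOrder w.prod := by
  have : ∀ n : ℕ, ∃ w' : CoprodI.NeWord M i j, w'.prod = w.prod ^ (n + 1) := by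
    intro n
    induction n with
    | zero => exact ⟨w, by simp⟩
    | succ n ih =>
      obtain ⟨w', h⟩ := ih
      exact ⟨.append w' hij.symm w, by rw [CoprodI.NeWord.append_prod, h, pow_succ _ (n + 1)]⟩
  rw [isOfFinOrder_iff_pow_eq_one]
  rintro ⟨n, hn, h⟩
  obtain ⟨w', h'⟩ := this (n - 1)
  rw [Nat.sub_add_cancel hn, h] at h'
  exact neWord_prod_ne_one _ h'

theorem exists_conj_of_isOfFinOrder {g : CoprodI M} (hg : IsOfFinOrder g) (hg1 : g ≠ 1) :
    ∃ (i : ι) (m : M i) (v : CoprodI M), g = v * CoprodI.of m * v⁻¹ := by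
  have key : ∀ n : ℕ, ∀ (i j : ι) (w : CoprodI.NeWord M i j), w.toList.length = n →
      IsOfFinOrder w.prod → ∃ (i : ι) (m : M i) (v : CoprodI M),
        w.prod = v * CoprodI.of m * v⁻¹ := by
    intro n
    induction n using Nat.strong_induction_on with
    | _ n ih =>
      intro i j w hl hw
      by_cases hij : i = j
      swap
      · exact absurd hw (neWord_not_isOfFinOrder w hij)
      rcases neWord_head_split w with ⟨-, h⟩ | ⟨a, w', ha, h, hl'⟩
      · exact ⟨i, w.head, 1, by simp [h]⟩
      subst hij
      have hcj : (CoprodI.of (w.head)⁻¹ * w'.inv.prod) =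
          (CoprodI.of w.head)⁻¹ * w.prod⁻¹ * ((CoprodI.of w.head)⁻¹)⁻¹ := by
        rw [h, CoprodI.NeWord.inv_prod, map_inv]; group
      have hfin : IsOfFinOrder (CoprodI.of (w.head)⁻¹ * w'.inv.prod) := by
        rw [hcj]
        exact (MulAut.conj (CoprodI.of w.head)⁻¹).toMonoidHom.isOfFinOrder hw.inv
      by_cases hx : (w.head)⁻¹ * w'.inv.head = 1
      · rcases neWord_head_split w'.inv with ⟨h1, -⟩ | ⟨b, w'', hb, h2, hl2⟩
        · exact absurd h1.symm ha
        rw [h2, ← mul_assoc, ← map_mul, hx, map_one, one_mul] at hfin hcj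
        have hl3 : w'.inv.toList.length = w'.toList.length := by
          clear * -
          induction w' with
          | singleton m hm => simp [CoprodI.NeWord.toList, CoprodI.NeWord.inv]
          | append w₁ hn w₂ ih₁ ih₂ =>
            simp [CoprodI.NeWord.toList, CoprodI.NeWord.inv, ih₁, ih₂, add_comm]
        obtain ⟨i', m, v, h4⟩ := ih w''.toList.length (by omega) _ _ w'' rfl hfin
        refine ⟨i', m⁻¹, CoprodI.of w.head * v, ?_⟩
        have h5 : w.prod = (CoprodI.of w.head * w''.prod * (CoprodI.of w.head)⁻¹)⁻¹ := by
          rw [hcj]; group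
        rw [h5, h4, map_inv]; group
      · have h3 := CoprodI.NeWord.mulHead_prod w'.inv (w.head)⁻¹ hx
        rw [← h3] at hfin
        exact absurd hfin (neWord_not_isOfFinOrder _ ha.symm)
  obtain ⟨i, j, w, rfl⟩ := exists_neWord hg1
  exact key _ i j w rfl hg

theorem neWord_conj_ne {a b i : ι} (w : CoprodI.NeWord M a b) (hb : b ≠ i) (m m' : M i)
    (hm : m ≠ 1) : w.prod * CoprodI.of m * w.prod⁻¹ ≠ CoprodI.of m' := by
  intro h
  have hm' : m' ≠ 1 := by
    rintro rfl
    rw [map_one, conj_eq_one_iff] at h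
    exact hm (CoprodI.of_injective i (by rw [h, map_one]))
  have := toWord_eq_of_prod_eq (.append (.append w hb (.singleton m hm)) hb.symm w.inv)
    (.singleton m' hm') (by simpa using h)
  have := congrArg (fun w => w.toList.length) this
  simp only [CoprodI.NeWord.toWord, CoprodI.NeWord.toList, List.length_append,
    List.length_singleton] at this
  have h1 := List.length_pos_iff.2 w.toList_ne_nil
  omega

theorem mem_range_of_commute {i : ι} {m : M i} (hm : m ≠ 1) {d : CoprodI M}
    (hd : d * CoprodI.of m = CoprodI.of m * d) : ∃ x : M i, d = CoprodI.of x := by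
  by_cases h1 : d = 1
  · exact ⟨1, by simp [h1]⟩
  obtain ⟨a, b, w, hw⟩ := exists_neWord (inv_ne_one.2 h1)
  have hd' : d = w.inv.prod := by rw [CoprodI.NeWord.inv_prod, hw, inv_inv]
  have hc : d * CoprodI.of m * d⁻¹ = CoprodI.of m := by rw [hd]; group
  by_cases ha : a = i
  · subst ha
    rcases neWord_head_split w with ⟨-, h⟩ | ⟨a', w', ha', h, -⟩
    · exact ⟨w.head⁻¹, by rw [map_inv, ← h, hw, inv_inv]⟩
    exfalso
    refine neWord_conj_ne w'.inv ha' (w.head⁻¹ * m * w.head) m ?_ ?_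
    · intro h'
      apply hm
      have : m = w.head * (w.head⁻¹ * m * w.head) * w.head⁻¹ := by group
      rw [this, h']; group
    · rw [← hc, ← inv_inv d, ← hw, h]
      simp only [CoprodI.NeWord.inv_prod, map_mul, map_inv]
      group
  · exact absurd (by rw [← hd', hc]) (neWord_conj_ne w.inv ha m m hm)
end

end

section

open Monoid

theorem zmod_cyclic_hom {A : Type} [Group A] (n : ℕ) (c : A) (hc : c ^ n = 1) :
    ∃ f : Multiplicative (ZMod n) →* A, f (Multiplicative.ofAdd 1) = c := by
  have h : zmultiplesHom (Additive A) (Additive.ofMul c) (n : ℤ) = 0 := by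
    simp only [zmultiplesHom_apply]
    rw [natCast_zsmul, ← ofMul_pow, hc]; rfl
  refine ⟨AddMonoidHom.toMultiplicativeLeft (ZMod.lift n ⟨_, h⟩), ?_⟩
  have := ZMod.lift_coe n ⟨zmultiplesHom (Additive A) (Additive.ofMul c), h⟩ 1
  simp only [Int.cast_one] at this
  simp [this]

theorem zmod_cases (e : ℕ) : ∃ n : ℕ, n ≠ 0 ∧ ∃ t : Multiplicative (ZMod e) →* Multiplicative (ZMod n),
    (Function.Injective t ∨ ((∀ m, t m = 1) ∧
      ∃ f : Multiplicative (ZMod e) →* Multiplicative ℤ, Function.Injective f)) := by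
  cases e with
  | zero => exact ⟨1, one_ne_zero, 1, .inr ⟨fun _ => rfl, MonoidHom.id (Multiplicative ℤ), fun _ _ h => h⟩⟩
  | succ e => exact ⟨e + 1, by simp, MonoidHom.id _, .inl fun _ _ h => h⟩

theorem ofAdd_one_generates (n : ℕ) {B : Type} [Group B] (f g : Multiplicative (ZMod n) →* B)
    (h : f (Multiplicative.ofAdd 1) = g (Multiplicative.ofAdd 1)) : f = g := by
  refine MonoidHom.ext fun x => ?_
  have hx : x = (Multiplicative.ofAdd (1 : ZMod n)) ^ ((show ZMod n from Multiplicative.toAdd x).cast : ℤ) := by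
    rw [← ofAdd_zsmul, zsmul_one, ZMod.intCast_cast, ZMod.cast_id]; rfl
  rw [hx, map_zpow, map_zpow, h]

theorem CyclicGens.exists_mulEquiv {ι : Type} {e : ι → ℕ} {A : Type} [Group A]
    (D : CyclicGens ι e A) : Nonempty (A ≃* CoprodI fun i => Multiplicative (ZMod (e i))) := by
  obtain ⟨φ, hφ⟩ := D.lift (CoprodI fun i => Multiplicative (ZMod (e i)))
    (fun i => CoprodI.of (Multiplicative.ofAdd 1)) (fun i => by
      rw [← map_pow, ← ofAdd_nsmul, nsmul_one, ZMod.natCast_self, ofAdd_zero, map_one])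
  choose f hf using fun i => zmod_cyclic_hom (e i) (D.c i) (D.pow i)
  refine ⟨MonoidHom.toMulEquiv φ (CoprodI.lift f) ?_ ?_⟩
  · refine MonoidHom.eq_of_eqOn_dense D.gen ?_
    rintro _ ⟨i, rfl⟩
    simp only [MonoidHom.comp_apply, hφ, CoprodI.lift_of, hf, MonoidHom.id_apply]
  · refine CoprodI.ext_hom _ _ fun i => ofAdd_one_generates _ _ _ ?_
    simp only [MonoidHom.comp_apply, hφ, CoprodI.lift_of, hf, MonoidHom.id_apply]

section
variable {ι : Type} {M : ι → Type} [∀ i, CommGroup (M i)]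

theorem coprodI_structure [Finite ι]
    (hM : ∀ i, ∃ n : ℕ, n ≠ 0 ∧ ∃ t : M i →* Multiplicative (ZMod n), (Function.Injective t ∨
      ((∀ m, t m = 1) ∧ ∃ f : M i →* Multiplicative ℤ, Function.Injective f))) :
    ∃ (Q : Type) (_ : CommGroup Q) (_ : Finite Q) (T : CoprodI M →* Q), IsFreeGroup T.ker ∧
      (∀ a a', IsOfFinOrder a → IsOfFinOrder a' → T a = T a' → IsConj a a') ∧
      ∀ a d : CoprodI M, IsOfFinOrder a → a ≠ 1 → ¬ IsOfFinOrder d → a * d ≠ d * a := by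
  classical
  choose n hn t ht using hM
  have : ∀ i, NeZero (n i) := fun i => ⟨hn i⟩
  let Q := ∀ i, Multiplicative (ZMod (n i))
  let T : CoprodI M →* Q := CoprodI.lift fun i => (MonoidHom.mulSingle _ i).comp (t i)
  have hT : ∀ i (m : M i), T (CoprodI.of m) = Pi.mulSingle i (t i m) := fun i m => by simp [T]
  have hfin : ∀ i, Finite (Multiplicative (ZMod (n i))) := fun i =>
    inferInstanceAs (Finite (ZMod (n i)))
  have htor : ∀ i (m : M i), IsOfFinOrder m → m ≠ 1 → Function.Injective (t i) := by
    intro i m hm h1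
    rcases ht i with h | ⟨-, f, hf⟩
    · exact h
    · exfalso
      have h2 := f.isOfFinOrder hm
      rw [isOfFinOrder_iff_pow_eq_one] at h2
      obtain ⟨k, hk, h3⟩ := h2
      have h4 : (k : ℕ) • Multiplicative.toAdd (f m) = 0 := h3
      have h5 : Multiplicative.toAdd (f m) = 0 := by
        rcases smul_eq_zero.1 h4 with h | h
        · omega
        · exact h
      exact h1 (hf (by rw [map_one]; exact h5))
  have hofs : ∀ i (m : M i) v, IsOfFinOrder (v * CoprodI.of m * v⁻¹ : CoprodI M) →
      IsOfFinOrder m := by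
    intro i m v h
    have h1 : IsOfFinOrder (CoprodI.of m : CoprodI M) := by
      have := (MulAut.conj v⁻¹).toMonoidHom.isOfFinOrder h
      simpa [mul_assoc] using this
    exact (Function.Injective.isOfFinOrder_iff (CoprodI.of_injective i)).1 h1
  refine ⟨Q, inferInstance, inferInstance, T, isFreeGroup_ker T fun i => ?_, ?_, ?_⟩
  · rcases ht i with h | ⟨h, h'⟩
    · left
      intro m hm
      rw [hT, Pi.mulSingle_eq_one_iff] at hm
      exact h (by rw [hm, map_one])
    · exact .inr ⟨fun m => by rw [hT, h, Pi.mulSingle_one], h'⟩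
  · intro a a' ha ha' hTT
    have hone : ∀ a, IsOfFinOrder a → T a = 1 → a = 1 := by
      intro a ha hT1
      by_contra h1
      obtain ⟨i, m, v, rfl⟩ := exists_conj_of_isOfFinOrder ha h1
      have hm : m ≠ 1 := by rintro rfl; simp at h1
      rw [map_mul, map_mul, map_inv, mul_inv_eq_one, mul_eq_left, hT,
        Pi.mulSingle_eq_one_iff] at hT1
      exact hm (htor i m (hofs i m v ha) hm (by rw [hT1, map_one]))
    by_cases h1 : a = 1
    · rw [h1, map_one] at hTT
      rw [h1, hone a' ha' hTT.symm]
    by_cases h1' : a' = 1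
    · rw [h1', map_one] at hTT
      exact absurd (hone a ha hTT) h1
    obtain ⟨i, m, v, rfl⟩ := exists_conj_of_isOfFinOrder ha h1
    obtain ⟨i', m', v', rfl⟩ := exists_conj_of_isOfFinOrder ha' h1'
    have hm : m ≠ 1 := by rintro rfl; simp at h1
    have hinj := htor i m (hofs i m v ha) hm
    have hT2 : T (CoprodI.of m) = T (CoprodI.of m') := by
      simpa only [map_mul, map_inv, mul_comm (T v), mul_comm (T v'), mul_inv_cancel_right] using hTT
    rw [hT, hT] at hT2
    by_cases hii : i = i'
    · subst hii
      have := Pi.mulSingle_injective _ hT2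
      have := hinj this
      subst this
      rw [isConj_iff]
      exact ⟨v' * v⁻¹, by group⟩
    · exfalso
      have h3 := congrFun hT2 i
      rw [Pi.mulSingle_eq_same, Pi.mulSingle_eq_of_ne hii] at h3
      exact hm (hinj (by rw [h3, map_one]))
  · intro a d ha h1 hd hcomm
    obtain ⟨i, m, v, rfl⟩ := exists_conj_of_isOfFinOrder ha h1
    have hm : m ≠ 1 := by rintro rfl; simp at h1
    have hinj := htor i m (hofs i m v ha) hm
    obtain ⟨x, hx⟩ := mem_range_of_commute (i := i) (m := m) hm (d := v⁻¹ * d * v) (by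
      have h2 : v⁻¹ * d * v * CoprodI.of m = v⁻¹ * (d * (v * CoprodI.of m * v⁻¹)) * v := by group
      rw [h2, ← hcomm]; group)
    apply hd
    have hxf : IsOfFinOrder x := (Function.Injective.isOfFinOrder_iff hinj).1
      (isOfFinOrder_of_finite _)
    have := (MulAut.conj v).toMonoidHom.isOfFinOrder
      ((CoprodI.of (M := M) (i := i)).isOfFinOrder hxf)
    rw [← hx] at this
    simpa [mul_assoc] using this
end

/-- The structural facts about free products of cyclic groups: a finite-index free normal subgroup
whose quotient separates conjugacy classes of torsion elements, and torsion elements do not commute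
with elements of infinite order. -/
theorem CyclicGens.exists_free_kernel {ι : Type} [Finite ι] {e : ι → ℕ} {A : Type} [Group A]
    (D : CyclicGens ι e A) : ∃ (Q : Type) (_ : CommGroup Q) (_ : Finite Q) (T : A →* Q),
      IsFreeGroup T.ker ∧
      (∀ a a', IsOfFinOrder a → IsOfFinOrder a' → T a = T a' → IsConj a a') ∧
      ∀ a d : A, IsOfFinOrder a → a ≠ 1 → ¬ IsOfFinOrder d → a * d ≠ d * a := by
  obtain ⟨E⟩ := D.exists_mulEquiv
  obtain ⟨Q, i1, i2, T, h1, h2, h3⟩ := coprodI_structure fun i => zmod_cases (e i)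
  have hof : ∀ a, IsOfFinOrder (E a) ↔ IsOfFinOrder a := fun a =>
    Function.Injective.isOfFinOrder_iff (f := E.toMonoidHom) E.injective
  refine ⟨Q, i1, i2, T.comp E.toMonoidHom, ?_, fun a a' ha ha' h => ?_, fun a d ha h1 hd h => ?_⟩
  · have hm : ∀ x : (T.comp E.toMonoidHom).ker, E x ∈ T.ker := fun x => x.2
    let F : (T.comp E.toMonoidHom).ker →* T.ker :=
      (E.toMonoidHom.comp (T.comp E.toMonoidHom).ker.subtype).codRestrict T.ker hm
    have hF : Function.Bijective F := by
      constructor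
      · intro x y hxy
        exact Subtype.ext (E.injective (congrArg Subtype.val hxy))
      · rintro ⟨y, hy⟩
        exact ⟨⟨E.symm y, by simpa [MonoidHom.mem_ker] using hy⟩, Subtype.ext (E.apply_symm_apply y)⟩
    exact IsFreeGroup.ofMulEquiv (MulEquiv.ofBijective F hF).symm
  · have := E.symm.toMonoidHom.map_isConj (h2 (E a) (E a') ((hof a).2 ha) ((hof a').2 ha') h)
    simpa using this
  · exact h3 (E a) (E d) ((hof a).2 ha) (by simpa using h1) (by rwa [hof]) (by
      rw [← map_mul, ← map_mul, h])

end

/-- The properties of finitely generated free products of cyclic groups that are used to establish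
conjugacy separability of their cyclic amalgams. -/
structure VirtFree (A : Type) [Group A] : Prop where
  retraction : ∀ (H : Subgroup A), H.FG → ∀ z ∉ H, ∃ F : Subgroup A, F.FiniteIndex ∧ z ∉ F ∧ H ≤ F ∧
    ∃ ρ : F →* H, ∀ x : F, (x : A) ∈ H → (ρ x : A) = x
  kernel : ∃ (Q : Type) (_ : CommGroup Q) (_ : Finite Q) (T : A →* Q),
      IsFreeGroup T.ker ∧
      (∀ a a', IsOfFinOrder a → IsOfFinOrder a' → T a = T a' → IsConj a a') ∧
      ∀ a d : A, IsOfFinOrder a → a ≠ 1 → ¬ IsOfFinOrder d → a * d ≠ d * a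

theorem CyclicGens.virtFree {ι : Type} [Finite ι] {e : ι → ℕ} {A : Type} [Group A]
    (D : CyclicGens ι e A) : VirtFree A :=
  ⟨fun H hH z hz => D.exists_retraction H hH z hz, D.exists_free_kernel⟩

section
variable {H : Type} [Group H] [IsFreeGroup H]

theorem isMulTorsionFree_of_isFreeGroup : IsMulTorsionFree H where
  pow_left_injective n hn x y hxy := by
    apply (IsFreeGroup.toFreeGroup H).injective
    apply IsMulTorsionFree.pow_left_injective hn
    simp only at hxy ⊢
    rw [← map_pow, ← map_pow, hxy]

theorem isCyclic_or_nontrivial_generators :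
    IsCyclic H ∨ Nontrivial (IsFreeGroup.Generators H) := by
  rcases subsingleton_or_nontrivial (IsFreeGroup.Generators H) with h | h
  · left
    have h1 : IsCyclic (FreeGroup (IsFreeGroup.Generators H)) := by
      rcases isEmpty_or_nonempty (IsFreeGroup.Generators H) with h2 | ⟨⟨x⟩⟩
      · infer_instance
      · have : Unique (IsFreeGroup.Generators H) := ⟨⟨x⟩, fun y => Subsingleton.elim _ _⟩
        infer_instance
    exact isCyclic_of_surjective (IsFreeGroup.toFreeGroup H).symm
      (IsFreeGroup.toFreeGroup H).symm.surjective
  · exact .inr h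

theorem isCyclic_of_commute (h : ∀ a b : H, a * b = b * a) : IsCyclic H := by
  classical
  rcases isCyclic_or_nontrivial_generators (H := H) with h1 | ⟨x, y, hxy⟩
  · exact h1
  · exfalso
    have h2 := congrArg (IsFreeGroup.toFreeGroup H)
      (h ((IsFreeGroup.toFreeGroup H).symm (FreeGroup.of x))
        ((IsFreeGroup.toFreeGroup H).symm (FreeGroup.of y)))
    simp only [map_mul, MulEquiv.apply_symm_apply] at h2
    have h3 := congrArg FreeGroup.toWord h2
    simp [FreeGroup.toWord_mul, FreeGroup.toWord_of, FreeGroup.reduce.cons, hxy] at h3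

theorem exists_independent_homs (a b : H) (hgen : Subgroup.closure {a, b} = ⊤)
    (hab : a * b ≠ b * a) : ∃ π₁ π₂ : H →* Multiplicative ℤ,
      Multiplicative.toAdd (π₁ a) * Multiplicative.toAdd (π₂ b) -
        Multiplicative.toAdd (π₁ b) * Multiplicative.toAdd (π₂ a) ≠ 0 := by
  classical
  rcases isCyclic_or_nontrivial_generators (H := H) with h1 | ⟨x, y, hxy⟩
  · have := IsCyclic.isMulCommutative (α := H)
    exact absurd (mul_comm' a b) hab
  let π : IsFreeGroup.Generators H → H →* Multiplicative ℤ := fun x =>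
    IsFreeGroup.lift fun z => if z = x then Multiplicative.ofAdd 1 else 1
  have hπ : ∀ x z, Multiplicative.toAdd (π x (IsFreeGroup.of z)) = if z = x then 1 else 0 := by
    intro x z
    simp only [π, IsFreeGroup.lift_of]
    split_ifs <;> rfl
  refine ⟨π x, π y, fun hdet => ?_⟩
  have key : ∀ g : H, ∃ p q : ℤ, ∀ z, Multiplicative.toAdd (π z g) =
      p * Multiplicative.toAdd (π z a) + q * Multiplicative.toAdd (π z b) := by
    intro g
    have hg : g ∈ Subgroup.closure {a, b} := hgen ▸ Subgroup.mem_top g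
    induction hg using Subgroup.closure_induction with
    | mem g hg =>
      rcases hg with rfl | rfl
      · exact ⟨1, 0, fun z => by ring⟩
      · exact ⟨0, 1, fun z => by ring⟩
    | one => exact ⟨0, 0, fun z => by simp⟩
    | mul g h _ _ ihg ihh =>
      obtain ⟨p, q, h1⟩ := ihg
      obtain ⟨p', q', h2⟩ := ihh
      exact ⟨p + p', q + q', fun z => by rw [map_mul, toAdd_mul, h1, h2]; ring⟩
    | inv g _ ih =>
      obtain ⟨p, q, h1⟩ := ih
      exact ⟨-p, -q, fun z => by rw [map_inv, toAdd_inv, h1]; ring⟩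
  obtain ⟨p, q, h1⟩ := key (IsFreeGroup.of x)
  obtain ⟨p', q', h2⟩ := key (IsFreeGroup.of y)
  have e1 := h1 x
  have e2 := h1 y
  have e3 := h2 x
  have e4 := h2 y
  rw [hπ] at e1 e2 e3 e4
  simp only [if_true, if_neg hxy, if_neg (Ne.symm hxy)] at e1 e2 e3 e4
  have : (1 : ℤ) = 0 := by
    calc (1 : ℤ) = 1 * 1 - 0 * 0 := by ring
      _ = (p * q' - q * p') * (Multiplicative.toAdd ((π x) a) * Multiplicative.toAdd ((π y) b) -
        Multiplicative.toAdd ((π x) b) * Multiplicative.toAdd ((π y) a)) := by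
          nth_rewrite 1 [e1]
          rw [e4]
          have : (0 : ℤ) * 0 = (p' * Multiplicative.toAdd ((π x) a) + q' * Multiplicative.toAdd ((π x) b)) * (p * Multiplicative.toAdd ((π y) a) + q * Multiplicative.toAdd ((π y) b)) := by
            rw [← e2, ← e3]
          rw [this]
          ring
      _ = 0 := by rw [hdet, mul_zero]
  omega
end

section
variable {A : Type} [Group A] (K : Subgroup A) [IsFreeGroup K]

theorem eq_of_zpow_eq {x y : A} (hx : x ∈ K) (hy : y ∈ K) {m : ℤ} (hm : m ≠ 0)
    (h : x ^ m = y ^ m) : x = y := by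
  have := isMulTorsionFree_of_isFreeGroup (H := K)
  have h1 : (⟨x, hx⟩ : K) ^ m = ⟨y, hy⟩ ^ m := Subtype.ext (by simpa using h)
  exact congrArg Subtype.val (zpow_left_injective hm h1)

theorem isFreeGroup_of_le {H : Subgroup A} (hH : H ≤ K) : IsFreeGroup H :=
  IsFreeGroup.ofMulEquiv (Subgroup.subgroupOfEquivOfLe hH)

theorem exists_root_of_commute {x y : A} (hx : x ∈ K) (hy : y ∈ K) (h : x * y = y * x) :
    ∃ s ∈ K, ∃ m n : ℤ, x = s ^ m ∧ y = s ^ n := by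
  have hle : Subgroup.closure {x, y} ≤ K := by
    rw [Subgroup.closure_le]
    rintro _ (rfl | rfl) <;> assumption
  have := isFreeGroup_of_le K hle
  have hcomm : ∀ a b : Subgroup.closure {x, y}, a * b = b * a := by
    have := Subgroup.isMulCommutative_closure (k := {x, y}) (by
      rintro _ (rfl | rfl) _ (rfl | rfl) <;> simp [h])
    exact fun a b => mul_comm' a b
  obtain ⟨s, hs⟩ := isCyclic_of_commute hcomm
  have hx' : x ∈ Subgroup.closure {x, y} := Subgroup.subset_closure (by simp)
  have hy' : y ∈ Subgroup.closure {x, y} := Subgroup.subset_closure (by simp)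
  obtain ⟨m, hm⟩ := hs ⟨x, hx'⟩
  obtain ⟨n, hn⟩ := hs ⟨y, hy'⟩
  refine ⟨s, hle s.2, m, n, ?_, ?_⟩
  · simpa using (congrArg Subtype.val hm).symm
  · simpa using (congrArg Subtype.val hn).symm
end

/-- Roots of elements of infinite order are unique. -/
theorem VirtFree.eq_of_pow_eq {A : Type} [Group A] (hA : VirtFree A) {b c : A} {g : ℕ} (hg : 0 < g)
    (h : b ^ g = c ^ g) (hb : ¬ IsOfFinOrder b) : b = c := by
  obtain ⟨Q, _, _, T, hfree, -, hcomm⟩ := hA.kernel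
  set z := b ^ g with hz
  have hzinf : ¬ IsOfFinOrder z := by
    rw [hz]
    intro h1
    exact hb ((isOfFinOrder_pow.1 h1).resolve_right hg.ne')
  let Z := Subgroup.centralizer {z}
  have hZ : ∀ x, x ∈ Z ↔ z * x = x * z := fun x => by
    simp only [Z, Subgroup.mem_centralizer_singleton_iff]
    exact eq_comm
  have htf : ∀ x ∈ Z, IsOfFinOrder x → x = 1 := by
    intro x hx hfin
    by_contra h1
    exact hcomm x z hfin h1 hzinf ((hZ x).1 hx).symm
  let k := Nat.card Q
  have hk : k ≠ 0 := Nat.card_pos.ne'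
  have hker : ∀ x, x ^ k ∈ T.ker := fun x => by
    rw [MonoidHom.mem_ker, map_pow, pow_card_eq_one']
  have hcen : ∀ y ∈ Z, y ∈ T.ker → ∀ x ∈ Z, x * y = y * x := by
    intro y hy hyk x hx
    have h0 : y * z ^ k = z ^ k * y := (Commute.pow_left ((hZ y).1 hy : Commute z y) k).symm
    obtain ⟨s, -, m, n, h1, h2⟩ := exists_root_of_commute T.ker hyk (hker z) h0
    have hn : n ≠ 0 := by
      rintro rfl
      rw [zpow_zero] at h2
      exact hzinf (isOfFinOrder_iff_pow_eq_one.2 ⟨k, Nat.pos_of_ne_zero hk, h2⟩)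
    have h3 : y ^ n = (z ^ k) ^ m := by
      rw [h1, h2, ← zpow_mul, ← zpow_mul, mul_comm]
    have h4 : x * z = z * x := ((hZ x).1 hx).symm
    have h5 : (x * y * x⁻¹) ^ n = y ^ n := by
      rw [conj_zpow, h3]
      have : Commute x ((z ^ k) ^ m) := (Commute.pow_right h4 k).zpow_right m
      rw [this.eq, mul_inv_cancel_right]
    have h6 := eq_of_zpow_eq T.ker (T.normal_ker.conj_mem y hyk x) hyk hn h5
    rw [mul_inv_eq_iff_eq_mul] at h6
    exact h6
  have hfi : (Subgroup.center Z).FiniteIndex := by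
    have h1 : (T.ker.subgroupOf Z) ≤ Subgroup.center Z := by
      intro y hy
      rw [Subgroup.mem_center_iff]
      intro x
      exact Subtype.ext (hcen y y.2 hy x x.2)
    exact Subgroup.finiteIndex_of_le h1
  have hab : ∀ x y : Z, x * y = y * x := by
    intro x y
    have h1 : (x * y * x⁻¹ * y⁻¹) ^ (Subgroup.center Z).index = 1 := by
      have h2 : MonoidHom.transferCenterPow Z (x * y * x⁻¹ * y⁻¹) = 1 := by
        simp only [map_mul, map_inv]
        rw [mul_comm' (MonoidHom.transferCenterPow Z x)]; group
      have h3 := congrArg Subtype.val h2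
      rwa [MonoidHom.transferCenterPow_apply] at h3
    have h2 : IsOfFinOrder ((x * y * x⁻¹ * y⁻¹ : Z) : A) := by
      rw [isOfFinOrder_iff_pow_eq_one]
      refine ⟨_, Nat.pos_of_ne_zero (Subgroup.FiniteIndex.index_ne_zero (H := Subgroup.center Z)), ?_⟩
      rw [← Subgroup.coe_pow, h1]; rfl
    have h3 := htf _ (x * y * x⁻¹ * y⁻¹).2 h2
    have h4 : x * y * x⁻¹ * y⁻¹ = 1 := Subtype.ext h3
    rw [mul_inv_eq_one, mul_inv_eq_iff_eq_mul] at h4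
    exact h4
  have hbZ : b ∈ Z := (hZ b).2 (by rw [hz, ← pow_succ, ← pow_succ'])
  have hcZ : c ∈ Z := (hZ c).2 (by rw [h, ← pow_succ, ← pow_succ'])
  have hcm : Commute b c⁻¹ := by
    have : Commute b c := congrArg Subtype.val (hab ⟨b, hbZ⟩ ⟨c, hcZ⟩)
    exact this.inv_right
  have h1 : IsOfFinOrder (b * c⁻¹) := by
    rw [isOfFinOrder_iff_pow_eq_one]
    exact ⟨g, hg, by rw [hcm.mul_pow, inv_pow, ← h, mul_inv_cancel]⟩
  have := htf _ (Z.mul_mem hbZ (Z.inv_mem hcZ)) h1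
  rwa [mul_inv_eq_one] at this

section
variable {A : Type} [Group A]

theorem VirtFree.exists_retraction (hA : VirtFree A) (H : Subgroup A) (hH : H.FG) :
    ∃ F : Subgroup A, F.FiniteIndex ∧ H ≤ F ∧
      ∃ ρ : F →* H, ∀ x : F, (x : A) ∈ H → (ρ x : A) = x := by
  by_cases h : ∃ z, z ∉ H
  · obtain ⟨z, hz⟩ := h
    obtain ⟨F, h1, -, h2, h3⟩ := hA.retraction H hH z hz
    exact ⟨F, h1, h2, h3⟩
  · push Not at h
    exact ⟨H, by
      have : H = ⊤ := (Subgroup.eq_top_iff' H).2 h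
      rw [this]; infer_instance, le_rfl, MonoidHom.id H, fun _ _ => rfl⟩

theorem zpow_injective_of_not_isOfFinOrder {u : A} (hu : ¬ IsOfFinOrder u) {i j : ℤ}
    (h : u ^ i = u ^ j) : i = j :=
  injective_zpow_iff_not_isOfFinOrder.2 hu h

theorem VirtFree.exists_character (hA : VirtFree A) {u : A} (hu : ¬ IsOfFinOrder u) :
    ∃ F : Subgroup A, F.FiniteIndex ∧ ∃ hF : u ∈ F, ∃ χ : F →* Multiplicative ℤ,
      χ ⟨u, hF⟩ = Multiplicative.ofAdd 1 := by
  obtain ⟨F, hfi, hle, ρ, hρ⟩ := hA.exists_retraction (Subgroup.zpowers u)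
    ((Subgroup.fg_iff _).2 ⟨{u}, by rw [Subgroup.zpowers_eq_closure], Set.finite_singleton u⟩)
  have hF : u ∈ F := hle (Subgroup.mem_zpowers u)
  have hinj : Function.Injective (zpowersHom A u) := by
    intro i j h
    exact zpow_injective_of_not_isOfFinOrder hu h
  let E : Multiplicative ℤ ≃* Subgroup.zpowers u := MonoidHom.ofInjective hinj
  refine ⟨F, hfi, hF, E.symm.toMonoidHom.comp ρ, ?_⟩
  have h1 : ρ ⟨u, hF⟩ = E (Multiplicative.ofAdd 1) := by
    apply Subtype.ext
    rw [hρ _ (Subgroup.mem_zpowers u)]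
    change u = u ^ (1 : ℤ)
    simp
  change E.symm (ρ ⟨u, hF⟩) = _
  rw [h1, MulEquiv.symm_apply_apply]

theorem VirtFree.pot (hA : VirtFree A) {u : A} (hu : ¬ IsOfFinOrder u) (N₀ : Subgroup A)
    (hN : N₀.Normal) (hfi : N₀.FiniteIndex) :
    ∃ s₀ : ℕ, 0 < s₀ ∧ ∀ s' : ℕ, 0 < s' → ∃ N ≤ N₀, N.Normal ∧ N.FiniteIndex ∧
      ∀ i : ℤ, u ^ i ∈ N ↔ ((s₀ * s' : ℕ) : ℤ) ∣ i := by
  obtain ⟨F, hF, huF, χ, hχ⟩ := hA.exists_character hu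
  let K := N₀ ⊓ F.normalCore
  have hKF : ∀ x ∈ K, x ∈ F := fun x hx => F.normalCore_le hx.2
  have hKn : K.Normal := inferInstance
  have hKfi : K.FiniteIndex := inferInstance
  let k := orderOf (u : A ⧸ K)
  have hk : ∀ i : ℤ, u ^ i ∈ K ↔ (k : ℤ) ∣ i := fun i => by
    rw [orderOf_dvd_iff_zpow_eq_one, ← QuotientGroup.mk_zpow, QuotientGroup.eq_one_iff]
  have hk0 : 0 < k := orderOf_pos _
  have hcK : ∀ a (m : ℤ), a⁻¹ * u ^ ((k : ℤ) * m) * a ∈ K := fun a m => by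
    simpa using hKn.conj_mem _ ((hk _).2 (dvd_mul_right (k : ℤ) m)) a⁻¹
  let c : A → ℤ := fun a => Multiplicative.toAdd (χ ⟨_, hKF _ (hcK a 1)⟩)
  have hc : ∀ a m, Multiplicative.toAdd (χ ⟨_, hKF _ (hcK a m)⟩) = m * c a := by
    intro a m
    have : (⟨_, hKF _ (hcK a m)⟩ : F) = ⟨_, hKF _ (hcK a 1)⟩ ^ m := by
      apply Subtype.ext
      have := conj_zpow (i := m) (a := a⁻¹) (b := u ^ (k : ℤ))
      rw [inv_inv] at this
      simp only [Subgroup.coe_zpow, mul_one, this, zpow_mul]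
    rw [this, map_zpow, toAdd_zpow, smul_eq_mul]
  obtain ⟨g, hg⟩ := Int.subgroup_cyclic (AddSubgroup.closure (Set.range c))
  have hgc : ∀ a, g ∣ c a := fun a => by
    have : c a ∈ AddSubgroup.closure (Set.range c) := AddSubgroup.subset_closure ⟨a, rfl⟩
    rw [hg, AddSubgroup.mem_closure_singleton] at this
    obtain ⟨n, hn⟩ := this
    exact ⟨n, by rw [← hn, smul_eq_mul, mul_comm]⟩
  have hcg : ∀ d m : ℤ, (∀ a, d ∣ m * c a) → d ∣ m * g := by
    intro d m h
    have : g ∈ AddSubgroup.closure (Set.range c) := by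
      rw [hg]; exact AddSubgroup.subset_closure rfl
    clear hg hgc
    induction this using AddSubgroup.closure_induction with
    | mem y hy => obtain ⟨a, rfl⟩ := hy; exact h a
    | zero => simp
    | add x y _ _ h1 h2 => rw [mul_add]; exact dvd_add h1 h2
    | neg x _ h1 => rw [mul_neg]; exact h1.neg_right
  have hg0 : g ≠ 0 := by
    rintro rfl
    have h1 := hgc 1
    have h2 : c 1 = k := by
      have : (⟨_, hKF _ (hcK 1 1)⟩ : F) = ⟨u, huF⟩ ^ k := by
        apply Subtype.ext; simp
      simp only [c]
      rw [this, map_pow, hχ]; simp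
    rw [h2, zero_dvd_iff] at h1
    omega
  refine ⟨k, hk0, fun s' hs' => ?_⟩
  let t := g.natAbs * s'
  have ht : t ≠ 0 := Nat.mul_ne_zero (by simpa using hg0) hs'.ne'
  have : NeZero t := ⟨ht⟩
  let χt : F →* Multiplicative (ZMod t) :=
    (AddMonoidHom.toMultiplicative (Int.castAddHom (ZMod t))).comp χ
  have hχt : ∀ x, χt x = 1 ↔ (t : ℤ) ∣ Multiplicative.toAdd (χ x) := fun x => by
    rw [← ZMod.intCast_zmod_eq_zero_iff_dvd]; rfl
  have hfin : Finite (Multiplicative (ZMod t)) := inferInstanceAs (Finite (ZMod t))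
  have hkerfi : χt.ker.FiniteIndex := inferInstance
  have hmapfi : (χt.ker.map F.subtype).FiniteIndex := ⟨by
    rw [Subgroup.index_map_subtype]
    exact mul_ne_zero hkerfi.index_ne_zero hF.index_ne_zero⟩
  let S := χt.ker.map F.subtype ⊓ K
  have hSfi : S.FiniteIndex := inferInstance
  have hS : ∀ x, x ∈ S ↔ ∃ h : x ∈ K, (t : ℤ) ∣ Multiplicative.toAdd (χ ⟨x, hKF x h⟩) := by
    intro x
    constructor
    · rintro ⟨⟨y, hy, rfl⟩, h⟩
      exact ⟨h, (hχt y).1 hy⟩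
    · rintro ⟨h, h1⟩
      exact ⟨⟨⟨x, hKF x h⟩, (hχt _).2 h1, rfl⟩, h⟩
  refine ⟨S.normalCore, fun x hx => (S.normalCore_le hx).2.1, inferInstance, inferInstance,
    fun i => ?_⟩
  have hcore : u ^ i ∈ S.normalCore ↔ ∀ a, a⁻¹ * u ^ i * a ∈ S := by
    constructor
    · intro h a
      have := h a⁻¹
      rwa [inv_inv] at this
    · intro h a
      have := h a⁻¹
      rwa [inv_inv] at this
  rw [hcore]
  constructor
  · intro h
    have h1 : u ^ i ∈ K := by
      have := ((hS _).1 (h 1)).1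
      simpa using this
    obtain ⟨m, rfl⟩ := (hk i).1 h1
    have h2 : (t : ℤ) ∣ m * g := hcg _ _ fun a => by
      have h3 := ((hS _).1 (h a)).2
      have h4 := hc a m
      exact h4 ▸ h3
    push_cast
    refine mul_dvd_mul_left _ ?_
    have h4 : ((g.natAbs * s' : ℕ) : ℤ) ∣ m * g := h2
    rw [Int.natCast_mul, mul_comm m, ← Int.dvd_natAbs, Int.natAbs_mul, Int.natCast_mul] at h4
    have h5 := Int.dvd_of_mul_dvd_mul_left (by simpa using hg0) h4
    exact Int.dvd_natAbs.1 h5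
  · rintro ⟨m, rfl⟩ a
    have h1 : ((k * s' : ℕ) : ℤ) * m = (k : ℤ) * (s' * m) := by push_cast; ring
    rw [h1, hS]
    refine ⟨hcK a _, ?_⟩
    rw [hc]
    have h2 : ((g.natAbs * s' : ℕ) : ℤ) ∣ s' * m * c a := by
      rw [Int.natCast_mul, mul_comm, mul_assoc]
      exact mul_dvd_mul_left _ (dvd_mul_of_dvd_right (Int.natAbs_dvd.2 (hgc a)) m)
    exact h2

theorem VirtFree.natAbs_eq_of_isConj (hA : VirtFree A) {u : A} (hu : ¬ IsOfFinOrder u) {x y : ℤ}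
    (h : IsConj (u ^ x) (u ^ y)) : x.natAbs = y.natAbs := by
  have key : ∀ x y : ℤ, IsConj (u ^ x) (u ^ y) → x ≠ 0 → y ≠ 0 → x ∣ y := by
    intro x y h hx hy
    obtain ⟨s₀, hs₀, hpot⟩ := hA.pot hu ⊤ inferInstance inferInstance
    obtain ⟨N, -, hN, -, hNi⟩ := hpot (x * y).natAbs (by positivity)
    obtain ⟨a, ha⟩ := isConj_iff.1 h
    have h1 : u ^ (x * (s₀ * y)) ∈ N := by
      rw [hNi, Int.natCast_mul, Int.natCast_natAbs]
      have : x * (s₀ * y) = s₀ * (x * y) := by ring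
      rw [this]
      exact mul_dvd_mul_left _ ((abs_dvd _ _).2 dvd_rfl)
    have h2 : u ^ (y * (s₀ * y)) ∈ N := by
      rw [zpow_mul, ← ha, conj_zpow, ← zpow_mul]
      exact hN.conj_mem _ h1 a
    rw [hNi, Int.natCast_mul, Int.natCast_natAbs] at h2
    have h3 : (s₀ : ℤ) * |x * y| ∣ s₀ * (y * y) := by
      convert h2 using 1; ring
    have h4 := Int.dvd_of_mul_dvd_mul_left (by omega) h3
    rw [abs_dvd] at h4
    exact Int.dvd_of_mul_dvd_mul_right hy h4
  have zero : ∀ x : ℤ, IsConj (u ^ (0 : ℤ)) (u ^ x) → x = 0 := by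
    intro x h
    rw [zpow_zero, isConj_one_right] at h
    exact zpow_injective_of_not_isOfFinOrder hu (by simpa using h)
  by_cases hx : x = 0
  · subst hx; rw [zero y h]
  by_cases hy : y = 0
  · subst hy; rw [zero x h.symm]
  exact Nat.dvd_antisymm (Int.natAbs_dvd_natAbs.2 (key x y h hx hy))
    (Int.natAbs_dvd_natAbs.2 (key y x h.symm hy hx))
end

section
variable {A : Type} [Group A]

theorem eventually_dvd_character {F : Subgroup A} (hF : F.FiniteIndex) (χ : F →* Multiplicative ℤ)
    {t : ℕ} (ht : 0 < t) : ∀ᶠ N in profin A, ∀ x ∈ N, ∃ h : x ∈ F,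
      (t : ℤ) ∣ Multiplicative.toAdd (χ ⟨x, h⟩) := by
  have : NeZero t := ⟨ht.ne'⟩
  let χt : F →* Multiplicative (ZMod t) :=
    (AddMonoidHom.toMultiplicative (Int.castAddHom (ZMod t))).comp χ
  have hχt : ∀ x, χt x = 1 ↔ (t : ℤ) ∣ Multiplicative.toAdd (χ x) := fun x => by
    rw [← ZMod.intCast_zmod_eq_zero_iff_dvd]; rfl
  have hfin : Finite (Multiplicative (ZMod t)) := inferInstanceAs (Finite (ZMod t))
  have hkerfi : χt.ker.FiniteIndex := inferInstance
  have hmapfi : (χt.ker.map F.subtype).FiniteIndex := ⟨by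
    rw [Subgroup.index_map_subtype]
    exact mul_ne_zero hkerfi.index_ne_zero hF.index_ne_zero⟩
  filter_upwards [eventually_le_of_finiteIndex (χt.ker.map F.subtype)] with N hN x hx
  obtain ⟨y, hy, rfl⟩ := hN hx
  exact ⟨y.2, (hχt y).1 hy⟩

theorem VirtFree.eventually_notMem (hA : VirtFree A) {z : A} (hz : z ≠ 1) :
    ∀ᶠ N in profin A, z ∉ N := by
  obtain ⟨F, hF, hzF, -⟩ := hA.retraction ⊥ Subgroup.FG.bot z (by simpa using hz)
  filter_upwards [eventually_le_of_finiteIndex F] with N hN h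
  exact hzF (hN h)

theorem VirtFree.eventually_notMem_mul (hA : VirtFree A) {K : Subgroup A} [IsFreeGroup K]
    {α β z : A} (hα : α ∈ K) (hβ : β ∈ K) (hz : ∀ i j : ℤ, z ≠ α ^ i * β ^ j) :
    ∀ᶠ N in profin A, ∀ i j : ℤ, z⁻¹ * (α ^ i * β ^ j) ∉ N := by
  let H := Subgroup.closure {α, β}
  have hαH : α ∈ H := Subgroup.subset_closure (by simp)
  have hβH : β ∈ H := Subgroup.subset_closure (by simp)
  have hHK : H ≤ K := by
    rw [Subgroup.closure_le]
    rintro _ (rfl | rfl) <;> assumption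
  have hHfg : H.FG := (Subgroup.fg_iff _).2 ⟨{α, β}, rfl, by simp⟩
  by_cases hzH : z ∈ H
  swap
  · obtain ⟨F, hF, hzF, hHF, -⟩ := hA.retraction H hHfg z hzH
    filter_upwards [eventually_le_of_finiteIndex F] with N hN i j h
    have h1 : α ^ i * β ^ j ∈ F := hHF (H.mul_mem (H.zpow_mem hαH i) (H.zpow_mem hβH j))
    exact hzF (by simpa using (F.mul_mem_cancel_right h1).1 (hN h))
  have hnc : α * β ≠ β * α := by
    intro hc
    have hc : Commute α β := hc
    obtain ⟨i, j, h⟩ : ∃ i j : ℤ, z = α ^ i * β ^ j := by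
      clear hz
      induction hzH using Subgroup.closure_induction with
      | mem x hx =>
        rcases hx with rfl | rfl
        · exact ⟨1, 0, by simp⟩
        · exact ⟨0, 1, by simp⟩
      | one => exact ⟨0, 0, by simp⟩
      | mul x y _ _ h1 h2 =>
        obtain ⟨i, j, rfl⟩ := h1
        obtain ⟨i', j', rfl⟩ := h2
        refine ⟨i + i', j + j', ?_⟩
        rw [zpow_add, zpow_add, mul_assoc, mul_assoc, ← mul_assoc (β ^ j),
          ← (hc.zpow_zpow i' j).eq, mul_assoc]
      | inv x _ h1 =>
        obtain ⟨i, j, rfl⟩ := h1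
        refine ⟨-i, -j, ?_⟩
        rw [mul_inv_rev, (hc.zpow_zpow (-i) (-j)).eq, zpow_neg, zpow_neg]
    exact hz i j h
  have := isFreeGroup_of_le K hHK
  obtain ⟨F, hF, hHF, ρ, hρ⟩ := hA.exists_retraction H hHfg
  obtain ⟨π₁, π₂, hD⟩ := exists_independent_homs (⟨α, hαH⟩ : H) ⟨β, hβH⟩ (by
      rw [eq_top_iff]
      rintro ⟨x, hx⟩ -
      induction hx using Subgroup.closure_induction with
      | mem x hx =>
        apply Subgroup.subset_closure
        rcases hx with rfl | rfl
        · left; rfl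
        · right; rfl
      | one => exact Subgroup.one_mem _
      | mul x y hx hy h1 h2 => exact Subgroup.mul_mem _ h1 h2
      | inv x hx h => exact Subgroup.inv_mem _ h) (fun h => hnc (congrArg Subtype.val h))
  set a₁ := Multiplicative.toAdd (π₁ ⟨α, hαH⟩)
  set a₂ := Multiplicative.toAdd (π₂ ⟨α, hαH⟩)
  set b₁ := Multiplicative.toAdd (π₁ ⟨β, hβH⟩)
  set b₂ := Multiplicative.toAdd (π₂ ⟨β, hβH⟩)
  set z₁ := Multiplicative.toAdd (π₁ ⟨z, hzH⟩) with hz₁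
  set z₂ := Multiplicative.toAdd (π₂ ⟨z, hzH⟩) with hz₂
  set D := a₁ * b₂ - b₁ * a₂
  let i₀ := (z₁ * b₂ - b₁ * z₂) / D
  let j₀ := (a₁ * z₂ - z₁ * a₂) / D
  have hne : z⁻¹ * (α ^ i₀ * β ^ j₀) ≠ 1 := fun h => hz i₀ j₀ (inv_mul_eq_one.1 h)
  obtain ⟨N₁, hN₁, hN₁f, hzN₁⟩ := eventually_profin.1 (hA.eventually_notMem hne)
  let e := N₁.index
  have he : 0 < e := Nat.pos_of_ne_zero hN₁f.index_ne_zero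
  have hpow : ∀ x (m : ℤ), x ^ ((e : ℤ) * m) ∈ N₁ := fun x m => by
    rw [zpow_mul, zpow_natCast]
    exact N₁.zpow_mem (N₁.pow_index_mem x) m
  have htpos : 0 < D.natAbs * e := Nat.mul_pos (Int.natAbs_pos.2 hD) he
  filter_upwards [eventually_le_of_finiteIndex N₁, eventually_dvd_character hF (π₁.comp ρ) htpos,
    eventually_dvd_character hF (π₂.comp ρ) htpos] with N hN h1 h2 i j h
  have hval : ∀ (π : H →* Multiplicative ℤ) hx,
      Multiplicative.toAdd ((π.comp ρ) ⟨z⁻¹ * (α ^ i * β ^ j), hx⟩) =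
      i * Multiplicative.toAdd (π ⟨α, hαH⟩) + j * Multiplicative.toAdd (π ⟨β, hβH⟩) -
        Multiplicative.toAdd (π ⟨z, hzH⟩) := by
    intro π hx
    have h3 : ρ ⟨z⁻¹ * (α ^ i * β ^ j), hx⟩ =
        (⟨z, hzH⟩ : H)⁻¹ * ((⟨α, hαH⟩ : H) ^ i * (⟨β, hβH⟩ : H) ^ j) := by
      apply Subtype.ext
      rw [hρ _ (H.mul_mem (H.inv_mem hzH) (H.mul_mem (H.zpow_mem hαH i) (H.zpow_mem hβH j)))]
      simp
    rw [MonoidHom.comp_apply, h3]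
    simp only [map_mul, map_inv, map_zpow, toAdd_mul, toAdd_inv, toAdd_zpow, smul_eq_mul]
    ring
  obtain ⟨hx, h1⟩ := h1 _ h
  obtain ⟨hx', h2⟩ := h2 _ h
  rw [hval] at h1 h2
  have hdiv : ((D.natAbs * e : ℕ) : ℤ) = |D| * e := by push_cast; ring
  rw [hdiv] at h1 h2
  have hDe : D * e ∣ |D| * e := mul_dvd_mul_right ((dvd_abs _ _).2 dvd_rfl) _
  have h1' := hDe.trans h1
  have h2' := hDe.trans h2
  have h5 : D * e ∣ i * D - (z₁ * b₂ - b₁ * z₂) := by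
    have := dvd_sub (h1'.mul_right b₂) (h2'.mul_right b₁)
    have h8 : i * D - (z₁ * b₂ - b₁ * z₂) =
        (i * a₁ + j * b₁ - z₁) * b₂ - (i * a₂ + j * b₂ - z₂) * b₁ := by ring
    rwa [h8]
  have h6 : D * e ∣ j * D - (a₁ * z₂ - z₁ * a₂) := by
    have := dvd_sub (h2'.mul_right a₁) (h1'.mul_right a₂)
    have h8 : j * D - (a₁ * z₂ - z₁ * a₂) =
        (i * a₂ + j * b₂ - z₂) * a₁ - (i * a₁ + j * b₁ - z₁) * a₂ := by ring
    rwa [h8]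
  have key : ∀ i P : ℤ, D * e ∣ i * D - P → ∃ m, i - P / D = e * m := by
    rintro i P ⟨m, hm⟩
    have : P = (i - e * m) * D := by linear_combination -hm
    rw [this, Int.mul_ediv_cancel _ hD]
    exact ⟨m, by ring⟩
  obtain ⟨m, hm⟩ := key _ _ h5
  obtain ⟨n, hn⟩ := key _ _ h6
  apply hzN₁ N₁ le_rfl
  have hi : i₀ = i + e * (-m) := by simp only [i₀]; linear_combination -hm
  have hj : j₀ = e * (-n) + j := by simp only [j₀]; linear_combination -hn
  rw [hi, hj, zpow_add, zpow_add]
  have h7 : z⁻¹ * (α ^ i * α ^ ((e : ℤ) * -m) * (β ^ ((e : ℤ) * -n) * β ^ j)) =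
      (z⁻¹ * (α ^ i * β ^ j)) *
        ((β ^ j)⁻¹ * (α ^ ((e : ℤ) * -m) * β ^ ((e : ℤ) * -n)) * (β ^ j)⁻¹⁻¹) := by group
  rw [h7]
  exact N₁.mul_mem (hN h) (hN₁.conj_mem _ (N₁.mul_mem (hpow _ _) (hpow _ _)) _)

theorem VirtFree.dc (hA : VirtFree A) (u x y : A) (t : ℕ) (ht : 0 < t) :
    ∀ᶠ N in profin A, ∀ α β : ℤ, x⁻¹ * (u ^ α * y * u ^ β) ∈ N →
      ∃ α' β' : ℤ, (t : ℤ) ∣ α - α' ∧ (t : ℤ) ∣ β - β' ∧ x = u ^ α' * y * u ^ β' := by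
  obtain ⟨Q, _, _, T, hfree, -, -⟩ := hA.kernel
  let k := t * Nat.card Q
  have hk : 0 < k := Nat.mul_pos ht Nat.card_pos
  have hker : ∀ x, x ^ k ∈ T.ker := fun x => by
    rw [MonoidHom.mem_ker, map_pow, pow_mul, pow_card_eq_one']
  have hloc : ∀ r s : Fin k, ∀ᶠ N in profin A, ∀ m n : ℤ,
      x⁻¹ * (u ^ (r + k * m : ℤ) * y * u ^ (s + k * n : ℤ)) ∈ N →
      ∃ m' n' : ℤ, x = u ^ (r + k * m' : ℤ) * y * u ^ (s + k * n' : ℤ) := by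
    intro r s
    by_cases hex : ∃ m' n' : ℤ, x = u ^ (r + k * m' : ℤ) * y * u ^ (s + k * n' : ℤ)
    · exact Filter.Eventually.of_forall fun N m n _ => hex
    have hform : ∀ m n : ℤ, (u ^ k) ^ m * ((y * u * y⁻¹) ^ k) ^ n =
        (u ^ (r : ℤ))⁻¹ * (u ^ (r + k * m : ℤ) * y * u ^ (s + k * n : ℤ)) *
          ((u ^ (s : ℤ))⁻¹ * y⁻¹) := by
      intro m n
      have h1 : ((y * u * y⁻¹) ^ k) ^ n = y * u ^ (k * n : ℤ) * y⁻¹ := by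
        rw [conj_pow, conj_zpow, zpow_mul, zpow_natCast]
      rw [h1, zpow_add, add_comm (s : ℤ), zpow_add, zpow_mul u k m, zpow_natCast u k]
      group
    obtain ⟨N₀, hN₀, hN₀f, h⟩ := eventually_profin.1 (hA.eventually_notMem_mul (K := T.ker)
      (hker u) (hker (y * u * y⁻¹)) (z := (u ^ (r : ℤ))⁻¹ * x * ((u ^ (s : ℤ))⁻¹ * y⁻¹)) (by
        intro m n h
        rw [hform] at h
        exact hex ⟨m, n, by simpa using h⟩))
    filter_upwards [eventually_le_of_finiteIndex N₀] with N hN m n hmem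
    exfalso
    apply h N₀ le_rfl m n
    rw [hform]
    have h2 := hN₀.conj_mem _ (hN hmem) ((u ^ (s : ℤ))⁻¹ * y⁻¹)⁻¹
    convert h2 using 1
    group
  have hall : ∀ᶠ N in profin A, ∀ r s : Fin k, ∀ m n : ℤ,
      x⁻¹ * (u ^ (r + k * m : ℤ) * y * u ^ (s + k * n : ℤ)) ∈ N →
      ∃ m' n' : ℤ, x = u ^ (r + k * m' : ℤ) * y * u ^ (s + k * n' : ℤ) := by
    rw [Filter.eventually_all]
    intro r
    rw [Filter.eventually_all]
    exact fun s => hloc r s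
  have hres : ∀ α : ℤ, ∃ (r : Fin k) (m : ℤ), α = r + k * m := by
    intro α
    have h1 := Int.emod_nonneg α (by omega : (k : ℤ) ≠ 0)
    have h2 := Int.emod_lt_of_pos α (by omega : 0 < (k : ℤ))
    refine ⟨⟨(α % k).toNat, by omega⟩, α / k, ?_⟩
    rw [Int.toNat_of_nonneg h1]
    exact (Int.emod_add_mul_ediv α k).symm
  filter_upwards [hall] with N hN α β h
  obtain ⟨r, m, rfl⟩ := hres α
  obtain ⟨s, n, rfl⟩ := hres β
  obtain ⟨m', n', hx⟩ := hN r s m n h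
  refine ⟨_, _, ?_, ?_, hx⟩
  · exact ⟨Nat.card Q * (m - m'), by simp only [k]; push_cast; ring⟩
  · exact ⟨Nat.card Q * (n - n'), by simp only [k]; push_cast; ring⟩
end

section
variable {α : Type*} {n : ℕ} [NeZero n]

def circleProd (ℓ : ZMod n → α × Bool) : ℕ → FreeGroup α
  | 0 => 1
  | m + 1 => circleProd ℓ m * FreeGroup.mk [ℓ (m : ZMod n)]

theorem circleProd_add (ℓ : ZMod n → α × Bool) (m : ℕ) :
    circleProd ℓ (n + m) = circleProd ℓ n * circleProd ℓ m := by
  induction m with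
  | zero => simp [circleProd]
  | succ m ih => rw [← add_assoc, circleProd, ih, circleProd, mul_assoc]; simp

theorem circleProd_mul_add (ℓ : ZMod n → α × Bool) (k m : ℕ) :
    circleProd ℓ (k * n + m) = circleProd ℓ n ^ k * circleProd ℓ m := by
  induction k with
  | zero => simp
  | succ k ih =>
    have : (k + 1) * n + m = n + (k * n + m) := by ring
    rw [this, circleProd_add, ih, pow_succ', mul_assoc]

theorem exists_perm_extending_partial {C : Type*} [Finite C] (S : Set C) (f : C → C)
    (hf : S.InjOn f) : ∃ σ : Equiv.Perm C, ∀ x ∈ S, σ x = f x := by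
  classical
  have := Fintype.ofFinite C
  obtain ⟨g, hg⟩ := Set.MapsTo.exists_equiv_extend_of_card_eq (t := (Finset.univ : Finset C))
    (by simp) (s := S) (f := f) (fun _ _ => by simp) hf
  exact ⟨g.trans (Equiv.subtypeUnivEquiv (by simp)), hg⟩

theorem exists_circle_step (ℓ : ZMod n → α × Bool)
    (hred : ∀ x, (ℓ x).1 = (ℓ (x + 1)).1 → (ℓ x).2 = (ℓ (x + 1)).2) (i : α) :
    ∃ (σ : Equiv.Perm (ZMod n)) (wt : ZMod n → ℤ),
      (∀ x, ℓ x = (i, true) → σ (x + 1) = x ∧ wt (x + 1) = 1) ∧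
      (∀ x, ℓ x = (i, false) → σ x = x + 1 ∧ wt x = -1) ∧
      (∀ x, wt x = 0 ∨ (wt x = 1 ∧ ℓ (x - 1) = (i, true)) ∨ (wt x = -1 ∧ ℓ x = (i, false))) := by
  classical
  have hno : ∀ x, ℓ x = (i, true) → ℓ (x + 1) = (i, false) → False := fun x h1 h2 => by
    have := hred x; rw [h1, h2] at this; simp at this
  have hno' : ∀ x, ℓ x = (i, false) → ℓ (x + 1) = (i, true) → False := fun x h1 h2 => by
    have := hred x; rw [h1, h2] at this; simp at this
  obtain ⟨σ, hσ⟩ := exists_perm_extending_partial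
    {x | ℓ (x - 1) = (i, true) ∨ ℓ x = (i, false)}
    (fun x => if ℓ (x - 1) = (i, true) then x - 1 else x + 1) (by
      intro x hx y hy h
      simp only at h
      split_ifs at h with h1 h2 h2
      · simpa using h
      · have hy := hy.resolve_left h2
        exact (hno' y hy (h ▸ h1)).elim
      · have hx := hx.resolve_left h1
        exact (hno' x hx (h ▸ h2)).elim
      · simpa using h)
  refine ⟨σ, fun x => if ℓ (x - 1) = (i, true) then 1 else if ℓ x = (i, false) then -1 else 0,
    fun x hx => ?_, fun x hx => ?_, fun x => ?_⟩
  · have := hσ (x + 1) (Or.inl (by simpa using hx))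
    simp [hx, this]
  · have h1 : ℓ (x - 1) ≠ (i, true) := fun h => hno (x - 1) h (by simpa using hx)
    have := hσ x (Or.inr hx)
    simp [hx, this, h1]
  · simp only
    split_ifs with h1 h2
    · exact Or.inr (Or.inl ⟨rfl, h1⟩)
    · exact Or.inr (Or.inr ⟨rfl, h2⟩)
    · exact Or.inl rfl

theorem exists_circle_action (ℓ : ZMod n → α × Bool)
    (hred : ∀ x, (ℓ x).1 = (ℓ (x + 1)).1 → (ℓ x).2 = (ℓ (x + 1)).2) :
    ∃ φ : ∀ R : ℕ, FreeGroup α →* Equiv.Perm (ZMod n × ZMod R),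
      ∀ (a : α × Bool) (x : ZMod n), ∃ (y : ZMod n) (c : ℤ),
        (∀ R s, φ R (FreeGroup.mk [a]) (x, s) = (y, s + c)) ∧ |c| ≤ 1 ∧
        (c = 1 → y + 1 = x ∧ ℓ y = a) ∧
        (c = -1 → y = x + 1 ∧ FreeGroup.mk [ℓ x] = (FreeGroup.mk [a])⁻¹) ∧
        (ℓ (x - 1) = a → y = x - 1 ∧ c = 1) := by
  choose σ wt h1 h2 h3 using exists_circle_step ℓ hred
  refine ⟨fun R => FreeGroup.lift fun i =>
    Equiv.prodShear (σ i) fun x => Equiv.addRight ((wt i x : ℤ) : ZMod R), ?_⟩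
  rintro ⟨i, b⟩ x
  cases b with
  | true =>
    refine ⟨σ i x, wt i x, fun R s => by simp [FreeGroup.lift_mk], ?_, ?_, ?_, ?_⟩
    · rcases h3 i x with h | ⟨h, -⟩ | ⟨h, -⟩ <;> simp [h]
    · intro h
      rcases h3 i x with h' | ⟨-, h'⟩ | ⟨h', -⟩
      · omega
      · have := (h1 i _ h').1
        rw [sub_add_cancel] at this
        rw [this]
        exact ⟨by simp, h'⟩
      · omega
    · intro h
      rcases h3 i x with h' | ⟨h', -⟩ | ⟨-, h'⟩
      · omega
      · omega
      · exact ⟨(h2 i _ h').1, by rw [h']; simp [FreeGroup.inv_mk, FreeGroup.invRev]⟩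
    · intro h
      have := h1 i _ h
      rwa [sub_add_cancel] at this
  | false =>
    obtain ⟨z, rfl⟩ := (σ i).surjective x
    refine ⟨z, -wt i z, fun R s => ?_, ?_, ?_, ?_, ?_⟩
    · simp only [FreeGroup.lift_mk, List.map_cons, List.map_nil, List.prod_cons, List.prod_nil,
        mul_one, cond_false]
      rw [Equiv.Perm.inv_eq_iff_eq]
      simp
    · rcases h3 i z with h | ⟨h, -⟩ | ⟨h, -⟩ <;> simp [h]
    · intro h
      rcases h3 i z with h' | ⟨h', -⟩ | ⟨-, h'⟩
      · omega
      · omega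
      · exact ⟨(h2 i _ h').1.symm, h'⟩
    · intro h
      rcases h3 i z with h' | ⟨-, h'⟩ | ⟨h', -⟩
      · omega
      · have := (h1 i _ h').1
        rw [sub_add_cancel] at this
        rw [this, h']
        exact ⟨by simp, by simp [FreeGroup.inv_mk, FreeGroup.invRev]⟩
      · omega
    · intro h
      obtain ⟨h4, h5⟩ := h2 i _ h
      rw [sub_add_cancel] at h4
      have := (σ i).injective h4
      rw [this] at h5
      exact ⟨this.symm, by omega⟩

theorem exists_circle_data (ℓ : ZMod n → α × Bool)
    (hred : ∀ x, (ℓ x).1 = (ℓ (x + 1)).1 → (ℓ x).2 = (ℓ (x + 1)).2) :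
    ∃ φ : ∀ R : ℕ, FreeGroup α →* Equiv.Perm (ZMod n × ZMod R),
      (∀ R (m : ℕ) s, φ R (circleProd ℓ m) ((m : ZMod n), s) = (0, s + m)) ∧
      ∀ (L : List (α × Bool)) (x : ZMod n), ∃ (y : ZMod n) (c : ℤ),
        (∀ R s, φ R (FreeGroup.mk L) (x, s) = (y, s + c)) ∧ |c| ≤ L.length ∧
        (c = L.length → ∀ Y : ℕ, ((Y + L.length : ℕ) : ZMod n) = x → y = Y ∧
          FreeGroup.mk L = (circleProd ℓ Y)⁻¹ * circleProd ℓ (Y + L.length)) ∧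
        (c = -L.length → ∀ X : ℕ, (X : ZMod n) = x → y = ((X + L.length : ℕ) : ZMod n) ∧
          FreeGroup.mk L = (circleProd ℓ (X + L.length))⁻¹ * circleProd ℓ X) := by
  obtain ⟨φ, hφ⟩ := exists_circle_action ℓ hred
  refine ⟨φ, fun R m => ?_, fun L x => ?_⟩
  · induction m with
    | zero => intro s; simp [circleProd]
    | succ m ih =>
      intro s
      obtain ⟨y, c, h1, -, -, -, h2⟩ := hφ (ℓ m) ((m + 1 : ℕ) : ZMod n)
      obtain ⟨rfl, rfl⟩ := h2 (by simp)
      rw [circleProd, map_mul, Equiv.Perm.mul_apply, h1]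
      have : ((m + 1 : ℕ) : ZMod n) - 1 = m := by simp
      rw [this, ih]
      simp [add_comm, add_left_comm]
  · induction L with
    | nil =>
      refine ⟨x, 0, fun R s => by simp [← FreeGroup.one_eq_mk], by simp, ?_, ?_⟩
      · rintro - Y rfl
        simp [← FreeGroup.one_eq_mk]
      · rintro - X rfl
        simp [← FreeGroup.one_eq_mk]
    | cons a L ih =>
      obtain ⟨y, c, h1, h2, h3, h4⟩ := ih
      obtain ⟨z, d, k1, k2, k3, k4, -⟩ := hφ a y
      have hmk : FreeGroup.mk (a :: L) = FreeGroup.mk [a] * FreeGroup.mk L := by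
        rw [FreeGroup.mul_mk]; rfl
      rw [abs_le] at h2 k2
      refine ⟨z, c + d, fun R s => ?_, ?_, ?_, ?_⟩
      · rw [hmk, map_mul, Equiv.Perm.mul_apply, h1, k1]
        simp [add_assoc]
      · rw [abs_le]; simp only [List.length_cons]; push_cast; constructor <;> linarith
      · intro h Y hY
        simp only [List.length_cons] at h hY ⊢
        push_cast at h
        obtain ⟨m1, m2⟩ := h3 (by linarith) (Y + 1) (by rw [← hY]; congr 1; ring)
        obtain ⟨m3, m4⟩ := k3 (by linarith)
        have hz : z = Y := by
          rw [m1] at m3; push_cast at m3; exact add_right_cancel m3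
        refine ⟨hz, ?_⟩
        rw [hmk, m2, circleProd, ← hz, m4, show Y + 1 + L.length = Y + (L.length + 1) by ring]
        group
      · intro h X hX
        simp only [List.length_cons] at h ⊢
        push_cast at h
        obtain ⟨m1, m2⟩ := h4 (by linarith) X hX
        obtain ⟨m3, m4⟩ := k4 (by linarith)
        refine ⟨by rw [m3, m1]; push_cast; ring, ?_⟩
        rw [hmk, m2, ← add_assoc, circleProd, ← m1, m4]
        group

theorem exists_circle_of_isCyclicallyReduced {l : List (α × Bool)} (hn : l.length = n)
    (hl : FreeGroup.IsCyclicallyReduced l) : ∃ ℓ : ZMod n → α × Bool,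
      (∀ x, (ℓ x).1 = (ℓ (x + 1)).1 → (ℓ x).2 = (ℓ (x + 1)).2) ∧
      circleProd ℓ n = FreeGroup.mk l := by
  have hlt : ∀ x : ZMod n, x.val < l.length := fun x => hn ▸ ZMod.val_lt x
  refine ⟨fun x => l[x.val]'(hlt x), fun x => ?_, ?_⟩
  · obtain ⟨h1, h2⟩ := hl
    by_cases hx : x.val + 1 < n
    · have : (x + 1).val = x.val + 1 := by
        rw [ZMod.val_add, ZMod.val_one_eq_one_mod, Nat.add_mod_mod, Nat.mod_eq_of_lt hx]
      have h3 := List.isChain_iff_getElem.1 h1 x.val (by omega)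
      simpa only [this] using h3
    · have h4 : x.val + 1 = n := by have := ZMod.val_lt x; omega
      have : (x + 1).val = 0 := by
        rw [ZMod.val_add, ZMod.val_one_eq_one_mod, Nat.add_mod_mod, h4, Nat.mod_self]
      have hxl : x.val = l.length - 1 := by omega
      simp only [this]
      refine h2 _ ?_ _ ?_
      · rw [List.getLast?_eq_getElem?, ← hxl]
        simp [List.getElem?_eq_getElem (hlt x)]
      · rw [List.head?_eq_getElem?, List.getElem?_eq_getElem (by omega)]; simp
  · have key : ∀ m ≤ n, circleProd (fun x => l[x.val]'(hlt x)) m = FreeGroup.mk (l.take m) := by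
      intro m
      induction m with
      | zero => intro _; simp [circleProd, ← FreeGroup.one_eq_mk]
      | succ m ih =>
        intro hm
        have hv : (m : ZMod n).val = m := ZMod.val_cast_of_lt (by omega)
        rw [circleProd, ih (by omega), List.take_succ_eq_append_getElem (by omega),
          FreeGroup.mul_mk]
        simp only [hv]
    rw [key n le_rfl, ← hn, List.take_length]

end

section
variable {α : Type*}

theorem exists_circle_ratio {l l' : List (α × Bool)} (hl : FreeGroup.IsCyclicallyReduced l)
    (hl0 : 0 < l.length) :
    ∃ K : ℕ, 0 < K ∧ ∀ R : ℕ, 0 < R → ∃ N : Subgroup (FreeGroup α), N.Normal ∧ N.FiniteIndex ∧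
      ∀ (i m : ℤ) (v : FreeGroup α),
        (FreeGroup.mk l ^ i)⁻¹ * (v * FreeGroup.mk l' ^ m * v⁻¹) ∈ N →
        ∃ c : ℤ, |c| ≤ K * l'.length ∧ (R : ℤ) ∣ m * c - i * (K * l.length) ∧
          ∀ ε : ℤ, ε = 1 ∨ ε = -1 → c = ε * (K * l'.length) →
            ∃ k : ℕ, K * l'.length = k * l.length ∧
              IsConj (FreeGroup.mk l ^ (ε * k)) (FreeGroup.mk l' ^ K) := by
  generalize hn : l.length = n
  have : NeZero n := ⟨by omega⟩
  obtain ⟨ℓ, hred, hr⟩ := exists_circle_of_isCyclicallyReduced hn hl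
  obtain ⟨φ, h1, h2⟩ := exists_circle_data ℓ hred
  let K := Nat.card (Equiv.Perm (ZMod n × ZMod 1))
  refine ⟨K, Nat.card_pos, fun R hR => ?_⟩
  have : NeZero R := ⟨hR.ne'⟩
  refine ⟨(φ R).ker, inferInstance, inferInstance, fun i m v h => ?_⟩
  have hv : φ R v * φ R (FreeGroup.mk l') ^ m = φ R (FreeGroup.mk l) ^ i * φ R v := by
    rw [MonoidHom.mem_ker, map_mul, map_inv, inv_mul_eq_one, map_mul, map_mul, map_zpow,
      map_zpow, map_inv] at h
    rw [h]; group
  have hshift : ∀ (g : FreeGroup α) x s t, φ R g (x, s + t) = ((φ R g (x, s)).1,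
      (φ R g (x, s)).2 + t) := by
    intro g x s t
    obtain ⟨L, rfl⟩ := Quot.exists_rep g
    obtain ⟨y, c, hc, -⟩ := h2 L x
    have hc' : ∀ s, φ R (Quot.mk _ L) (x, s) = (y, s + c) := hc R
    rw [hc', hc']
    ext
    · rfl
    · simp only; ring
  let p := (φ R v)⁻¹ (0, 0)
  have hp : φ R v p = (0, 0) := by
    simp only [p]; rw [← Equiv.Perm.mul_apply, mul_inv_cancel, Equiv.Perm.one_apply]
  let L := (List.replicate K l').flatten
  have hLlen : L.length = K * l'.length := by simp [L]
  have hL : FreeGroup.mk L = FreeGroup.mk l' ^ K := (FreeGroup.pow_mk K).symm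
  obtain ⟨y, c, hc1, hc2, hc3, hc4⟩ := h2 L p.1
  have hy : y = p.1 := by
    have h3 := hc1 1 0
    rw [hL, map_pow, pow_card_eq_one', Equiv.Perm.one_apply] at h3
    exact (congrArg Prod.fst h3).symm
  subst hy
  rw [hLlen] at hc2 hc3 hc4
  push_cast at hc2 hc3 hc4
  have hrit : ∀ (P : Equiv.Perm (ZMod n × ZMod R)) x (d : ℤ),
      (∀ s, P (x, s) = (x, s + d)) → ∀ (j : ℤ) s, (P ^ j) (x, s) = (x, s + j * d) := by
    intro P x d hP j
    induction j with
    | zero => intro s; simp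
    | succ j ih => intro s; rw [zpow_add_one, Equiv.Perm.mul_apply, hP, ih]; ext; · rfl
                   push_cast; ring
    | pred j ih =>
      intro s; rw [zpow_sub_one, Equiv.Perm.mul_apply]
      have : P⁻¹ (x, s) = (x, s - d) := by rw [Equiv.Perm.inv_eq_iff_eq, hP]; simp
      rw [this, ih]; ext; · rfl
      push_cast; ring
  have hr0 : ∀ s, φ R (FreeGroup.mk l) (0, s) = (0, s + (n : ℤ)) := by
    intro s
    have := h1 R n s
    rw [hr, ZMod.natCast_self] at this
    exact_mod_cast this
  refine ⟨c, hc2, ?_, ?_⟩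
  · have hvK : φ R v * (φ R (FreeGroup.mk l') ^ K) ^ m =
        φ R (FreeGroup.mk l) ^ (i * K) * φ R v := by
      rw [← zpow_natCast, zpow_comm, zpow_natCast, zpow_mul, zpow_natCast]
      have h5 : φ R (FreeGroup.mk l') ^ m =
          (φ R v)⁻¹ * φ R (FreeGroup.mk l) ^ i * (φ R v)⁻¹⁻¹ := by
        rw [inv_inv, mul_assoc, ← hv]; group
      rw [h5, conj_pow]; group
    have h4 := congrArg (fun P : Equiv.Perm _ => P p) hvK
    simp only [Equiv.Perm.mul_apply, hp] at h4
    rw [hrit _ _ _ hr0, ← map_pow, ← hL] at h4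
    have h5 := hrit _ p.1 c (hc1 R) m p.2
    rw [Prod.mk.eta] at h5
    rw [h5, hshift] at h4
    rw [Prod.mk.eta, hp] at h4
    have h6 := congrArg Prod.snd h4
    simp only [zero_add] at h6
    rw [← ZMod.intCast_zmod_eq_zero_iff_dvd]
    push_cast at h6 ⊢
    rw [h6]; ring
  · intro ε hε hcε
    have hdvd : ∀ X : ZMod n, X + ((K * l'.length : ℕ) : ZMod n) = X → n ∣ K * l'.length :=
      fun X h => (ZMod.natCast_eq_zero_iff _ _).1 (by simpa using h)
    rcases hε with rfl | rfl
    · obtain ⟨Y, hY⟩ := ZMod.natCast_zmod_surjective (p.1 - ((K * l'.length : ℕ) : ZMod n))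
      obtain ⟨h3, h4⟩ := hc3 (by linarith) Y (by rw [hY]; simp)
      obtain ⟨k, hk⟩ := hdvd Y (by linear_combination hY + h3)
      refine ⟨k, by rw [hk, mul_comm], ?_⟩
      rw [isConj_iff]
      refine ⟨(circleProd ℓ Y)⁻¹, ?_⟩
      rw [← hL, h4, hk, show Y + n * k = k * n + Y by ring, circleProd_mul_add, hr, one_mul,
        zpow_natCast]
      group
    · obtain ⟨X, hX⟩ := ZMod.natCast_zmod_surjective p.1
      obtain ⟨h3, h4⟩ := hc4 (by linarith) X hX
      obtain ⟨k, hk⟩ := hdvd X (by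
        push_cast at h3 ⊢; linear_combination -h3 - hX)
      refine ⟨k, by rw [hk, mul_comm], ?_⟩
      rw [isConj_iff]
      refine ⟨(circleProd ℓ X)⁻¹, ?_⟩
      rw [← hL, h4, hk, show X + n * k = k * n + X by ring, circleProd_mul_add, hr, neg_one_mul,
        zpow_neg, zpow_natCast]
      group

theorem commensurable_arith {n n' K K' q R : ℕ} {i l c c' : ℤ}
    (hn : 0 < n) (hn' : 0 < n') (hK : 0 < K) (hK' : 0 < K')
    (hR : R = q * (K * n.gcd n') * (2 * (K * K' * n * n')).factorial)
    (hc : |c| ≤ K * n') (hc' : |c'| ≤ K' * n)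
    (h : (R : ℤ) ∣ l * c - i * (K * n)) (h' : (R : ℤ) ∣ i * c' - l * (K' * n')) :
    ((q : ℤ) ∣ i ∧ (q : ℤ) ∣ l) ∨ ∃ ε : ℤ, (ε = 1 ∨ ε = -1) ∧ c = ε * (K * n') ∧
      (q : ℤ) ∣ i * (n / n.gcd n' : ℕ) - ε * l * (n' / n.gcd n' : ℕ) := by
  have hg : 0 < n.gcd n' := Nat.gcd_pos_of_pos_left _ hn
  by_cases hE : (K * K' * n * n' : ℤ) - c * c' = 0
  · right
    have habs : |c| = K * n' := by
      apply le_antisymm hc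
      by_contra hlt
      push Not at hlt
      have h1 : |c| * |c'| = (K * n') * (K' * n) := by
        rw [← abs_mul, show c * c' = (K * K' * n * n' : ℤ) by linarith, abs_of_nonneg (by positivity)]
        ring
      have h2 : (0 : ℤ) < K' * n := by positivity
      nlinarith [abs_nonneg c, abs_nonneg c']
    have key : ∀ ε : ℤ, ε = 1 ∨ ε = -1 → c = ε * (K * n') →
        (q : ℤ) ∣ i * (n / n.gcd n' : ℕ) - ε * l * (n' / n.gcd n' : ℕ) := by
      intro ε _ hcε
      have h1 : ((q * (K * n.gcd n') : ℕ) : ℤ) ∣ l * c - i * (K * n) :=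
        (Int.natCast_dvd_natCast.2 (hR ▸ Dvd.intro _ rfl)).trans h
      have hx : (n' : ℤ) = n.gcd n' * (n' / n.gcd n' : ℕ) := by
        exact_mod_cast (Nat.mul_div_cancel' (Nat.gcd_dvd_right n n')).symm
      have hy : (n : ℤ) = n.gcd n' * (n / n.gcd n' : ℕ) := by
        exact_mod_cast (Nat.mul_div_cancel' (Nat.gcd_dvd_left n n')).symm
      generalize n' / n.gcd n' = x at *
      generalize n / n.gcd n' = y at *
      have h2 : l * c - i * (K * n) = -(i * y - ε * l * x) * (K * n.gcd n') := by
        rw [hcε]; nth_rw 1 [hx]; nth_rw 1 [hy]; ring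
      rw [h2, Nat.cast_mul, ← Nat.cast_mul K] at h1
      push_cast at h1
      have h3 := Int.dvd_of_mul_dvd_mul_right (by positivity) h1
      exact (dvd_neg.1 h3)
    rcases abs_eq (by positivity : (0 : ℤ) ≤ K * n') |>.1 habs with h1 | h1
    · exact ⟨1, Or.inl rfl, by rw [h1, one_mul], key 1 (Or.inl rfl) (by rw [h1, one_mul])⟩
    · exact ⟨-1, Or.inr rfl, by rw [h1]; ring, key (-1) (Or.inr rfl) (by rw [h1]; ring)⟩
  · left
    set E := (K * K' * n * n' : ℤ) - c * c' with hEdef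
    have hE0 : 0 < E.natAbs := Int.natAbs_pos.2 hE
    have hEle : E.natAbs ≤ 2 * (K * K' * n * n') := by
      zify
      have h1 : |c * c'| ≤ (K * n') * (K' * n) := by
        rw [abs_mul]; exact mul_le_mul hc hc' (abs_nonneg _) (by positivity)
      rw [abs_le] at h1 ⊢
      rw [hEdef]
      constructor <;> nlinarith
    have hdvd : (E : ℤ) ∣ ((2 * (K * K' * n * n')).factorial : ℕ) :=
      Int.natAbs_dvd.1 (Int.natCast_dvd_natCast.2 (Nat.dvd_factorial hE0 hEle))
    have hRE : (q : ℤ) * E ∣ R := by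
      rw [hR]; push_cast
      exact mul_dvd_mul (Dvd.intro _ rfl) hdvd
    have h1 : (R : ℤ) ∣ i * E := by
      have := dvd_add (h.mul_left (K' * n')) (h'.mul_left c)
      rw [← dvd_neg]
      convert this using 1
      rw [hEdef]; ring
    have h2 : (R : ℤ) ∣ l * E := by
      have := dvd_add (h'.mul_left (K * n)) (h.mul_left c')
      rw [← dvd_neg]
      convert this using 1
      rw [hEdef]; ring
    exact ⟨Int.dvd_of_mul_dvd_mul_right hE (hRE.trans h1),
      Int.dvd_of_mul_dvd_mul_right hE (hRE.trans h2)⟩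

def Separates {G : Type*} [Group G] (N : Subgroup G) (r w : G) (x y q : ℕ) : Prop :=
  ∀ (i l : ℤ) (v : G), (r ^ i)⁻¹ * (v * w ^ l * v⁻¹) ∈ N →
    ((q : ℤ) ∣ i ∧ (q : ℤ) ∣ l) ∨ ∃ (ε : ℤ) (g : ℕ), (ε = 1 ∨ ε = -1) ∧ 0 < g ∧
      IsConj (r ^ (g * x)) (w ^ (ε * (g * y))) ∧ (q : ℤ) ∣ i * y - ε * l * x

theorem mem_symm_of_normal {G : Type*} [Group G] {N : Subgroup G} (hN : N.Normal) {a b v : G}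
    (h : a⁻¹ * (v * b * v⁻¹) ∈ N) : b⁻¹ * (v⁻¹ * a * v⁻¹⁻¹) ∈ N := by
  have h3 := hN.conj_mem _ (N.inv_mem h) (v⁻¹)
  convert h3 using 1
  group

theorem exists_conj_cyclicallyReduced (r : FreeGroup α) :
    ∃ (c : FreeGroup α) (l : List (α × Bool)), r = c * FreeGroup.mk l * c⁻¹ ∧
      FreeGroup.IsCyclicallyReduced l := by
  classical
  refine ⟨FreeGroup.mk (FreeGroup.reduceCyclically.conjugator r.toWord),
    FreeGroup.reduceCyclically r.toWord, ?_,
    FreeGroup.reduceCyclically.isCyclicallyReduced FreeGroup.isReduced_toWord⟩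
  rw [FreeGroup.inv_mk, FreeGroup.mul_mk, FreeGroup.mul_mk,
    FreeGroup.reduceCyclically.conj_conjugator_reduceCyclically, FreeGroup.mk_toWord]

theorem isConj_of_ratio {G : Type*} [Group G] {r w : G} {n n' k K : ℕ} {ε : ℤ} (hn : 0 < n)
    (hK : 0 < K) (hε : ε = 1 ∨ ε = -1) (hk : K * n' = k * n)
    (h : IsConj (r ^ (ε * k)) (w ^ K)) :
    ∃ g : ℕ, 0 < g ∧ IsConj (r ^ (g * (n' / n.gcd n'))) (w ^ (ε * (g * (n / n.gcd n') : ℕ))) := by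
  have hg : 0 < n.gcd n' := Nat.gcd_pos_of_pos_left _ hn
  have hx : n' = n.gcd n' * (n' / n.gcd n') := (Nat.mul_div_cancel' (Nat.gcd_dvd_right n n')).symm
  have hy : n = n.gcd n' * (n / n.gcd n') := (Nat.mul_div_cancel' (Nat.gcd_dvd_left n n')).symm
  have hco : Nat.Coprime (n / n.gcd n') (n' / n.gcd n') := Nat.coprime_div_gcd_div_gcd hg
  have hy0 : 0 < n / n.gcd n' := Nat.div_pos (Nat.gcd_le_left _ hn) hg
  generalize n' / n.gcd n' = x at *
  generalize n / n.gcd n' = y at *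
  have hkk : K * x = k * y := by
    apply Nat.eq_of_mul_eq_mul_left hg
    calc _ = K * (n.gcd n' * x) := by ring
      _ = k * (n.gcd n' * y) := by rw [← hx, ← hy, hk]
      _ = _ := by ring
  obtain ⟨g, rfl⟩ : y ∣ K := hco.dvd_of_dvd_mul_right (hkk ▸ Dvd.intro_left _ rfl)
  have hkg : k = g * x := by
    apply Nat.eq_of_mul_eq_mul_right hy0
    rw [← hkk]; ring
  refine ⟨g, Nat.pos_of_mul_pos_left hK, ?_⟩
  obtain ⟨c, hc⟩ := isConj_iff.1 h
  rw [isConj_iff]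
  refine ⟨c, ?_⟩
  have h1 := congrArg (· ^ ε) hc
  simp only [conj_zpow] at h1
  rw [← zpow_mul, ← zpow_natCast, ← zpow_mul] at h1
  have hee : ε * ε = 1 := by rcases hε with rfl | rfl <;> rfl
  have h2 : ε * (k : ℤ) * ε = (g * x : ℕ) := by rw [hkg, mul_right_comm, hee, one_mul]
  rw [h2, zpow_natCast, mul_comm _ ε, mul_comm y g] at h1
  exact h1

theorem freeGroup_separates (r w : FreeGroup α) (hr : r ≠ 1) (hw : w ≠ 1) :
    ∃ x y : ℕ, 0 < x ∧ 0 < y ∧ x.Coprime y ∧ ∀ q : ℕ, 0 < q →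
      ∃ N : Subgroup (FreeGroup α), N.Normal ∧ N.FiniteIndex ∧ Separates N r w x y q := by
  obtain ⟨c, l, rfl, hl⟩ := exists_conj_cyclicallyReduced r
  obtain ⟨d, l', rfl, hl'⟩ := exists_conj_cyclicallyReduced w
  have hpos : ∀ (l : List (α × Bool)) (c : FreeGroup α), c * FreeGroup.mk l * c⁻¹ ≠ 1 →
      0 < l.length := by
    intro l c h
    rw [List.length_pos_iff]
    rintro rfl
    simp [← FreeGroup.one_eq_mk] at h
  have hn := hpos l c hr
  have hn' := hpos l' d hw
  obtain ⟨K, hK, H⟩ := exists_circle_ratio (l' := l') hl hn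
  obtain ⟨K', hK', H'⟩ := exists_circle_ratio (l' := l) hl' hn'
  have hg : 0 < l.length.gcd l'.length := Nat.gcd_pos_of_pos_left _ hn
  refine ⟨l'.length / l.length.gcd l'.length, l.length / l.length.gcd l'.length,
    Nat.div_pos (Nat.gcd_le_right _ hn') hg, Nat.div_pos (Nat.gcd_le_left _ hn) hg,
    (Nat.coprime_div_gcd_div_gcd hg).symm, fun q hq => ?_⟩
  obtain ⟨R, hR⟩ : ∃ R, R = q * (K * l.length.gcd l'.length) *
    (2 * (K * K' * l.length * l'.length)).factorial := ⟨_, rfl⟩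
  have hR0 : 0 < R := by
    have := Nat.factorial_pos (2 * (K * K' * l.length * l'.length))
    rw [hR]; positivity
  obtain ⟨N₁, hN₁, hN₁f, h1⟩ := H R hR0
  obtain ⟨N₂, hN₂, hN₂f, h2⟩ := H' R hR0
  refine ⟨N₁ ⊓ N₂, inferInstance, inferInstance, fun i m v h => ?_⟩
  have h3 : (FreeGroup.mk l ^ i)⁻¹ * ((c⁻¹ * v * d) * FreeGroup.mk l' ^ m * (c⁻¹ * v * d)⁻¹) ∈
      N₁ ⊓ N₂ := by
    have := (inferInstance : (N₁ ⊓ N₂).Normal).conj_mem _ h c⁻¹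
    rw [conj_zpow, conj_zpow] at this
    convert this using 1
    group
  obtain ⟨b, hb1, hb2, hb3⟩ := h1 _ _ _ h3.1
  obtain ⟨b', hb1', hb2', -⟩ := h2 _ _ _ (mem_symm_of_normal hN₂ h3.2)
  rcases commensurable_arith hn hn' hK hK' hR hb1 hb1' hb2 hb2' with h4 | ⟨ε, hε, hbε, h4⟩
  · exact Or.inl h4
  · right
    obtain ⟨k, hk, hconj⟩ := hb3 ε hε hbε
    obtain ⟨g, hg0, hgc⟩ := isConj_of_ratio hn hK hε hk hconj
    refine ⟨ε, g, hε, hg0, ?_, h4⟩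
    push_cast at hgc
    rw [conj_pow, conj_zpow]
    exact ((isConj_iff.2 ⟨c, rfl⟩ : IsConj _ _).symm.trans hgc).trans (isConj_iff.2 ⟨d, rfl⟩)

end

section
variable {A : Type} [Group A]

theorem isFreeGroup_separates {G : Type} [Group G] [IsFreeGroup G] (r w : G) (hr : r ≠ 1)
    (hw : w ≠ 1) : ∃ x y : ℕ, 0 < x ∧ 0 < y ∧ x.Coprime y ∧ ∀ q : ℕ, 0 < q →
      ∃ N : Subgroup G, N.Normal ∧ N.FiniteIndex ∧ Separates N r w x y q := by
  let f := IsFreeGroup.toFreeGroup G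
  obtain ⟨x, y, hx, hy, hxy, H⟩ := freeGroup_separates (f r) (f w) (by simpa using hr)
    (by simpa using hw)
  refine ⟨x, y, hx, hy, hxy, fun q hq => ?_⟩
  obtain ⟨N, hN, hNf, h⟩ := H q hq
  refine ⟨N.comap f.toMonoidHom, inferInstance, ⟨by
    rw [Subgroup.index_comap_of_surjective _ f.surjective]; exact hNf.index_ne_zero⟩, fun i l v hm => ?_⟩
  rcases h i l (f v) (by simpa using hm) with h1 | ⟨ε, g, hε, hg, hc, h1⟩
  · exact Or.inl h1
  · refine Or.inr ⟨ε, g, hε, hg, ?_, h1⟩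
    have := f.symm.toMonoidHom.map_isConj hc
    simpa using this

def Commens {G : Type*} [Group G] (a u : G) (x y : ℕ) : Prop :=
  ∃ (ε : ℤ) (g : ℕ), (ε = 1 ∨ ε = -1) ∧ 0 < g ∧ IsConj (a ^ (g * x)) (u ^ (ε * (g * y)))

theorem IsConj.pow' {G : Type*} [Group G] {a b : G} (h : IsConj a b) (n : ℕ) :
    IsConj (a ^ n) (b ^ n) := by
  obtain ⟨c, hc⟩ := isConj_iff.1 h
  exact isConj_iff.2 ⟨c, by rw [← conj_pow, hc]⟩

theorem VirtFree.commens_unique (hA : VirtFree A) {a u : A} (hu : ¬IsOfFinOrder u)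
    {x y x' y' : ℕ} (hc : Commens a u x y) (hc' : Commens a u x' y') (hxy : x.Coprime y)
    (hxy' : x'.Coprime y') : x = x' ∧ y = y' := by
  obtain ⟨ε, g, hε, hg, h⟩ := hc
  obtain ⟨ε', g', hε', hg', h'⟩ := hc'
  have h1 := IsConj.pow' h (g' * x')
  have h2 := IsConj.pow' h' (g * x)
  rw [← pow_mul, ← zpow_natCast (u ^ _), ← zpow_mul] at h1 h2
  rw [show g' * x' * (g * x) = g * x * (g' * x') by ring] at h2
  have h3 := hA.natAbs_eq_of_isConj hu (h1.symm.trans h2)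
  have hε1 : ε.natAbs = 1 := by rcases hε with rfl | rfl <;> rfl
  have hε1' : ε'.natAbs = 1 := by rcases hε' with rfl | rfl <;> rfl
  simp only [Int.natAbs_mul, hε1, hε1', Int.natAbs_natCast] at h3
  have h4 : y * x' = y' * x := by
    apply Nat.eq_of_mul_eq_mul_left (Nat.mul_pos hg hg')
    linarith
  have hx1 : x ∣ x' := hxy.dvd_of_dvd_mul_left (h4 ▸ Dvd.intro_left _ rfl)
  have hx2 : x' ∣ x := hxy'.dvd_of_dvd_mul_left (h4 ▸ Dvd.intro_left _ rfl)
  have hy1 : y ∣ y' := hxy.symm.dvd_of_dvd_mul_right (h4 ▸ Dvd.intro _ rfl)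
  have hy2 : y' ∣ y := hxy'.symm.dvd_of_dvd_mul_right (h4 ▸ Dvd.intro _ rfl)
  exact ⟨Nat.dvd_antisymm hx1 hx2, Nat.dvd_antisymm hy1 hy2⟩

theorem VirtFree.separates (hA : VirtFree A) {a u : A} (ha : ¬IsOfFinOrder a)
    (hu : ¬IsOfFinOrder u) : ∃ x y : ℕ, 0 < x ∧ 0 < y ∧ x.Coprime y ∧ ∀ q : ℕ, 0 < q →
      ∀ᶠ N in profin A, Separates N a u x y q := by
  obtain ⟨Q, _, _, T, hfree, -, -⟩ := hA.kernel
  let k := Nat.card Q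
  have hk : 0 < k := Nat.card_pos
  have hker : ∀ x, x ^ k ∈ T.ker := fun x => by
    rw [MonoidHom.mem_ker, map_pow, pow_card_eq_one']
  have hTfi : T.ker.FiniteIndex := inferInstance
  have hne : ∀ x : A, ¬IsOfFinOrder x → x ^ k ≠ 1 := fun x hx h =>
    hx (isOfFinOrder_iff_pow_eq_one.2 ⟨k, hk, h⟩)
  let r : T.ker := ⟨a ^ k, hker a⟩
  let y (j : A ⧸ T.ker) : A := j.out
  let w (j : A ⧸ T.ker) : T.ker := ⟨(y j * u * (y j)⁻¹) ^ k, hker _⟩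
  have hw : ∀ j, (w j : A) = y j * u ^ k * (y j)⁻¹ := fun j => conj_pow
  have H : ∀ j, _ := fun j => isFreeGroup_separates r (w j)
    (fun h => hne a ha (congrArg Subtype.val h)) (fun h => by
      have h1 := congrArg Subtype.val h
      rw [hw] at h1
      exact hne u hu (by simpa using h1))
  choose X Y hX hY hXY M hMn hMf hM using H
  have hsep : ∀ (q : ℕ) (hq : 0 < q), ∃ N₀ : Subgroup A, N₀.Normal ∧ N₀.FiniteIndex ∧
      ∀ (i l : ℤ) v, (a ^ i)⁻¹ * (v * u ^ l * v⁻¹) ∈ N₀ → ((q : ℤ) ∣ i ∧ (q : ℤ) ∣ l) ∨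
        ∃ (j : A ⧸ T.ker) (ε : ℤ) (g : ℕ), (ε = 1 ∨ ε = -1) ∧ 0 < g ∧
        IsConj (a ^ (g * X j)) (u ^ (ε * (g * Y j))) ∧ (q : ℤ) ∣ i * Y j - ε * l * X j := by
    intro q hq
    have hfi : ∀ j, ((M j q hq).map T.ker.subtype).FiniteIndex := fun j => ⟨by
      rw [Subgroup.index_map_subtype]
      exact mul_ne_zero (hMf j q hq).index_ne_zero hTfi.index_ne_zero⟩
    have hfi' : (⨅ j, (M j q hq).map T.ker.subtype).FiniteIndex :=
      Subgroup.finiteIndex_iInf hfi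
    let N₀ := (⨅ j, (M j q hq).map T.ker.subtype).normalCore
    refine ⟨N₀, inferInstance, inferInstance, fun i l v h => ?_⟩
    let j : A ⧸ T.ker := (v : A ⧸ T.ker)
    have hκ : v * (y j)⁻¹ ∈ T.ker := by
      have h1 : (y j)⁻¹ * v ∈ T.ker := QuotientGroup.eq.1 (Quotient.out_eq' j)
      exact (inferInstance : T.ker.Normal).mem_comm h1
    have h2 : ((r ^ i)⁻¹ * (⟨_, hκ⟩ * w j ^ l * (⟨_, hκ⟩ : T.ker)⁻¹) : T.ker) ∈ M j q hq := by
      have h3 : (a ^ (k * i : ℤ))⁻¹ * (v * u ^ (k * l : ℤ) * v⁻¹) ∈ N₀ := by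
        have hN : N₀.Normal := inferInstance
        rw [← QuotientGroup.eq_one_iff] at h ⊢
        rw [QuotientGroup.mk_mul, QuotientGroup.mk_inv, inv_mul_eq_one] at h ⊢
        rw [← conj_zpow] at h ⊢
        rw [mul_comm (k : ℤ), mul_comm (k : ℤ), zpow_mul, zpow_mul]
        exact congrArg (· ^ (k : ℤ)) h
      have h4 := Subgroup.normalCore_le _ h3
      rw [Subgroup.mem_iInf] at h4
      obtain ⟨z, hz, hz'⟩ := h4 j
      suffices h5 : (r ^ i)⁻¹ * (⟨_, hκ⟩ * w j ^ l * (⟨_, hκ⟩ : T.ker)⁻¹) = z by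
        rw [h5]; exact hz
      apply Subtype.ext
      have h6 : (z : A) = _ := hz'
      rw [h6]
      simp only [Subgroup.coe_mul, Subgroup.coe_inv, Subgroup.coe_zpow, hw, r, zpow_mul,
        zpow_natCast, conj_zpow]
      group
    rcases hM j q hq i l _ h2 with h3 | ⟨ε, g, hε, hg, hc, h3⟩
    · exact Or.inl h3
    · refine Or.inr ⟨j, ε, k * g, hε, Nat.mul_pos hk hg, ?_, h3⟩
      have h4 := T.ker.subtype.map_isConj hc
      simp only [map_pow, map_zpow, Subgroup.subtype_apply, hw, r] at h4
      rw [mul_assoc, pow_mul]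
      refine h4.trans ((isConj_iff.2 ⟨y j, ?_⟩ : IsConj _ _).symm)
      rw [conj_zpow, ← zpow_natCast u k, ← zpow_mul]
      congr 3
      push_cast; ring
  by_cases hJ : ∃ j₀, Commens a u (X j₀) (Y j₀)
  · obtain ⟨j₀, hj₀⟩ := hJ
    refine ⟨X j₀, Y j₀, hX j₀, hY j₀, hXY j₀, fun q hq => ?_⟩
    obtain ⟨N₀, hN₀, hN₀f, h⟩ := hsep q hq
    refine eventually_profin.2 ⟨N₀, hN₀, hN₀f, fun N hN i l v hm => ?_⟩
    rcases h i l v (hN hm) with h1 | ⟨j, ε, g, hε, hg, hc, h1⟩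
    · exact Or.inl h1
    · obtain ⟨h2, h3⟩ := hA.commens_unique hu ⟨ε, g, hε, hg, hc⟩ hj₀ (hXY j) (hXY j₀)
      rw [h2, h3] at hc h1
      exact Or.inr ⟨ε, g, hε, hg, hc, h1⟩
  · refine ⟨1, 1, one_pos, one_pos, Nat.coprime_one_left 1, fun q hq => ?_⟩
    obtain ⟨N₀, hN₀, hN₀f, h⟩ := hsep q hq
    refine eventually_profin.2 ⟨N₀, hN₀, hN₀f, fun N hN i l v hm => ?_⟩
    rcases h i l v (hN hm) with h1 | ⟨j, ε, g, hε, hg, hc, h1⟩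
    · exact Or.inl h1
    · exact (hJ ⟨j, ε, g, hε, hg, hc⟩).elim
end

section
variable {A : Type} [Group A]

theorem mem_pow_of_normal {G : Type*} [Group G] {N : Subgroup G} (hN : N.Normal) {a b y : G}
    (h : b⁻¹ * (y * a * y⁻¹) ∈ N) (k : ℕ) : (b ^ k)⁻¹ * (y * a ^ k * y⁻¹) ∈ N := by
  rw [← QuotientGroup.eq_one_iff, QuotientGroup.mk_mul, QuotientGroup.mk_inv,
    inv_mul_eq_one] at h ⊢
  rw [← conj_pow]
  exact congrArg (· ^ k) h

theorem VirtFree.conj_of_pow (hA : VirtFree A) {a b : A} {g : ℕ} (hg : 0 < g)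
    (ha : ¬IsOfFinOrder a) (h : IsConj (a ^ g) (b ^ g)) : IsConj a b := by
  obtain ⟨c, hc⟩ := isConj_iff.1 h
  rw [← conj_pow] at hc
  refine isConj_iff.2 ⟨c, hA.eq_of_pow_eq hg hc fun hf => ha ?_⟩
  have := (MonoidHom.isOfFinOrder (MulAut.conj c).symm.toMonoidHom hf)
  simpa [mul_assoc] using this

theorem VirtFree.conj (hA : VirtFree A) (a a' : A) (hn : ¬IsConj a a') :
    ∀ᶠ N in profin A, ∀ y, a'⁻¹ * (y * a * y⁻¹) ∉ N := by
  by_cases ha : IsOfFinOrder a <;> by_cases ha' : IsOfFinOrder a'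
  · obtain ⟨Q, _, _, T, -, hT, -⟩ := hA.kernel
    filter_upwards [eventually_le_ker T] with N hN y hy
    have h1 := hN hy
    rw [MonoidHom.mem_ker, map_mul, map_inv, map_mul, map_mul, map_inv, mul_inv_cancel_comm,
      inv_mul_eq_one] at h1
    exact hn (hT a a' ha ha' h1.symm)
  · obtain ⟨o, ho, hao⟩ := isOfFinOrder_iff_pow_eq_one.1 ha
    obtain ⟨N₀, hN₀, hN₀f, h⟩ := eventually_profin.1 (hA.eventually_notMem (z := a' ^ o)
      fun h => ha' (isOfFinOrder_iff_pow_eq_one.2 ⟨o, ho, h⟩))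
    filter_upwards [eventually_le_of_finiteIndex N₀] with N hN y hy
    have h1 := mem_pow_of_normal hN₀ (hN hy) o
    rw [hao, mul_one, mul_inv_cancel, mul_one, inv_mem_iff] at h1
    exact h N₀ le_rfl h1
  · obtain ⟨o, ho, hao⟩ := isOfFinOrder_iff_pow_eq_one.1 ha'
    obtain ⟨N₀, hN₀, hN₀f, h⟩ := eventually_profin.1 (hA.eventually_notMem (z := a ^ o)
      fun h => ha (isOfFinOrder_iff_pow_eq_one.2 ⟨o, ho, h⟩))
    filter_upwards [eventually_le_of_finiteIndex N₀] with N hN y hy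
    have h1 := mem_pow_of_normal hN₀ (hN hy) o
    rw [hao, inv_one, one_mul] at h1
    have h2 := hN₀.conj_mem _ h1 y⁻¹
    exact h N₀ le_rfl (by simpa [mul_assoc] using h2)
  · obtain ⟨x, y, hx, hy, hxy, H⟩ := hA.separates ha' ha
    filter_upwards [H (x + y + 1) (by omega)] with N hN v hv
    rcases hN 1 1 v (by simpa using hv) with ⟨h1, -⟩ | ⟨ε, g, hε, hg, hc, h1⟩
    · have := Int.le_of_dvd one_pos h1
      omega
    · rcases hε with rfl | rfl
      · have h2 : (1 : ℤ) * y - 1 * 1 * x = 0 := Int.eq_zero_of_abs_lt_dvd h1 (by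
          rw [abs_lt]; push_cast; constructor <;> omega)
        have h3 : x = y := by omega
        subst h3
        rw [Nat.coprime_self] at hxy
        subst hxy
        simp only [mul_one, Nat.cast_one, one_mul, zpow_natCast] at hc
        exact hn (hA.conj_of_pow hg ha' hc).symm
      · have h2 : (1 : ℤ) * y - -1 * 1 * x = 0 := Int.eq_zero_of_abs_lt_dvd h1 (by
          rw [abs_lt]; push_cast; constructor <;> omega)
        omega

theorem VirtFree.free_of_isOfFinOrder (hA : VirtFree A) {a u : A} (hu : ¬IsOfFinOrder u)
    (ha : IsOfFinOrder a) (ha1 : a ≠ 1) :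
    ∃ p : ℕ, p.Prime ∧ ∀ᶠ N in profin A, ∀ (i l : ℤ) y,
      (a ^ i)⁻¹ * (y * u ^ l * y⁻¹) ∈ N → (p : ℤ) ∣ i := by
  have ho : 0 < orderOf a := ha.orderOf_pos
  refine ⟨(orderOf a).minFac, Nat.minFac_prime (by simpa using ha1), ?_⟩
  have h0 : ∀ᶠ N in profin A, ∀ j : Fin (orderOf a), a ^ (j : ℕ) ∈ N → a ^ (j : ℕ) = 1 := by
    rw [Filter.eventually_all]
    intro j
    by_cases hj : a ^ (j : ℕ) = 1
    · exact Filter.Eventually.of_forall fun N _ => hj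
    · filter_upwards [hA.eventually_notMem hj] with N hN h
      exact (hN h).elim
  obtain ⟨N₀, hN₀, hN₀f, h⟩ := eventually_profin.1 h0
  have hk0 : 0 < N₀.index := Nat.pos_of_ne_zero hN₀f.index_ne_zero
  obtain ⟨s₀, hs₀, hpot⟩ := hA.pot hu N₀ hN₀ hN₀f
  obtain ⟨N₁, hle, hN₁, hN₁f, hN₁u⟩ := hpot (orderOf a * N₀.index) (Nat.mul_pos ho hk0)
  filter_upwards [eventually_le_of_finiteIndex N₁] with N hN i l y hm
  have h1 := mem_pow_of_normal hN₁ (hN hm) (orderOf a)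
  have h2 : (a ^ i) ^ orderOf a = 1 := by
    rw [← zpow_natCast, zpow_comm, zpow_natCast, pow_orderOf_eq_one, one_zpow]
  rw [h2, inv_one, one_mul] at h1
  have h3 := hN₁.conj_mem _ h1 y⁻¹
  have h4 : u ^ (l * orderOf a : ℤ) ∈ N₁ := by
    rw [zpow_mul, zpow_natCast]; simpa [mul_assoc] using h3
  rw [hN₁u] at h4
  have h5 : (N₀.index : ℤ) ∣ l := by
    have h6 : (orderOf a : ℤ) ≠ 0 := by omega
    apply Int.dvd_of_mul_dvd_mul_right h6
    refine Dvd.dvd.trans ?_ h4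
    exact ⟨s₀, by push_cast; ring⟩
  have h6 : u ^ l ∈ N₀ := by
    obtain ⟨m, rfl⟩ := h5
    rw [zpow_mul, zpow_natCast]
    exact N₀.zpow_mem (N₀.pow_index_mem u) m
  have h7 : a ^ i ∈ N₀ := by
    have := (N₀.mul_mem_cancel_right (hN₀.conj_mem _ h6 y)).1 (hle (hN hm))
    simpa using this
  have h8 : a ^ i = 1 := by
    have h9 : a ^ (i % orderOf a).toNat = a ^ i := by
      rw [← zpow_natCast, Int.toNat_of_nonneg (Int.emod_nonneg _ (by omega)), zpow_mod_orderOf]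
    have h10 : (i % orderOf a).toNat < orderOf a := by
      have := Int.emod_lt_of_pos i (by omega : (0 : ℤ) < orderOf a)
      omega
    rw [← h9] at h7 ⊢
    exact h N₀ le_rfl ⟨_, h10⟩ h7
  rw [← orderOf_dvd_iff_zpow_eq_one] at h8
  exact (Int.natCast_dvd_natCast.2 (Nat.minFac_dvd _)).trans h8

theorem VirtFree.free (hA : VirtFree A) {a u : A} (hu : ¬IsOfFinOrder u)
    (hn : ∀ y (l : ℤ), a ≠ y * u ^ l * y⁻¹) :
    ∃ p : ℕ, p.Prime ∧ ∀ᶠ N in profin A, ∀ (i l : ℤ) y,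
      (a ^ i)⁻¹ * (y * u ^ l * y⁻¹) ∈ N → (p : ℤ) ∣ i := by
  by_cases ha : IsOfFinOrder a
  · exact hA.free_of_isOfFinOrder hu ha (by simpa using hn 1 0)
  obtain ⟨x, y, hx, hy, hxy, H⟩ := hA.separates ha hu
  by_cases hx1 : x = 1
  · refine ⟨2, Nat.prime_two, ?_⟩
    filter_upwards [H 2 two_pos] with N hN i l v hm
    rcases hN i l v hm with ⟨h1, -⟩ | ⟨ε, g, hε, hg, hc, h1⟩
    · exact h1
    · exfalso
      rw [hx1, mul_one, show ε * (g * y : ℤ) = (ε * y) * g by ring, zpow_mul, zpow_natCast] at hc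
      obtain ⟨c, hc⟩ := isConj_iff.1 (hA.conj_of_pow hg ha hc)
      exact hn c⁻¹ (ε * y) (by rw [← hc]; group)
  · refine ⟨x.minFac, Nat.minFac_prime hx1, ?_⟩
    filter_upwards [H x.minFac (Nat.minFac_pos x)] with N hN i l v hm
    rcases hN i l v hm with ⟨h1, -⟩ | ⟨ε, g, hε, hg, hc, h1⟩
    · exact h1
    · have h2 : (x.minFac : ℤ) ∣ x := Int.natCast_dvd_natCast.2 (Nat.minFac_dvd x)
      have h3 := (dvd_sub_left (h2.mul_left (ε * l))).1 h1
      have h4 : IsCoprime (x.minFac : ℤ) y :=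
        Nat.isCoprime_iff_coprime.2 (hxy.coprime_dvd_left (Nat.minFac_dvd x))
      exact h4.dvd_of_dvd_mul_right h3

theorem VirtFree.inv (hA : VirtFree A) {u : A} (hu : ¬IsOfFinOrder u) (l : ℤ)
    (hn : ¬IsConj (u ^ l) (u ^ (-l))) (q : ℕ) (hq : 0 < q) :
    ∀ᶠ N in profin A, ∀ (i j : ℤ) y, (u ^ i)⁻¹ * (y * u ^ j * y⁻¹) ∈ N → (q : ℤ) ∣ i - j := by
  obtain ⟨x, y, hx, hy, hxy, H⟩ := hA.separates hu hu
  filter_upwards [H q hq] with N hN i j v hm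
  rcases hN i j v hm with ⟨h1, h2⟩ | ⟨ε, g, hε, hg, hc, h1⟩
  · exact dvd_sub h1 h2
  · have h2 : x = y := by
      have := hA.natAbs_eq_of_isConj hu (x := (g * x : ℕ)) (y := ε * (g * y)) (by rw [zpow_natCast]; exact hc)
      have hε1 : ε.natAbs = 1 := by rcases hε with rfl | rfl <;> rfl
      simp only [Int.natAbs_mul, hε1, Int.natAbs_natCast, one_mul] at this
      exact Nat.eq_of_mul_eq_mul_left hg this
    subst h2
    rw [Nat.coprime_self] at hxy
    subst hxy
    rcases hε with rfl | rfl
    · simpa using h1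
    · exfalso
      simp only [mul_one, Nat.cast_one, neg_one_mul, zpow_neg, zpow_natCast, ← inv_pow] at hc
      obtain ⟨c, hc⟩ := isConj_iff.1 (hA.conj_of_pow hg hu hc)
      refine hn (isConj_iff.2 ⟨c, ?_⟩)
      rw [← conj_zpow, hc, inv_zpow']

theorem VirtFree.nice (hA : VirtFree A) {u : A} (hu : ¬IsOfFinOrder u) : Nice A u where
  pot := hA.pot hu
  dc := hA.dc u
  conj := hA.conj
  free := fun _ h => hA.free hu h
  inv := fun l _ h q hq => hA.inv hu l h q hq
end

theorem lift_eq_of_letters {α : Type*} [DecidableEq α] {H : Type*} [Group H]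
    (φ ψ : FreeGroup α →* H) (w : FreeGroup α)
    (h : ∀ x ∈ w.toWord, φ (FreeGroup.of x.1) = ψ (FreeGroup.of x.1)) : φ w = ψ w := by
  have key : ∀ L : List (α × Bool), (∀ x ∈ L, φ (FreeGroup.of x.1) = ψ (FreeGroup.of x.1)) →
      φ (FreeGroup.mk L) = ψ (FreeGroup.mk L) := by
    intro L
    induction L with
    | nil => intro _; simp [← FreeGroup.one_eq_mk]
    | cons a L ih =>
      intro h
      have hmk : FreeGroup.mk (a :: L) = FreeGroup.mk [a] * FreeGroup.mk L := by
        rw [FreeGroup.mul_mk]; rfl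
      have ha : φ (FreeGroup.mk [a]) = ψ (FreeGroup.mk [a]) := by
        obtain ⟨i, b⟩ := a
        have h1 := h (i, b) (by simp)
        cases b
        · have : FreeGroup.mk [(i, false)] = (FreeGroup.of i)⁻¹ := by
            simp [FreeGroup.of, FreeGroup.inv_mk, FreeGroup.invRev]
          rw [this, map_inv, map_inv, h1]
        · exact h1
      rw [hmk, map_mul, map_mul, ha, ih fun x hx => h x (by simp [hx])]
  have := key w.toWord h
  rwa [FreeGroup.mk_toWord] at this

namespace FTypeBase
variable (D : FTypeBase)

theorem mk1_pow (i : Fin D.n) :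
    (PresentedGroup.of i : D.Gp1) ^ (if (i : ℕ) < D.p then D.e i else 1) = 1 := by
  split_ifs with h
  · exact PresentedGroup.one_of_mem (rels := D.rels1) (Or.inl ⟨i, h, rfl⟩)
  · rw [pow_one]
    exact PresentedGroup.one_of_mem (rels := D.rels1) (Or.inr ⟨i, not_lt.1 h, rfl⟩)

theorem mk2_pow (i : Fin D.n) :
    (PresentedGroup.of i : D.Gp2) ^ (if (i : ℕ) < D.p then 1 else D.e i) = 1 := by
  split_ifs with h
  · rw [pow_one]
    exact PresentedGroup.one_of_mem (rels := D.rels2) (Or.inr ⟨i, h, rfl⟩)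
  · exact PresentedGroup.one_of_mem (rels := D.rels2) (Or.inl ⟨i, not_lt.1 h, rfl⟩)

theorem rels1_lift {Q : Type*} [Group Q] (f : Fin D.n → Q)
    (hf : ∀ i, f i ^ (if (i : ℕ) < D.p then D.e i else 1) = 1) :
    ∀ r ∈ D.rels1, FreeGroup.lift f r = 1 := by
  rintro r (⟨i, hi, rfl⟩ | ⟨i, hi, rfl⟩)
  · simpa [hi] using hf i
  · simpa [not_lt.2 hi] using hf i

theorem rels2_lift {Q : Type*} [Group Q] (f : Fin D.n → Q)
    (hf : ∀ i, f i ^ (if (i : ℕ) < D.p then 1 else D.e i) = 1) :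
    ∀ r ∈ D.rels2, FreeGroup.lift f r = 1 := by
  rintro r (⟨i, hi, rfl⟩ | ⟨i, hi, rfl⟩)
  · simpa [not_lt.2 hi] using hf i
  · simpa [hi] using hf i

def cyclicGens1 : CyclicGens (Fin D.n) (fun i => if (i : ℕ) < D.p then D.e i else 1) D.Gp1 where
  c := PresentedGroup.of
  pow := D.mk1_pow
  gen := PresentedGroup.closure_range_of _
  lift := fun _ _ f hf => ⟨PresentedGroup.toGroup (D.rels1_lift f hf),
    fun _ => PresentedGroup.toGroup.of _⟩

def cyclicGens2 : CyclicGens (Fin D.n) (fun i => if (i : ℕ) < D.p then 1 else D.e i) D.Gp2 where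
  c := PresentedGroup.of
  pow := D.mk2_pow
  gen := PresentedGroup.closure_range_of _
  lift := fun _ _ f hf => ⟨PresentedGroup.toGroup (D.rels2_lift f hf),
    fun _ => PresentedGroup.toGroup.of _⟩

theorem mk_pow (i : Fin D.n) : (PresentedGroup.of i : D.Gp) ^ D.e i = 1 :=
  PresentedGroup.one_of_mem (rels := D.rels) (Or.inl ⟨i, rfl⟩)

def incl1 : D.Gp1 →* D.Gp :=
  PresentedGroup.toGroup (D.rels1_lift (Q := D.Gp)
    (fun i => if (i : ℕ) < D.p then PresentedGroup.of i else 1) fun i => by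
      by_cases hi : (i : ℕ) < D.p
      · simpa only [if_pos hi] using D.mk_pow i
      · simp only [if_neg hi, one_pow])

def incl2 : D.Gp2 →* D.Gp :=
  PresentedGroup.toGroup (D.rels2_lift (Q := D.Gp)
    (fun i => if (i : ℕ) < D.p then 1 else PresentedGroup.of i) fun i => by
      by_cases hi : (i : ℕ) < D.p
      · simp only [if_pos hi, one_pow]
      · simpa only [if_neg hi] using D.mk_pow i)

theorem incl1_of (i : Fin D.n) :
    D.incl1 (PresentedGroup.of i) = if (i : ℕ) < D.p then PresentedGroup.of i else 1 := by
  rw [incl1, PresentedGroup.toGroup.of]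

theorem incl2_of (i : Fin D.n) :
    D.incl2 (PresentedGroup.of i) = if (i : ℕ) < D.p then 1 else PresentedGroup.of i := by
  rw [incl2, PresentedGroup.toGroup.of]

variable {D}

theorem incl1_imgU1 (hU : ∀ x ∈ D.U.toWord, (x.1 : ℕ) < D.p) :
    D.incl1 D.imgU1 = PresentedGroup.mk D.rels D.U :=
  lift_eq_of_letters (D.incl1.comp (PresentedGroup.mk D.rels1)) (PresentedGroup.mk D.rels) D.U
    fun x hx => (D.incl1_of x.1).trans (if_pos (hU x hx))

theorem incl2_imgV2 (hV : ∀ x ∈ D.V.toWord, D.p ≤ (x.1 : ℕ)) :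
    D.incl2 D.imgV2 = PresentedGroup.mk D.rels D.V :=
  lift_eq_of_letters (D.incl2.comp (PresentedGroup.mk D.rels2)) (PresentedGroup.mk D.rels) D.V
    fun x hx => (D.incl2_of x.1).trans (if_neg (not_lt.2 (hV x hx)))

theorem exists_lift (hU : ∀ x ∈ D.U.toWord, (x.1 : ℕ) < D.p)
    (hV : ∀ x ∈ D.V.toWord, D.p ≤ (x.1 : ℕ)) {Q : Type*} [Group Q] (f : D.Gp1 →* Q)
    (g : D.Gp2 →* Q) (hfg : f D.imgU1 = g D.imgV2⁻¹) :
    ∃ φ : D.Gp →* Q, φ.comp D.incl1 = f ∧ φ.comp D.incl2 = g := by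
  let h (i : Fin D.n) : Q :=
    if (i : ℕ) < D.p then f (PresentedGroup.of i) else g (PresentedGroup.of i)
  have h1 : FreeGroup.lift h D.U = f D.imgU1 :=
    lift_eq_of_letters (FreeGroup.lift h) (f.comp (PresentedGroup.mk D.rels1)) D.U
      fun x hx => by rw [FreeGroup.lift_apply_of]; exact if_pos (hU x hx)
  have h2 : FreeGroup.lift h D.V = g D.imgV2 :=
    lift_eq_of_letters (FreeGroup.lift h) (g.comp (PresentedGroup.mk D.rels2)) D.V
      fun x hx => by rw [FreeGroup.lift_apply_of]; exact if_neg (not_lt.2 (hV x hx))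
  have hr : ∀ r ∈ D.rels, FreeGroup.lift h r = 1 := by
    rintro r (⟨i, rfl⟩ | rfl)
    · rw [map_pow, FreeGroup.lift_apply_of]
      by_cases hi : (i : ℕ) < D.p
      · have := D.mk1_pow i
        rw [if_pos hi] at this
        simp only [h, if_pos hi]
        rw [← map_pow, this, map_one]
      · have := D.mk2_pow i
        rw [if_neg hi] at this
        simp only [h, if_neg hi]
        rw [← map_pow, this, map_one]
    · rw [map_mul, h1, h2, hfg, map_inv, inv_mul_cancel]
  refine ⟨PresentedGroup.toGroup hr, PresentedGroup.ext fun i => ?_,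
    PresentedGroup.ext fun i => ?_⟩
  · rw [MonoidHom.comp_apply, incl1_of]
    have := D.mk1_pow i
    split_ifs with hi
    · rw [PresentedGroup.toGroup.of]; exact if_pos hi
    · rw [if_neg hi, pow_one] at this
      rw [this, map_one, map_one]
  · rw [MonoidHom.comp_apply, incl2_of]
    have := D.mk2_pow i
    split_ifs with hi
    · rw [if_pos hi, pow_one] at this
      rw [this, map_one, map_one]
    · rw [PresentedGroup.toGroup.of]; exact if_neg hi

def toAmalg (hU : ∀ x ∈ D.U.toWord, (x.1 : ℕ) < D.p) (hV : ∀ x ∈ D.V.toWord, D.p ≤ (x.1 : ℕ)) :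
    Amalg D.Gp1 D.Gp2 D.Gp where
  iA := D.incl1
  iB := D.incl2
  u := D.imgU1
  w := D.imgV2⁻¹
  glue := by
    rw [map_inv, incl1_imgU1 hU, incl2_imgV2 hV, eq_inv_iff_mul_eq_one, ← map_mul]
    exact PresentedGroup.one_of_mem (rels := D.rels) (Or.inr rfl)
  gen := by
    rw [eq_top_iff, ← PresentedGroup.closure_range_of, Subgroup.closure_le]
    rintro _ ⟨i, rfl⟩
    apply Subgroup.subset_closure
    by_cases hi : (i : ℕ) < D.p
    · exact Or.inl ⟨_, (D.incl1_of i).trans (if_pos hi)⟩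
    · exact Or.inr ⟨_, (D.incl2_of i).trans (if_neg hi)⟩
  lift := fun _ _ f g h => exists_lift hU hV f g h

theorem IsFType.conjugacySeparable (hD : D.IsFType) : ConjugacySeparable D.Gp := by
  obtain ⟨-, -, -, -, hU, hV, -, -, hu, hv, -, -⟩ := hD
  intro g h hgh
  have hv' : ¬IsOfFinOrder D.imgV2⁻¹ := by rwa [isOfFinOrder_inv_iff]
  obtain ⟨Q, _, _, ψ, hψ⟩ := (toAmalg hU hV).sep_of_not_isConj
    (D.cyclicGens1.virtFree.nice hu) (D.cyclicGens2.virtFree.nice hv') g h hgh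
  refine ⟨ψ.range, inferInstance, inferInstance, ψ.rangeRestrict,
    ψ.rangeRestrict_surjective, fun hc => ?_⟩
  obtain ⟨⟨_, k, rfl⟩, hk⟩ := isConj_iff.1 hc.symm
  exact hψ k (congrArg Subtype.val hk)

end FTypeBase

theorem ConjugacySeparable.of_mulEquiv {G H : Type*} [Group G] [Group H] (f : G ≃* H)
    (hH : ConjugacySeparable H) : ConjugacySeparable G := by
  intro g h hgh
  obtain ⟨Q, i1, i2, φ, hφ, hn⟩ := hH (f g) (f h) fun hc => hgh (by
    simpa using f.symm.toMonoidHom.map_isConj hc)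
  exact ⟨Q, i1, i2, φ.comp f.toMonoidHom, hφ.comp f.surjective, hn⟩

theorem ConjugacySeparable.residuallyFinite {G : Type*} [Group G] (hG : ConjugacySeparable G) :
    ResiduallyFinite G := by
  intro g hg
  obtain ⟨Q, i1, i2, φ, -, hn⟩ := hG g 1 (by simpa using hg)
  exact ⟨Q, i1, i2, φ, fun h => hn (by simp [h])⟩

theorem ResiduallyFinite.hopfian {G : Type*} [Group G] [Group.FG G] (hG : ResiduallyFinite G) :
    Hopfian G := by
  intro φ hφ
  rw [injective_iff_map_eq_one]
  by_contra! hne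
  obtain ⟨g, hg, hg1⟩ := hne
  obtain ⟨Q, _, _, ψ, hψ⟩ := hG g hg1
  obtain ⟨S, hS, hSf⟩ := (Group.fg_iff (G := G)).1 inferInstance
  have : Finite S := hSf
  have hfin : Finite (G →* Q) := Finite.of_injective (fun (f : G →* Q) (s : S) => f s) (by
    intro f f' h
    exact MonoidHom.eq_of_eqOn_dense hS fun s hs => congrFun h ⟨s, hs⟩)
  have hinj : Function.Injective fun f : G →* Q => f.comp φ := fun f f' h =>
    (MonoidHom.cancel_right hφ).1 h
  obtain ⟨ψ', hψ'⟩ := (Finite.injective_iff_surjective.1 hinj) ψ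
  apply hψ
  rw [← hψ']
  simp [hg]

/-- Every group of F-type is conjugacy separable; in particular it is
residually finite and Hopfian. -/
theorem fType_conjugacy_separable (G : Type*) [Group G] (hG : IsFTypeGroup G) :
    ConjugacySeparable G ∧ ResiduallyFinite G ∧ Hopfian G := by
  obtain ⟨D, hD, ⟨f⟩⟩ := hG
  have hc := hD.conjugacySeparable.of_mulEquiv f
  have hfg : Group.FG D.Gp := (Group.fg_iff).2
    ⟨_, PresentedGroup.closure_range_of _, Set.finite_range _⟩
  have : Group.FG G := Group.fg_of_surjective (f := f.symm.toMonoidHom) f.symm.surjective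
  exact ⟨hc, hc.residuallyFinite, hc.residuallyFinite.hopfian⟩

end FPaper
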